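/- (Comparison principle for the linearized oblique problem) Let η_sub and η_sup be continuous on K̄₁, with η_sub a viscosity subsolution and η_sup a viscosity supersolution of the linearized oblique problem on K₁⁺. If η_sub ≤ η_sup on ∂_bK₁, then η_sub ≤ η_sup in K₁. -/

import Mathlib

open Set MeasureTheory Metric
open scoped RealInnerProductSpace

noncomputable section

abbrev Eucl (n : ℕ) : Type := EuclideanSpace ℝ (Fin n)
abbrev SpaceTime (n : ℕ) : Type := Eucl n × ℝ

/-- The operator norm of an `n × n` real matrix, acting on Euclidean space. -/
noncomputable def matOpNorm {n : ℕ} (A : Matrix (Fin n) (Fin n) ℝ) : ℝ :=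
  ‖(LinearMap.toContinuousLinearMap (Matrix.toEuclideanLin A))‖

/-- `F` is uniformly elliptic with ellipticity constant `Λ`. -/
def UniformlyElliptic {n : ℕ} (Λ : ℝ) (F : Matrix (Fin n) (Fin n) ℝ → ℝ) : Prop :=
  ∀ M N : Matrix (Fin n) (Fin n) ℝ, M.IsSymm → N.IsSymm → N.PosSemidef →
    Λ⁻¹ * matOpNorm N ≤ F (M + N) - F M ∧ F (M + N) - F M ≤ Λ * matOpNorm N

/-- Pucci minimal operator `P⁻(R, a, b) = a ∑_{eᵢ>0} eᵢ + b ∑_{eᵢ<0} eᵢ`. -/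
noncomputable def pucciMinus {n : ℕ} (R : Matrix (Fin n) (Fin n) ℝ) (a b : ℝ) : ℝ :=
  if h : R.IsHermitian then
    a * ∑ i, max (h.eigenvalues i) 0 + b * ∑ i, min (h.eigenvalues i) 0
  else 0

/-- Pucci maximal operator `P⁺(R, a, b) = a ∑_{eᵢ<0} eᵢ + b ∑_{eᵢ>0} eᵢ`. -/
noncomputable def pucciPlus {n : ℕ} (R : Matrix (Fin n) (Fin n) ℝ) (a b : ℝ) : ℝ :=
  if h : R.IsHermitian then
    a * ∑ i, min (h.eigenvalues i) 0 + b * ∑ i, max (h.eigenvalues i) 0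
  else 0

/-- Parabolic cylinder `E_ρ(x₀,t₀) = B_ρ(x₀) × (t₀ − ρ², t₀]`. -/
def cylE {n : ℕ} (x₀ : Eucl n) (t₀ ρ : ℝ) : Set (SpaceTime n) :=
  (ball x₀ ρ) ×ˢ (Ioc (t₀ - ρ ^ 2) t₀)

/-- `φ` is C² in `x` and C¹ in `t` on `D`, with time derivative `φt`,
spatial gradient `gφ` and spatial Hessian `Hφ`. -/
structure ParabolicTest {n : ℕ} (φ : SpaceTime n → ℝ) (D : Set (SpaceTime n))
    (φt : SpaceTime n → ℝ) (gφ : SpaceTime n → Eucl n)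
    (Hφ : SpaceTime n → Matrix (Fin n) (Fin n) ℝ) : Prop where
  contPhi : ContinuousOn φ D
  contPhit : ContinuousOn φt D
  contGrad : ContinuousOn gφ D
  contHess : ContinuousOn Hφ D
  symmHess : ∀ p ∈ D, (Hφ p).IsSymm
  timeDeriv : ∀ p ∈ D, HasDerivWithinAt (fun s : ℝ => φ (p.1, s)) (φt p) {s : ℝ | (p.1, s) ∈ D} p.2
  spaceGrad : ∀ p ∈ D, HasGradientWithinAt (fun y => φ (y, p.2)) (gφ p) {y | (y, p.2) ∈ D} p.1
  spaceHess : ∀ p ∈ D, HasFDerivWithinAt (fun y => gφ (y, p.2))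
      (LinearMap.toContinuousLinearMap (Matrix.toEuclideanLin (Hφ p))) {y | (y, p.2) ∈ D} p.1

/-- `φ` touches `u` from above at `p₀` in the set `E`. -/
def TouchesAbove {n : ℕ} (φ u : SpaceTime n → ℝ) (E : Set (SpaceTime n)) (p₀ : SpaceTime n) :
    Prop :=
  p₀ ∈ E ∧ φ p₀ = u p₀ ∧ ∀ p ∈ E, u p ≤ φ p

/-- `φ` touches `u` from below at `p₀` in the set `E`. -/
def TouchesBelow {n : ℕ} (φ u : SpaceTime n → ℝ) (E : Set (SpaceTime n)) (p₀ : SpaceTime n) :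
    Prop :=
  p₀ ∈ E ∧ φ p₀ = u p₀ ∧ ∀ p ∈ E, φ p ≤ u p

/-- `u` is a viscosity subsolution of `u_t = F(D²u)` in `D`. -/
def ViscSub {n : ℕ} (F : Matrix (Fin n) (Fin n) ℝ → ℝ) (u : SpaceTime n → ℝ)
    (D : Set (SpaceTime n)) : Prop :=
  ∀ (φ φt : SpaceTime n → ℝ) (gφ : SpaceTime n → Eucl n)
    (Hφ : SpaceTime n → Matrix (Fin n) (Fin n) ℝ) (p₀ : SpaceTime n) (ρ : ℝ),
    0 < ρ → p₀ ∈ D → cylE p₀.1 p₀.2 ρ ⊆ D →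
    ParabolicTest φ (cylE p₀.1 p₀.2 ρ) φt gφ Hφ →
    TouchesAbove φ u (cylE p₀.1 p₀.2 ρ) p₀ →
    φt p₀ ≤ F (Hφ p₀)

/-- `u` is a viscosity supersolution of `u_t = F(D²u)` in `D`. -/
def ViscSup {n : ℕ} (F : Matrix (Fin n) (Fin n) ℝ → ℝ) (u : SpaceTime n → ℝ)
    (D : Set (SpaceTime n)) : Prop :=
  ∀ (φ φt : SpaceTime n → ℝ) (gφ : SpaceTime n → Eucl n)
    (Hφ : SpaceTime n → Matrix (Fin n) (Fin n) ℝ) (p₀ : SpaceTime n) (ρ : ℝ),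
    0 < ρ → p₀ ∈ D → cylE p₀.1 p₀.2 ρ ⊆ D →
    ParabolicTest φ (cylE p₀.1 p₀.2 ρ) φt gφ Hφ →
    TouchesBelow φ u (cylE p₀.1 p₀.2 ρ) p₀ →
    F (Hφ p₀) ≤ φt p₀

end

/-- The last ("vertical") coordinate `xₙ` of a point in `ℝⁿ = ℝ^{d+1}`. -/
def lastC {d : ℕ} (x : Eucl (d + 1)) : ℝ := x (Fin.last d)

/-- `K_r = (B_r ∩ {xₙ > 0}) × (−r, 0]`. -/
def Kc (d : ℕ) (r : ℝ) : Set (SpaceTime (d + 1)) :=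
  {p | p.1 ∈ ball 0 r ∧ 0 < lastC p.1 ∧ p.2 ∈ Ioc (-r) 0}

/-- `F_r = (B_r ∩ {xₙ = 0}) × (−r, 0]`. -/
def Fc (d : ℕ) (r : ℝ) : Set (SpaceTime (d + 1)) :=
  {p | p.1 ∈ ball 0 r ∧ lastC p.1 = 0 ∧ p.2 ∈ Ioc (-r) 0}

/-- `K_r⁺ = K_r ∪ F_r`. -/
def KcP (d : ℕ) (r : ℝ) : Set (SpaceTime (d + 1)) := Kc d r ∪ Fc d r

/-- The Dirichlet part `∂_b K₁` of the boundary of `K₁`: the part of the topological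
boundary not contained in `F₁ ∪ ((B₁ ∩ {xₙ>0}) × {0})`. -/
def bdryK (d : ℕ) : Set (SpaceTime (d + 1)) :=
  frontier (Kc d 1) \
    (Fc d 1 ∪ {p | p.1 ∈ ball 0 1 ∧ 0 < lastC p.1 ∧ p.2 = 0})

/-- Coefficient data for the linearized oblique problem: `Q` is symmetric, uniformly
elliptic, differentiable (entrywise, with derivative `Q'`) with `‖Q'‖ ≤ C₀/λ`, and the
oblique vector `v` is differentiable with `vₙ ≥ M⁻¹`, `|v| ≤ M`, `|v'| ≤ λ⁻¹`. -/
structure ObliqueData (d : ℕ) (lam Λ M C₀ : ℝ)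
    (Q Q' : ℝ → Matrix (Fin (d + 1)) (Fin (d + 1)) ℝ)
    (v v' : ℝ → Eucl (d + 1)) : Prop where
  lam_pos : 0 < lam
  lam_le_one : lam ≤ 1
  Lam_ge_one : 1 ≤ Λ
  M_ge_one : 1 ≤ M
  C0_pos : 0 < C₀
  Qsymm : ∀ t ∈ Icc (-1 : ℝ) 0, (Q t).IsSymm
  Qlower : ∀ t ∈ Icc (-1 : ℝ) 0,
    (Q t - (Λ * M ^ 2)⁻¹ • (1 : Matrix (Fin (d + 1)) (Fin (d + 1)) ℝ)).PosSemidef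
  Qupper : ∀ t ∈ Icc (-1 : ℝ) 0,
    ((Λ * M ^ 2) • (1 : Matrix (Fin (d + 1)) (Fin (d + 1)) ℝ) - Q t).PosSemidef
  Qderiv : ∀ t ∈ Icc (-1 : ℝ) 0, ∀ i j,
    HasDerivWithinAt (fun s => Q s i j) (Q' t i j) (Icc (-1 : ℝ) 0) t
  Qderiv_bound : ∀ t ∈ Icc (-1 : ℝ) 0, matOpNorm (Q' t) ≤ C₀ / lam
  vderiv : ∀ t ∈ Icc (-1 : ℝ) 0, HasDerivWithinAt v (v' t) (Icc (-1 : ℝ) 0) t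
  vlast : ∀ t ∈ Icc (-1 : ℝ) 0, M⁻¹ ≤ lastC (v t)
  vbound : ∀ t ∈ Icc (-1 : ℝ) 0, ‖v t‖ ≤ M
  vderiv_bound : ∀ t ∈ Icc (-1 : ℝ) 0, ‖v' t‖ ≤ lam⁻¹

/-- `η` is a viscosity subsolution of the linearized oblique problem
`λ η_t = tr(Q(t) D²η)` in `K₁`, `η_t = v(t)·∇η` on `F₁`. -/
def ObliqueSub (d : ℕ) (lam : ℝ) (Q : ℝ → Matrix (Fin (d + 1)) (Fin (d + 1)) ℝ)
    (v : ℝ → Eucl (d + 1)) (η : SpaceTime (d + 1) → ℝ) : Prop :=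
  ContinuousOn η (KcP d 1) ∧
  ∀ (φ φt : SpaceTime (d + 1) → ℝ) (gφ : SpaceTime (d + 1) → Eucl (d + 1))
    (Hφ : SpaceTime (d + 1) → Matrix (Fin (d + 1)) (Fin (d + 1)) ℝ)
    (p₀ : SpaceTime (d + 1)) (ρ : ℝ),
    0 < ρ →
    ParabolicTest φ (cylE p₀.1 p₀.2 ρ ∩ closure (Kc d 1)) φt gφ Hφ →
    TouchesAbove φ η (cylE p₀.1 p₀.2 ρ ∩ closure (Kc d 1)) p₀ →
    (p₀ ∈ Kc d 1 → lam * φt p₀ ≤ (Q p₀.2 * Hφ p₀).trace) ∧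
    (p₀ ∈ Fc d 1 → φt p₀ ≤ ⟪v p₀.2, gφ p₀⟫)

/-- `η` is a viscosity supersolution of the linearized oblique problem. -/
def ObliqueSup (d : ℕ) (lam : ℝ) (Q : ℝ → Matrix (Fin (d + 1)) (Fin (d + 1)) ℝ)
    (v : ℝ → Eucl (d + 1)) (η : SpaceTime (d + 1) → ℝ) : Prop :=
  ContinuousOn η (KcP d 1) ∧
  ∀ (φ φt : SpaceTime (d + 1) → ℝ) (gφ : SpaceTime (d + 1) → Eucl (d + 1))
    (Hφ : SpaceTime (d + 1) → Matrix (Fin (d + 1)) (Fin (d + 1)) ℝ)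
    (p₀ : SpaceTime (d + 1)) (ρ : ℝ),
    0 < ρ →
    ParabolicTest φ (cylE p₀.1 p₀.2 ρ ∩ closure (Kc d 1)) φt gφ Hφ →
    TouchesBelow φ η (cylE p₀.1 p₀.2 ρ ∩ closure (Kc d 1)) p₀ →
    (p₀ ∈ Kc d 1 → (Q p₀.2 * Hφ p₀).trace ≤ lam * φt p₀) ∧
    (p₀ ∈ Fc d 1 → ⟪v p₀.2, gφ p₀⟫ ≤ φt p₀)

/-- `η` is a viscosity solution of the linearized oblique problem on `K₁⁺`. -/
def ObliqueSolution (d : ℕ) (lam : ℝ) (Q : ℝ → Matrix (Fin (d + 1)) (Fin (d + 1)) ℝ)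
    (v : ℝ → Eucl (d + 1)) (η : SpaceTime (d + 1) → ℝ) : Prop :=
  ObliqueSub d lam Q v η ∧ ObliqueSup d lam Q v η

/-- The distance `|x' − y'|` between the horizontal projections. -/
noncomputable def primeDist {d : ℕ} (x y : Eucl (d + 1)) : ℝ :=
  Real.sqrt (∑ i : Fin d, (x i.castSucc - y i.castSucc) ^ 2)

/-- The boundary-adapted parabolic distance `d(·,·)`. -/
noncomputable def pdist {d : ℕ} (P₁ P₂ : SpaceTime (d + 1)) : ℝ :=
  primeDist P₁.1 P₂.1 +
    min (|lastC P₁.1| + |lastC P₂.1| + |P₁.2 - P₂.2|)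
      (|lastC P₁.1 - lastC P₂.1| + Real.sqrt |P₁.2 - P₂.2|)

/-- The rescaled distance `d_λ(P₁,P₂) = λ⁻¹ d(λP₁, λP₂)`. -/
noncomputable def pdistL {d : ℕ} (lam : ℝ) (P₁ P₂ : SpaceTime (d + 1)) : ℝ :=
  lam⁻¹ * pdist (lam • P₁.1, lam * P₁.2) (lam • P₂.1, lam * P₂.2)

noncomputable def mclm {n : ℕ} (A : Matrix (Fin n) (Fin n) ℝ) : Eucl n →L[ℝ] Eucl n :=
  LinearMap.toContinuousLinearMap (Matrix.toEuclideanLin A)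

lemma mclm_add {n : ℕ} (A B : Matrix (Fin n) (Fin n) ℝ) : mclm (A + B) = mclm A + mclm B := by
  ext x i; simp [mclm]

lemma mclm_smul {n : ℕ} (c : ℝ) (A : Matrix (Fin n) (Fin n) ℝ) : mclm (c • A) = c • mclm A := by
  ext x i; simp [mclm]

lemma mclm_one {n : ℕ} : mclm (1 : Matrix (Fin n) (Fin n) ℝ) = ContinuousLinearMap.id ℝ _ := by
  ext x i; simp [mclm, Matrix.toEuclideanLin]

lemma mclm_vecMulVec {n : ℕ} (a b : Eucl n) :
    mclm (Matrix.vecMulVec a b) = (innerSL ℝ b).smulRight a := by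
  ext x i
  simp [mclm, Matrix.toEuclideanLin, Matrix.vecMulVec_mulVec, PiLp.inner_apply, dotProduct, mul_comm]

/-- global smooth test functions -/
def GT {n : ℕ} (φ : SpaceTime n → ℝ) (φt : SpaceTime n → ℝ) (gφ : SpaceTime n → Eucl n)
    (Hφ : SpaceTime n → Matrix (Fin n) (Fin n) ℝ) : Prop :=
  ParabolicTest φ univ φt gφ Hφ

lemma GT.mono {n : ℕ} {φ φt : SpaceTime n → ℝ} {g : SpaceTime n → Eucl n}
    {H : SpaceTime n → Matrix (Fin n) (Fin n) ℝ} (h : GT φ φt g H) (D : Set (SpaceTime n)) :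
    ParabolicTest φ D φt g H where
  contPhi := h.contPhi.mono (subset_univ _)
  contPhit := h.contPhit.mono (subset_univ _)
  contGrad := h.contGrad.mono (subset_univ _)
  contHess := h.contHess.mono (subset_univ _)
  symmHess := fun p _ => h.symmHess p trivial
  timeDeriv := fun p _ => (h.timeDeriv p trivial).mono (fun _ _ => trivial)
  spaceGrad := fun p _ => HasFDerivWithinAt.hasGradientWithinAt
    ((h.spaceGrad p trivial).hasFDerivWithinAt.mono (fun _ _ => trivial)) |> fun h => by simpa using h
  spaceHess := fun p _ => (h.spaceHess p trivial).mono (fun _ _ => trivial)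

lemma GT.mk' {n : ℕ} {φ φt : SpaceTime n → ℝ} {g : SpaceTime n → Eucl n}
    {H : SpaceTime n → Matrix (Fin n) (Fin n) ℝ}
    (h1 : Continuous φ) (h2 : Continuous φt) (h3 : Continuous g) (h4 : Continuous H)
    (h5 : ∀ p, (H p).IsSymm) (h6 : ∀ x t, HasDerivAt (fun s => φ (x, s)) (φt (x, t)) t)
    (h7 : ∀ x t, HasFDerivAt (fun y => φ (y, t)) (innerSL ℝ (g (x, t))) x)
    (h8 : ∀ x t, HasFDerivAt (fun y => g (y, t)) (mclm (H (x, t))) x) : GT φ φt g H where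
  contPhi := h1.continuousOn
  contPhit := h2.continuousOn
  contGrad := h3.continuousOn
  contHess := h4.continuousOn
  symmHess := fun p _ => h5 p
  timeDeriv := fun p _ => (h6 p.1 p.2).hasDerivWithinAt
  spaceGrad := fun p _ => by
    rw [hasGradientWithinAt_iff_hasFDerivWithinAt]
    exact (h7 p.1 p.2).hasFDerivWithinAt
  spaceHess := fun p _ => (h8 p.1 p.2).hasFDerivWithinAt

lemma GT.elim {n : ℕ} {φ φt : SpaceTime n → ℝ} {g : SpaceTime n → Eucl n}
    {H : SpaceTime n → Matrix (Fin n) (Fin n) ℝ} (h : GT φ φt g H) :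
    Continuous φ ∧ Continuous φt ∧ Continuous g ∧ Continuous H ∧ (∀ p, (H p).IsSymm) ∧
    (∀ x t, HasDerivAt (fun s => φ (x, s)) (φt (x, t)) t) ∧
    (∀ x t, HasFDerivAt (fun y => φ (y, t)) (innerSL ℝ (g (x, t))) x) ∧
    (∀ x t, HasFDerivAt (fun y => g (y, t)) (mclm (H (x, t))) x) := by
  refine ⟨continuousOn_univ.1 h.contPhi, continuousOn_univ.1 h.contPhit,
    continuousOn_univ.1 h.contGrad, continuousOn_univ.1 h.contHess,
    fun p => h.symmHess p trivial, fun x t => ?_, fun x t => ?_, fun x t => ?_⟩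
  · simpa using h.timeDeriv (x, t) trivial
  · have := h.spaceGrad (x, t) trivial
    rw [hasGradientWithinAt_iff_hasFDerivWithinAt] at this
    simp only [mem_univ, setOf_true] at this
    exact hasFDerivWithinAt_univ.1 this
  · have := h.spaceHess (x, t) trivial
    simp only [mem_univ, setOf_true] at this
    exact hasFDerivWithinAt_univ.1 this

lemma GT.mul {n : ℕ} {φ φt ψ ψt : SpaceTime n → ℝ} {g k : SpaceTime n → Eucl n}
    {H J : SpaceTime n → Matrix (Fin n) (Fin n) ℝ} (h : GT φ φt g H) (h' : GT ψ ψt k J) :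
    GT (fun p => φ p * ψ p) (fun p => φt p * ψ p + φ p * ψt p)
      (fun p => φ p • k p + ψ p • g p)
      (fun p => φ p • J p + ψ p • H p + (Matrix.vecMulVec (k p) (g p) +
        Matrix.vecMulVec (g p) (k p))) := by
  obtain ⟨a1, a2, a3, a4, a5, a6, a7, a8⟩ := h.elim
  obtain ⟨b1, b2, b3, b4, b5, b6, b7, b8⟩ := h'.elim
  refine GT.mk' (by fun_prop) (by fun_prop) (by fun_prop) ?_ ?_ ?_ ?_ ?_
  · refine ((a1.smul b4).add (b1.smul a4)).add (Continuous.add ?_ ?_)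
    · apply continuous_matrix; intro i j; simp only [Matrix.vecMulVec_apply]; fun_prop
    · apply continuous_matrix; intro i j; simp only [Matrix.vecMulVec_apply]; fun_prop
  · intro p
    have := a5 p; have := b5 p
    unfold Matrix.IsSymm at *
    rw [Matrix.transpose_add, Matrix.transpose_add, Matrix.transpose_add, Matrix.transpose_smul,
      Matrix.transpose_smul, Matrix.transpose_vecMulVec, Matrix.transpose_vecMulVec, a5 p, b5 p,
      add_comm (Matrix.vecMulVec (k p) (g p))]
  · intro x t; exact (a6 x t).mul (b6 x t)
  · intro x t
    refine HasFDerivAt.congr_fderiv ((a7 x t).mul (b7 x t)) ?_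
    ext y; simp [inner_add_left, inner_smul_left]
  · intro x t
    refine HasFDerivAt.congr_fderiv (((a7 x t).smul (b8 x t)).add ((b7 x t).smul (a8 x t))) ?_
    rw [mclm_add, mclm_add, mclm_add, mclm_smul, mclm_smul, mclm_vecMulVec, mclm_vecMulVec]
    ext y : 1; simp; abel

lemma GT.add {n : ℕ} {φ φt ψ ψt : SpaceTime n → ℝ} {g k : SpaceTime n → Eucl n}
    {H J : SpaceTime n → Matrix (Fin n) (Fin n) ℝ} (h : GT φ φt g H) (h' : GT ψ ψt k J) :
    GT (fun p => φ p + ψ p) (fun p => φt p + ψt p)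
      (fun p => g p + k p) (fun p => H p + J p) := by
  obtain ⟨a1, a2, a3, a4, a5, a6, a7, a8⟩ := h.elim
  obtain ⟨b1, b2, b3, b4, b5, b6, b7, b8⟩ := h'.elim
  refine GT.mk' (by fun_prop) (by fun_prop) (by fun_prop) (by fun_prop) ?_ ?_ ?_ ?_
  · intro p; exact (a5 p).add (b5 p)
  · intro x t; exact (a6 x t).add (b6 x t)
  · intro x t
    refine HasFDerivAt.congr_fderiv ((a7 x t).add (b7 x t)) ?_
    ext y; simp [inner_add_left]
  · intro x t
    refine HasFDerivAt.congr_fderiv ((a8 x t).add (b8 x t)) ?_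
    rw [mclm_add]

/-- functions of time -/
lemma GT.time {n : ℕ} (f f' : ℝ → ℝ) (hf : ∀ t, HasDerivAt f (f' t) t) (hc : Continuous f') :
    GT (n := n) (fun p => f p.2) (fun p => f' p.2) (fun _ => 0) (fun _ => 0) := by
  have : Continuous f := continuous_iff_continuousAt.2 fun t => (hf t).continuousAt
  refine GT.mk' (by fun_prop) (by fun_prop) (by fun_prop) (by fun_prop) ?_ ?_ ?_ ?_
  · intro p; simp [Matrix.IsSymm]
  · intro x t; exact hf t
  · intro x t; simpa using hasFDerivAt_const _ _
  · intro x t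
    refine HasFDerivAt.congr_fderiv (hasFDerivAt_const (0 : Eucl n) x) ?_
    ext; simp [mclm]

/-- ridge functions -/
lemma GT.ridge {n : ℕ} (f f' f'' : ℝ → ℝ) (k : Eucl n) (hf : ∀ t, HasDerivAt f (f' t) t)
    (hf' : ∀ t, HasDerivAt f' (f'' t) t) (hc : Continuous f'') :
    GT (n := n) (fun p => f ⟪k, p.1⟫) (fun _ => 0) (fun p => f' ⟪k, p.1⟫ • k)
      (fun p => f'' ⟪k, p.1⟫ • Matrix.vecMulVec k k) := by
  have c1 : Continuous f := continuous_iff_continuousAt.2 fun t => (hf t).continuousAt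
  have c2 : Continuous f' := continuous_iff_continuousAt.2 fun t => (hf' t).continuousAt
  have hl : ∀ x : Eucl n, HasFDerivAt (fun y : Eucl n => ⟪k, y⟫) (innerSL ℝ k) x := fun x =>
    (innerSL ℝ k).hasFDerivAt
  refine GT.mk' (by fun_prop) (by fun_prop) (by fun_prop) (by fun_prop) ?_ ?_ ?_ ?_
  · intro p; simp [Matrix.IsSymm, Matrix.transpose_vecMulVec]
  · intro x t; simpa using hasDerivAt_const _ _
  · intro x t
    refine HasFDerivAt.congr_fderiv ((hf ⟪k, x⟫).comp_hasFDerivAt x (hl x)) ?_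
    ext y; simp [inner_smul_left]
  · intro x t
    refine HasFDerivAt.congr_fderiv (((hf' ⟪k, x⟫).comp_hasFDerivAt x (hl x)).smul_const k) ?_
    rw [mclm_smul, mclm_vecMulVec]
    ext y : 1; simp [smul_smul]

lemma GT.normsq {n : ℕ} (a : Eucl n) :
    GT (n := n) (fun p => ‖p.1 - a‖ ^ 2) (fun _ => 0) (fun p => (2 : ℝ) • (p.1 - a))
      (fun _ => (2 : ℝ) • 1) := by
  refine GT.mk' (by fun_prop) (by fun_prop) (by fun_prop) (by fun_prop) ?_ ?_ ?_ ?_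
  · intro p; simp [Matrix.IsSymm]
  · intro x t; simpa using hasDerivAt_const _ _
  · intro x t
    refine HasFDerivAt.congr_fderiv (((hasFDerivAt_id x).sub_const a).norm_sq) ?_
    ext y; simp [inner_smul_left]
  · intro x t
    refine HasFDerivAt.congr_fderiv (((hasFDerivAt_id x).sub_const a).const_smul (2 : ℝ)) ?_
    rw [mclm_smul, mclm_one]

lemma GT.const {n : ℕ} (c : ℝ) :
    GT (n := n) (fun _ => c) (fun _ => 0) (fun _ => 0) (fun _ => 0) :=
  GT.time (fun _ => c) (fun _ => 0) (fun _ => hasDerivAt_const _ _) continuous_const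

lemma GT.cmul {n : ℕ} {φ φt : SpaceTime n → ℝ} {g : SpaceTime n → Eucl n}
    {H : SpaceTime n → Matrix (Fin n) (Fin n) ℝ} (c : ℝ) (h : GT φ φt g H) :
    GT (fun p => c * φ p) (fun p => c * φt p) (fun p => c • g p) (fun p => c • H p) := by
  have := (GT.const (n := n) c).mul h
  convert this using 2 <;> simp

lemma GT.sum {n : ℕ} {ι : Type*} (s : Finset ι) {φ φt : ι → SpaceTime n → ℝ}
    {g : ι → SpaceTime n → Eucl n} {H : ι → SpaceTime n → Matrix (Fin n) (Fin n) ℝ}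
    (h : ∀ i ∈ s, GT (φ i) (φt i) (g i) (H i)) :
    GT (fun p => ∑ i ∈ s, φ i p) (fun p => ∑ i ∈ s, φt i p) (fun p => ∑ i ∈ s, g i p)
      (fun p => ∑ i ∈ s, H i p) := by
  classical
  induction s using Finset.induction_on with
  | empty => simpa using GT.const (n := n) 0
  | insert a s ha ih =>
    simp only [Finset.sum_insert ha]
    exact (h a (by simp)).add (ih fun i hi => h i (by simp [hi]))

lemma GT.neg {n : ℕ} {φ φt : SpaceTime n → ℝ} {g : SpaceTime n → Eucl n}
    {H : SpaceTime n → Matrix (Fin n) (Fin n) ℝ} (h : GT φ φt g H) :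
    GT (fun p => - φ p) (fun p => - φt p) (fun p => - g p) (fun p => - H p) := by
  convert h.cmul (-1) using 2 <;> simp

lemma lastC_cont {d : ℕ} : Continuous (lastC (d := d)) := by unfold lastC; fun_prop

lemma lastC_add {d : ℕ} (x y : Eucl (d+1)) : lastC (x + y) = lastC x + lastC y := rfl
lemma lastC_sub {d : ℕ} (x y : Eucl (d+1)) : lastC (x - y) = lastC x - lastC y := rfl
lemma lastC_smul {d : ℕ} (c : ℝ) (y : Eucl (d+1)) : lastC (c • y) = c * lastC y := rfl

/-- last basis vector -/
noncomputable def eL (d : ℕ) : Eucl (d+1) := EuclideanSpace.single (Fin.last d) 1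

lemma lastC_eL {d : ℕ} : lastC (eL d) = 1 := by simp [lastC, eL]
lemma norm_eL {d : ℕ} : ‖eL d‖ = 1 := by simp [eL]
lemma inner_eL {d : ℕ} (x : Eucl (d+1)) : ⟪eL d, x⟫ = lastC x := by
  rw [eL, EuclideanSpace.inner_single_left]; simp [lastC]
lemma inner_eL' {d : ℕ} (x : Eucl (d+1)) : ⟪x, eL d⟫ = lastC x := by
  rw [real_inner_comm, inner_eL]
lemma abs_lastC_le {d : ℕ} (x : Eucl (d+1)) : |lastC x| ≤ ‖x‖ := by
  have := abs_real_inner_le_norm (eL d) x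
  rwa [inner_eL, norm_eL, one_mul] at this

lemma mem_Kc {d : ℕ} {p : SpaceTime (d+1)} :
    p ∈ Kc d 1 ↔ ‖p.1‖ < 1 ∧ 0 < lastC p.1 ∧ -1 < p.2 ∧ p.2 ≤ 0 := by
  simp [Kc]

lemma mem_Fc {d : ℕ} {p : SpaceTime (d+1)} :
    p ∈ Fc d 1 ↔ ‖p.1‖ < 1 ∧ lastC p.1 = 0 ∧ -1 < p.2 ∧ p.2 ≤ 0 := by
  simp [Fc]

lemma mem_KcP {d : ℕ} {p : SpaceTime (d+1)} :
    p ∈ KcP d 1 ↔ ‖p.1‖ < 1 ∧ 0 ≤ lastC p.1 ∧ -1 < p.2 ∧ p.2 ≤ 0 := by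
  rw [KcP, mem_union, mem_Kc, mem_Fc]
  constructor
  · rintro (⟨a, b, c⟩ | ⟨a, b, c⟩)
    · exact ⟨a, b.le, c⟩
    · exact ⟨a, b.ge, c⟩
  · rintro ⟨a, b, c⟩
    rcases b.lt_or_eq with h | h
    · exact Or.inl ⟨a, h, c⟩
    · exact Or.inr ⟨a, h.symm, c⟩

lemma clK_sub {d : ℕ} {p : SpaceTime (d+1)} (hp : p ∈ closure (Kc d 1)) :
    ‖p.1‖ ≤ 1 ∧ 0 ≤ lastC p.1 ∧ -1 ≤ p.2 ∧ p.2 ≤ 0 := by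
  have hc : IsClosed {p : SpaceTime (d+1) | ‖p.1‖ ≤ 1 ∧ 0 ≤ lastC p.1 ∧ -1 ≤ p.2 ∧ p.2 ≤ 0} := by
    have := lastC_cont (d := d)
    simp only [setOf_and]
    exact (isClosed_le (by fun_prop) (by fun_prop)).inter
      ((isClosed_le (by fun_prop) (by fun_prop)).inter
      ((isClosed_le (by fun_prop) (by fun_prop)).inter (isClosed_le (by fun_prop) (by fun_prop))))
  exact closure_minimal (fun q hq => by
    rw [mem_Kc] at hq; exact ⟨hq.1.le, hq.2.1.le, hq.2.2.1.le, hq.2.2.2⟩) hc hp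

lemma KcP_sub_cl {d : ℕ} : KcP d 1 ⊆ closure (Kc d 1) := by
  rintro p hp
  rw [mem_KcP] at hp
  obtain ⟨h1, h2, h3, h4⟩ := hp
  rw [Metric.mem_closure_iff]
  intro ε hε
  set δ := min (ε/2) ((1 - ‖p.1‖)/2) with hδ
  have hδ0 : 0 < δ := lt_min (by linarith) (by linarith)
  refine ⟨(p.1 + δ • eL d, p.2), ?_, ?_⟩
  · rw [mem_Kc]
    refine ⟨?_, ?_, h3, h4⟩
    · have := norm_add_le p.1 (δ • eL d)
      rw [norm_smul, norm_eL, Real.norm_of_nonneg hδ0.le] at this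
      have := min_le_right (ε/2) ((1 - ‖p.1‖)/2)
      simp only; linarith
    · simp only [lastC_add, lastC_smul, lastC_eL]; linarith
  · rw [Prod.dist_eq]
    simp only [dist_self, dist_self_add_right, norm_smul, norm_eL, Real.norm_of_nonneg hδ0.le]
    have := min_le_left (ε/2) ((1 - ‖p.1‖)/2)
    rw [max_eq_left (by linarith)]; linarith

lemma clK_compact {d : ℕ} : IsCompact (closure (Kc d 1)) := by
  refine IsCompact.of_isClosed_subset ((isCompact_closedBall (0 : Eucl (d+1)) 1).prod
    (isCompact_Icc (a := (-1:ℝ)) (b := 0))) isClosed_closure ?_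
  intro p hp
  obtain ⟨h1, h2, h3, h4⟩ := clK_sub hp
  exact ⟨by simpa using h1, h3, h4⟩

lemma clK_not_bdry {d : ℕ} {p : SpaceTime (d+1)} (hp : p ∈ closure (Kc d 1)) (hb : p ∉ bdryK d) :
    p ∈ KcP d 1 := by
  by_cases hf : p ∈ frontier (Kc d 1)
  · have : p ∈ Fc d 1 ∪ {p | p.1 ∈ ball 0 1 ∧ 0 < lastC p.1 ∧ p.2 = 0} := by
      by_contra h; exact hb ⟨hf, h⟩
    rcases this with h | h
    · exact Or.inr h
    · refine Or.inl ⟨h.1, h.2.1, ?_⟩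
      have := h.2.2
      simp [this]
  · have : p ∈ interior (Kc d 1) := by
      by_contra h; exact hf ⟨hp, h⟩
    exact Or.inl (interior_subset this)

lemma sup_neg {d : ℕ} {lam : ℝ} {Q : ℝ → Matrix (Fin (d + 1)) (Fin (d + 1)) ℝ}
    {v : ℝ → Eucl (d + 1)} {w : SpaceTime (d + 1) → ℝ} (h : ObliqueSup d lam Q v w) :
    ObliqueSub d lam Q v (fun p => - w p) := by
  refine ⟨h.1.neg, fun φ φt g H p₀ ρ hρ hT hab => ?_⟩
  have := h.2 (fun p => - φ p) (fun p => - φt p) (fun p => - g p) (fun p => - H p) p₀ ρ hρ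
    ⟨hT.contPhi.neg, hT.contPhit.neg, hT.contGrad.neg, hT.contHess.neg,
      fun p hp => by have := hT.symmHess p hp; simp only [Matrix.IsSymm, Matrix.transpose_neg] at *; rw [this],
      fun p hp => (hT.timeDeriv p hp).neg, fun p hp => by
        have := hT.spaceGrad p hp
        rw [hasGradientWithinAt_iff_hasFDerivWithinAt] at *
        rw [map_neg]; exact this.neg, fun p hp => by
        have := (hT.spaceHess p hp).neg
        rw [map_neg, map_neg]; exact this⟩
    ⟨hab.1, by have := hab.2.1; simp only at *; rw [this, neg_neg], fun p hp => by have := hab.2.2 p hp; linarith⟩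
  simp only [inner_neg_right, mul_neg, Matrix.trace_neg, neg_le_neg_iff] at this
  exact this

open Filter Topology in
lemma penal {Z : Type*} [MetricSpace Z] {C : Set Z} (hC : IsCompact C) {f g : Z → ℝ}
    (hf : ContinuousOn f C) (hg : ContinuousOn g C) (hg0 : ∀ z, 0 ≤ g z) {zh : Z} (hz : zh ∈ C)
    (hgz : g zh = 0) :
    ∃ zs ∈ C, g zs = 0 ∧ f zh ≤ f zs ∧ ∀ U ∈ 𝓝 zs, ∀ η > 0, ∃ ε, 0 < ε ∧ ε < 1 ∧ ∃ z ∈ C, z ∈ U ∧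
      g z ≤ η * ε ∧ ∀ z' ∈ C, f z' - g z' / (2 * ε) ≤ f z - g z / (2 * ε) := by
  set e : ℕ → ℝ := fun k => 1 / ((k:ℝ) + 2) with he
  have e0 : ∀ k, 0 < e k := fun k => by positivity
  have e1 : ∀ k, e k < 1 := fun k => by
    rw [he]; simp only; rw [div_lt_one (by positivity)]
    have : (0:ℝ) ≤ k := by positivity
    linarith
  have elim : Tendsto e atTop (𝓝 0) := by
    have := tendsto_one_div_add_atTop_nhds_zero_nat (𝕜 := ℝ)
    have h2 := (tendsto_add_atTop_iff_nat 1).2 this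
    refine h2.congr fun k => ?_
    simp only [he]; push_cast; ring_nf
  have hmax : ∀ k, ∃ z ∈ C, ∀ z' ∈ C, f z' - g z' / (2 * e k) ≤ f z - g z / (2 * e k) := fun k => by
    have := hC.exists_isMaxOn ⟨zh, hz⟩ (f := fun z => f z - g z / (2 * e k))
      (hf.sub (hg.div_const _))
    obtain ⟨z, hz, h⟩ := this
    exact ⟨z, hz, fun z' hz' => h hz'⟩
  choose z hzC hzm using hmax
  obtain ⟨zs, hzs, σ, hσ, hlim⟩ := hC.tendsto_subseq hzC
  have hwithin : Tendsto (z ∘ σ) atTop (𝓝[C] zs) :=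
    tendsto_nhdsWithin_iff.2 ⟨hlim, Eventually.of_forall fun k => hzC _⟩
  have hfl : Tendsto (fun k => f (z (σ k))) atTop (𝓝 (f zs)) := (hf zs hzs).tendsto.comp hwithin
  have hgl : Tendsto (fun k => g (z (σ k))) atTop (𝓝 (g zs)) := (hg zs hzs).tendsto.comp hwithin
  have hel : Tendsto (fun k => e (σ k)) atTop (𝓝 0) := elim.comp hσ.tendsto_atTop
  have hb : ∀ k, g (z k) ≤ (f (z k) - f zh) * (2 * e k) := fun k => by
    have := hzm k zh hz
    rw [hgz] at this
    have h2 := e0 k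
    have h3 : g (z k) / (2 * e k) ≤ f (z k) - f zh := by linarith [zero_div (2 * e k)]
    rwa [div_le_iff₀ (by linarith)] at h3
  have hgs : g zs = 0 := by
    have h1 : Tendsto (fun k => (f (z (σ k)) - f zh) * (2 * e (σ k))) atTop
      (𝓝 ((f zs - f zh) * (2 * 0))) := (hfl.sub_const _).mul (hel.const_mul 2)
    have := le_of_tendsto_of_tendsto' hgl h1 fun k => hb _
    have := hg0 zs
    linarith
  refine ⟨zs, hzs, hgs, ?_, ?_⟩
  · refine ge_of_tendsto' hfl fun k => ?_
    have := hb (σ k)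
    have h1 := hg0 (z (σ k))
    have h2 := e0 (σ k)
    by_contra h
    push Not at h
    nlinarith
  · intro U hU η hη
    have h1 : ∀ᶠ k in atTop, z (σ k) ∈ U := hlim hU
    have h2 : ∀ᶠ k in atTop, f (z (σ k)) < f zs + η / 2 := hfl.eventually_lt_const (by linarith)
    obtain ⟨k, hk1, hk2⟩ := (h1.and h2).exists
    refine ⟨e (σ k), e0 _, e1 _, z (σ k), hzC _, hk1, ?_, hzm _⟩
    have := hzm (σ k) zs hzs
    rw [hgs] at this
    have h3 : g (z (σ k)) / (2 * e (σ k)) ≤ η / 2 := by linarith [zero_div (2 * e (σ k))]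
    have h2 := e0 (σ k)
    rw [div_le_iff₀ (by linarith)] at h3
    linarith

/-- doubled maximum data -/
def DMax (d : ℕ) (u w : SpaceTime (d+1) → ℝ) (κ ε : ℝ) (p q : SpaceTime (d+1)) : Prop :=
  ∀ p' ∈ closure (Kc d 1), ∀ q' ∈ closure (Kc d 1), lastC p'.1 = lastC q'.1 →
    u p' - w q' - κ * p'.2 - (‖p'.1 - q'.1‖^2 + (p'.2 - q'.2)^2) / (2 * ε) ≤
    u p - w q - κ * p.2 - (‖p.1 - q.1‖^2 + (p.2 - q.2)^2) / (2 * ε)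

open Filter Topology in
lemma setup {d : ℕ} {u w : SpaceTime (d+1) → ℝ} (hu : ContinuousOn u (closure (Kc d 1)))
    (hw : ContinuousOn w (closure (Kc d 1))) (hb : ∀ p ∈ bdryK d, u p ≤ w p)
    {ph : SpaceTime (d+1)} (hph : ph ∈ Kc d 1) (hlt : w ph < u ph) :
    ∃ κ > 0, ∀ η > 0, ∃ ε, 0 < ε ∧ ε < 1 ∧ ∃ p ∈ KcP d 1, ∃ q ∈ KcP d 1, lastC p.1 = lastC q.1 ∧
      ‖p.1 - q.1‖^2 + (p.2 - q.2)^2 ≤ η * ε ∧ DMax d u w κ ε p q := by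
  set κ := (u ph - w ph) / 2 with hκ
  have hκ0 : 0 < κ := by rw [hκ]; linarith
  refine ⟨κ, hκ0, ?_⟩
  set K := closure (Kc d 1) with hK
  set C : Set (SpaceTime (d+1) × SpaceTime (d+1)) := (K ×ˢ K) ∩ {z | lastC z.1.1 = lastC z.2.1} with hCdef
  have := lastC_cont (d := d)
  have hC : IsCompact C := (clK_compact.prod clK_compact).inter_right
    (isClosed_eq (by fun_prop) (by fun_prop))
  have phK : ph ∈ K := subset_closure hph
  have h1 : ContinuousOn (fun z : SpaceTime (d+1) × SpaceTime (d+1) => u z.1) C :=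
    hu.comp (by fun_prop) fun z hz => hz.1.1
  have h2 : ContinuousOn (fun z : SpaceTime (d+1) × SpaceTime (d+1) => w z.2) C :=
    hw.comp (by fun_prop) fun z hz => hz.1.2
  obtain ⟨zs, hzs, hg, hfz, H⟩ := penal hC (f := fun z => u z.1 - w z.2 - κ * z.1.2)
    (g := fun z => ‖z.1.1 - z.2.1‖^2 + (z.1.2 - z.2.2)^2)
    ((h1.sub h2).sub (by fun_prop)) (by fun_prop) (fun z => by positivity) (zh := (ph, ph))
    ⟨⟨phK, phK⟩, rfl⟩ (by simp)
  have heq : zs.1 = zs.2 := by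
    have a := sq_nonneg ‖zs.1.1 - zs.2.1‖
    have b := sq_nonneg (zs.1.2 - zs.2.2)
    have c : ‖zs.1.1 - zs.2.1‖^2 = 0 := by linarith
    have c' : (zs.1.2 - zs.2.2)^2 = 0 := by linarith
    refine Prod.ext (sub_eq_zero.1 (norm_eq_zero.1 (pow_eq_zero_iff two_ne_zero |>.1 c))) ?_
    exact sub_eq_zero.1 (pow_eq_zero_iff two_ne_zero |>.1 c')
  have hzK := clK_sub hzs.1.1
  have hph' := mem_Kc.1 hph
  have hnb : zs.1 ∉ bdryK d := fun h => by
    have h3 := hb _ h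
    simp only at hfz
    rw [← heq] at hfz
    nlinarith
  have hP := mem_KcP.1 (clK_not_bdry hzs.1.1 hnb)
  intro η hη
  set U : Set (SpaceTime (d+1) × SpaceTime (d+1)) :=
    {z | ‖z.1.1‖ < 1} ∩ {z | ‖z.2.1‖ < 1} ∩ {z | -1 < z.1.2} ∩ {z | -1 < z.2.2} with hU
  have hUo : IsOpen U := (((isOpen_lt (by fun_prop) (by fun_prop)).inter
    (isOpen_lt (by fun_prop) (by fun_prop))).inter (isOpen_lt (by fun_prop) (by fun_prop))).inter
    (isOpen_lt (by fun_prop) (by fun_prop))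
  have hzU : zs ∈ U := by
    refine ⟨⟨⟨hP.1, ?_⟩, hP.2.2.1⟩, ?_⟩
    · have := hP.1; rw [heq] at this; exact this
    · have := hP.2.2.1; rw [heq] at this; exact this
  obtain ⟨ε, e0, e1, z, hzC, hzU, hgz, hm⟩ := H U (hUo.mem_nhds hzU) η hη
  have k1 := clK_sub hzC.1.1
  have k2 := clK_sub hzC.1.2
  refine ⟨ε, e0, e1, z.1, ?_, z.2, ?_, hzC.2, hgz, ?_⟩
  · exact mem_KcP.2 ⟨hzU.1.1.1, k1.2.1, hzU.1.2, k1.2.2.2⟩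
  · exact mem_KcP.2 ⟨hzU.1.1.2, k2.2.1, hzU.2, k2.2.2.2⟩
  · intro p' hp' q' hq' hpq
    exact hm (p', q') ⟨⟨hp', hq'⟩, hpq⟩

lemma psd_quad {n : ℕ} {A : Matrix (Fin n) (Fin n) ℝ} (h : A.PosSemidef) (x : Fin n → ℝ) :
    0 ≤ ∑ i, ∑ j, x i * (A i j * x j) := by
  have := h.dotProduct_mulVec_nonneg x
  simpa [dotProduct, Matrix.mulVec, Finset.mul_sum] using this

section data
variable {d : ℕ} {lam Λ M C₀ : ℝ}
    {Q Q' : ℝ → Matrix (Fin (d + 1)) (Fin (d + 1)) ℝ} {v v' : ℝ → Eucl (d + 1)}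

lemma ObliqueData.Lpos (h : ObliqueData d lam Λ M C₀ Q Q' v v') : 1 ≤ Λ * M^2 := by
  have h1 := h.Lam_ge_one
  have h2 := h.M_ge_one
  nlinarith [mul_le_mul h1 (one_le_pow₀ (n := 2) h2) (by norm_num) (by linarith)]

lemma sum_one_quad {n : ℕ} (c : ℝ) (x : Fin n → ℝ) :
    ∑ i, ∑ j, x i * ((c • (1 : Matrix (Fin n) (Fin n) ℝ)) i j * x j) = c * ∑ i, x i ^ 2 := by
  rw [Finset.mul_sum]
  refine Finset.sum_congr rfl fun i _ => ?_
  rw [Finset.sum_eq_single i]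
  · simp; ring
  · intro j _ hj; simp [Matrix.one_apply, hj.symm]
  · simp

lemma ObliqueData.Qlo (h : ObliqueData d lam Λ M C₀ Q Q' v v') {t : ℝ} (ht : t ∈ Icc (-1:ℝ) 0)
    (x : Fin (d+1) → ℝ) : (Λ * M^2)⁻¹ * ∑ i, x i ^ 2 ≤ ∑ i, ∑ j, x i * (Q t i j * x j) := by
  have h2 := psd_quad (h.Qlower t ht) x
  rw [← sum_one_quad]
  simp only [Matrix.sub_apply, sub_mul, mul_sub, Finset.sum_sub_distrib] at h2
  linarith

lemma ObliqueData.Qhi (h : ObliqueData d lam Λ M C₀ Q Q' v v') {t : ℝ} (ht : t ∈ Icc (-1:ℝ) 0)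
    (x : Fin (d+1) → ℝ) : ∑ i, ∑ j, x i * (Q t i j * x j) ≤ (Λ * M^2) * ∑ i, x i ^ 2 := by
  have h2 := psd_quad (h.Qupper t ht) x
  rw [← sum_one_quad]
  simp only [Matrix.sub_apply, sub_mul, mul_sub, Finset.sum_sub_distrib] at h2
  linarith

lemma single_quad {n : ℕ} (A : Matrix (Fin n) (Fin n) ℝ) (k : Fin n) :
    ∑ i, ∑ j, (Pi.single k 1 : Fin n → ℝ) i * (A i j * (Pi.single k 1 : Fin n → ℝ) j) = A k k := by
  simp [Pi.single_apply]

lemma single_sq {n : ℕ} (k : Fin n) :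
    ∑ i, (Pi.single k 1 : Fin n → ℝ) i ^ 2 = 1 := by
  simp [Pi.single_apply]

lemma ObliqueData.Qdiag (h : ObliqueData d lam Λ M C₀ Q Q' v v') {t : ℝ} (ht : t ∈ Icc (-1:ℝ) 0)
    (i : Fin (d+1)) : (Λ * M^2)⁻¹ ≤ Q t i i ∧ Q t i i ≤ Λ * M^2 := by
  have h1 := h.Qlo ht (Pi.single i 1)
  have h2 := h.Qhi ht (Pi.single i 1)
  rw [single_quad, single_sq, mul_one] at h1 h2
  exact ⟨h1, h2⟩

lemma ObliqueData.Qentry (h : ObliqueData d lam Λ M C₀ Q Q' v v') {t : ℝ} (ht : t ∈ Icc (-1:ℝ) 0)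
    (i j : Fin (d+1)) : |Q t i j| ≤ Λ * M^2 := by
  by_cases hij : i = j
  · subst hij
    have := h.Qdiag ht i
    have h2 : 0 < (Λ * M^2)⁻¹ := inv_pos.2 (by linarith [h.Lpos])
    rw [abs_of_nonneg (by linarith)]; exact this.2
  have hs : Q t j i = Q t i j := by
    have := h.Qsymm t ht
    exact this.apply i j
  have key : ∀ σ : ℝ, 0 ≤ Q t i i + 2 * σ * Q t i j + σ^2 * Q t j j := fun σ => by
    have h1 := h.Qlo ht (Pi.single i 1 + σ • Pi.single j 1)
    have h0 : 0 ≤ (Λ * M^2)⁻¹ * ∑ k, (Pi.single i 1 + σ • Pi.single j 1 : Fin (d+1) → ℝ) k ^ 2 :=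
      mul_nonneg (inv_nonneg.2 (by linarith [h.Lpos])) (Finset.sum_nonneg fun k _ => sq_nonneg _)
    have h2 := h0.trans h1
    simp [Pi.single_apply, add_mul, mul_add, Finset.sum_add_distrib] at h2
    rw [hs] at h2
    linarith
  have a := key 1
  have b := key (-1)
  have c := (h.Qdiag ht i).2
  have e := (h.Qdiag ht j).2
  rw [abs_le]; constructor <;> linarith

lemma abs_coord_le {n : ℕ} (x : Eucl n) (i : Fin n) : |x i| ≤ ‖x‖ := by
  simpa using PiLp.norm_apply_le x i

lemma trace_vec {n : ℕ} (A : Matrix (Fin n) (Fin n) ℝ) (a b : Fin n → ℝ) :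
    (A * Matrix.vecMulVec a b).trace = ∑ i, ∑ j, A i j * (a j * b i) := by
  simp [Matrix.trace, Matrix.mul_apply, Matrix.vecMulVec_apply]

lemma ObliqueData.trvec (h : ObliqueData d lam Λ M C₀ Q Q' v v') {t : ℝ} (ht : t ∈ Icc (-1:ℝ) 0)
    (a b : Eucl (d+1)) :
    |(Q t * Matrix.vecMulVec a b).trace| ≤ ((d:ℝ)+1)^2 * (Λ * M^2) * (‖a‖ * ‖b‖) := by
  rw [trace_vec]
  have hL := h.Lpos
  calc |∑ i, ∑ j, Q t i j * (a j * b i)| ≤ ∑ i : Fin (d+1), ∑ j : Fin (d+1), (Λ * M^2) * (‖a‖ * ‖b‖) := by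
        refine (Finset.abs_sum_le_sum_abs _ _).trans (Finset.sum_le_sum fun i _ => ?_)
        refine (Finset.abs_sum_le_sum_abs _ _).trans (Finset.sum_le_sum fun j _ => ?_)
        rw [abs_mul, abs_mul]
        have := h.Qentry ht i j
        have h1 := abs_coord_le a j
        have h2 := abs_coord_le b i
        gcongr
    _ = _ := by simp; ring

lemma ObliqueData.trQ (h : ObliqueData d lam Λ M C₀ Q Q' v v') {t : ℝ} (ht : t ∈ Icc (-1:ℝ) 0) :
    0 ≤ (Q t).trace ∧ (Q t).trace ≤ ((d:ℝ)+1) * (Λ * M^2) := by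
  have h2 : 0 < (Λ * M^2)⁻¹ := inv_pos.2 (by linarith [h.Lpos])
  constructor
  · exact Finset.sum_nonneg fun i _ => h2.le.trans (h.Qdiag ht i).1
  · calc (Q t).trace ≤ ∑ i : Fin (d+1), Λ * M^2 := Finset.sum_le_sum fun i _ => (h.Qdiag ht i).2
      _ = _ := by simp

lemma trace_eL (A : Matrix (Fin (d+1)) (Fin (d+1)) ℝ) :
    (A * Matrix.vecMulVec (eL d) (eL d)).trace = A (Fin.last d) (Fin.last d) := by
  rw [trace_vec]
  simp [eL, Pi.single_apply]

lemma ObliqueData.vLip (h : ObliqueData d lam Λ M C₀ Q Q' v v') {t s : ℝ} (ht : t ∈ Icc (-1:ℝ) 0)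
    (hs : s ∈ Icc (-1:ℝ) 0) : ‖v t - v s‖ ≤ lam⁻¹ * |t - s| := by
  have := (convex_Icc (-1:ℝ) 0).norm_image_sub_le_of_norm_hasDerivWithin_le
    (fun x hx => h.vderiv x hx) (fun x hx => h.vderiv_bound x hx) hs ht
  simpa using this

lemma entry_le_op {n : ℕ} (A : Matrix (Fin n) (Fin n) ℝ) (i j : Fin n) : |A i j| ≤ matOpNorm A := by
  have h1 := (LinearMap.toContinuousLinearMap (Matrix.toEuclideanLin A)).le_opNorm
    (EuclideanSpace.single j 1)
  have h2 := abs_coord_le ((LinearMap.toContinuousLinearMap (Matrix.toEuclideanLin A))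
    (EuclideanSpace.single j 1)) i
  have h3 := h2.trans h1
  simpa [matOpNorm, Matrix.toEuclideanLin] using h3

lemma ObliqueData.QLip (h : ObliqueData d lam Λ M C₀ Q Q' v v') {t s : ℝ} (ht : t ∈ Icc (-1:ℝ) 0)
    (hs : s ∈ Icc (-1:ℝ) 0) (i j : Fin (d+1)) : |Q t i j - Q s i j| ≤ C₀ / lam * |t - s| := by
  have := (convex_Icc (-1:ℝ) 0).norm_image_sub_le_of_norm_hasDerivWithin_le
    (fun x hx => h.Qderiv x hx i j)
    (fun x hx => ((Real.norm_eq_abs _).le.trans (entry_le_op _ i j)).trans (h.Qderiv_bound x hx)) hs ht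
  simpa using this

end data

lemma GT.congr {n : ℕ} {φ φ' φt : SpaceTime n → ℝ} {g : SpaceTime n → Eucl n}
    {H : SpaceTime n → Matrix (Fin n) (Fin n) ℝ} (h : GT φ φt g H) (he : ∀ x t, φ' (x, t) = φ (x, t)) :
    GT φ' φt g H := by
  have : φ' = φ := funext fun p => he p.1 p.2
  rw [this]; exact h

lemma barrierGT {d : ℕ} (x₀ y₀ h : Eucl (d+1)) (t₀ s₀ ε r τ q c γ W : ℝ) (hy : lastC y₀ = 0)
    (hε : 0 < ε) :
    ∃ Bt g H, GT (n := d+1) (fun p => W - (‖x₀ - p.1‖^2 + (t₀ - p.2)^2) / (2 * ε)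
        + lastC p.1 / r * ((⟪h, p.1 - y₀⟫ + τ * (p.2 - s₀)) / ε)
        + q * lastC p.1 - c * (lastC p.1 * (r - lastC p.1))
        - γ * (‖p.1 - y₀‖^2 + (s₀ - p.2))) Bt g H ∧
      (∀ y s, Bt (y, s) = (t₀ - s) / ε + lastC y / r * (τ / ε) + γ) ∧
      g (y₀, s₀) = ε⁻¹ • (x₀ - y₀) + (q - c * r) • eL d ∧
      ∀ p, H p = (-(ε⁻¹ + 2 * γ)) • 1 + (1 / (r * ε)) • (Matrix.vecMulVec (eL d) h + Matrix.vecMulVec h (eL d))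
        + (2 * c) • Matrix.vecMulVec (eL d) (eL d) := by
  have h1 := ((GT.normsq x₀).add (GT.time (n := d+1) (fun t => (t - t₀)^2) (fun t => 2 * (t - t₀))
    (fun t => by
      have := ((hasDerivAt_id t).sub_const t₀).pow 2
      exact this.congr_deriv (by simp)) (by fun_prop))).cmul (-(1 / (2 * ε)))
  have h2 := ((GT.ridge (fun z => z) (fun _ => 1) (fun _ => 0) (eL d) (fun t => hasDerivAt_id t)
    (fun t => hasDerivAt_const _ _) (by fun_prop)).mul
    ((GT.ridge (fun z => z - ⟪h, y₀⟫) (fun _ => 1) (fun _ => 0) h (fun t => (hasDerivAt_id t).sub_const _)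
    (fun t => hasDerivAt_const _ _) (by fun_prop)).add
    (GT.time (n := d+1) (fun s => τ * (s - s₀)) (fun _ => τ) (fun t => by
      simpa using ((hasDerivAt_id t).sub_const s₀).const_mul τ) (by fun_prop)))).cmul (1 / (r * ε))
  have h3 := GT.ridge (fun z => q * z - c * (z * (r - z))) (fun z => q - c * r + 2 * c * z) (fun _ => 2 * c)
    (eL d) (fun z => by
      have := ((hasDerivAt_id z).const_mul q).sub
        (((hasDerivAt_id z).mul ((hasDerivAt_id z).const_sub r)).const_mul c)
      refine this.congr_deriv ?_
      simp; ring) (fun z => by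
      have := ((hasDerivAt_id z).const_mul (2 * c)).const_add (q - c * r)
      simpa using this) (by fun_prop)
  have h4 := ((GT.normsq y₀).add (GT.time (n := d+1) (fun t => (s₀ - t)) (fun t => -1)
    (fun t => by
      simpa using ((hasDerivAt_id t).const_sub s₀)) (by fun_prop))).cmul (-γ)
  refine ⟨_, _, _, (((((GT.const W).add h1).add h2).add h3).add h4).congr ?_, ?_, ?_, ?_⟩
  · intro x t
    simp only [inner_eL, norm_sub_rev x₀, inner_sub_right]
    field_simp
    ring
  · intro y s
    simp only [inner_eL]
    field_simp
    ring
  · simp only [inner_eL, hy]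
    ext i
    simp
    field_simp
    ring
  · intro p
    ext i j
    simp [Matrix.vecMulVec_apply]
    field_simp
    ring

/-- the comparison function -/
noncomputable def barB {d : ℕ} (x₀ y₀ h : Eucl (d+1)) (t₀ s₀ ε r τ q c γ W : ℝ) (p : SpaceTime (d+1)) : ℝ :=
  W - (‖x₀ - p.1‖^2 + (t₀ - p.2)^2) / (2 * ε)
        + lastC p.1 / r * ((⟪h, p.1 - y₀⟫ + τ * (p.2 - s₀)) / ε)
        + q * lastC p.1 - c * (lastC p.1 * (r - lastC p.1))
        - γ * (‖p.1 - y₀‖^2 + (s₀ - p.2))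

section
variable {d : ℕ} {lam Λ M C₀ : ℝ}
    {Q Q' : ℝ → Matrix (Fin (d + 1)) (Fin (d + 1)) ℝ} {v v' : ℝ → Eucl (d + 1)}

lemma barrier_strict (hD : ObliqueData d lam Λ M C₀ Q Q' v v') {ε γ : ℝ} (hε : 0 < ε) (hγ : 0 < γ) :
    ∃ C > 0, ∀ (h : Eucl (d+1)) (r yn t₀ s τ : ℝ), 0 < r → 0 ≤ yn → yn ≤ r → |τ| ≤ 1 →
      t₀ ∈ Icc (-1:ℝ) 0 → s ∈ Icc (-1:ℝ) 0 →
      lam * ((t₀ - s) / ε + yn / r * (τ / ε) + γ) <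
      (Q s * ((-(ε⁻¹ + 2 * γ)) • (1 : Matrix (Fin (d+1)) (Fin (d+1)) ℝ) + (1 / (r * ε)) • (Matrix.vecMulVec (eL d) h + Matrix.vecMulVec h (eL d))
        + (2 * (C * (1 + ‖h‖ / r))) • Matrix.vecMulVec (eL d) (eL d))).trace := by
  set L := Λ * M^2 with hL
  have hL1 : 1 ≤ L := hD.Lpos
  set N : ℝ := (d:ℝ) + 1 with hN
  have hN0 : 1 ≤ N := by rw [hN]; have : (0:ℝ) ≤ d := by positivity
                         linarith
  set A : ℝ := 2 / ε + γ + (ε⁻¹ + 2 * γ) * (N * L) with hA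
  set A2 : ℝ := 2 / ε * (N^2 * L) with hA2
  have hA0 : 0 < A := by positivity
  have hA20 : 0 < A2 := by positivity
  refine ⟨L * (A + A2), by positivity, ?_⟩
  intro h r yn t₀ s τ hr hy hyr hτ ht hs
  rw [mul_add (Q s), mul_add (Q s), Matrix.trace_add, Matrix.trace_add, Matrix.mul_smul, Matrix.mul_smul,
    Matrix.mul_smul, Matrix.trace_smul, Matrix.trace_smul, Matrix.trace_smul, mul_one, mul_add (Q s),
    Matrix.trace_add, trace_eL]
  have t1 := (hD.trQ hs).2
  have t2 := hD.trvec hs (eL d) h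
  have t3 := hD.trvec hs h (eL d)
  rw [norm_eL] at t2 t3
  have t4 := (hD.Qdiag hs (Fin.last d)).1
  rw [← hL] at t1 t2 t3 t4
  rw [← hN] at t1 t2 t3
  have t2' := (abs_le.1 t2).1
  have t3' := (abs_le.1 t3).1
  set T1 := (Q s * Matrix.vecMulVec (eL d) h).trace
  set T2 := (Q s * Matrix.vecMulVec h (eL d)).trace
  simp only [smul_eq_mul]
  -- upper bound of left side
  have l1 : lam * ((t₀ - s) / ε + yn / r * (τ / ε) + γ) ≤ 2 / ε + γ := by
    have b1 : (t₀ - s) / ε ≤ 1 / ε := by gcongr; linarith [ht.2, hs.1]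
    have b2 : yn / r * (τ / ε) ≤ 1 * (1 / ε) := by
      have : yn / r ≤ 1 := by rw [div_le_one hr]; exact hyr
      have h0 : 0 ≤ yn / r := by positivity
      have h3 : τ / ε ≤ 1 / ε := by gcongr; exact (le_abs_self τ).trans hτ
      have h4 : 0 ≤ 1 / ε := by positivity
      calc yn / r * (τ / ε) ≤ yn / r * (1 / ε) := by gcongr
        _ ≤ 1 * (1 / ε) := by gcongr
    have b3 : (t₀ - s) / ε + yn / r * (τ / ε) + γ ≤ 2 / ε + γ := by
      have : 2 / ε = 1 / ε + 1 / ε := by ring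
      linarith
    have : (0:ℝ) < 2 / ε + γ := by positivity
    calc lam * ((t₀ - s) / ε + yn / r * (τ / ε) + γ) ≤ lam * (2 / ε + γ) := by
          have := hD.lam_pos; gcongr
      _ ≤ 1 * (2 / ε + γ) := by have := hD.lam_le_one; gcongr
      _ = _ := one_mul _
  have l2 : -(ε⁻¹ + 2 * γ) * (N * L) ≤ -(ε⁻¹ + 2 * γ) * (Q s).trace := by
    have : 0 < ε⁻¹ + 2 * γ := by positivity
    nlinarith
  have l3 : - (A2 * (‖h‖ / r)) ≤ 1 / (r * ε) * (T1 + T2) := by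
    have : -(2 * (N^2 * L * ‖h‖)) ≤ T1 + T2 := by linarith
    calc - (A2 * (‖h‖ / r)) = 1 / (r * ε) * (-(2 * (N^2 * L * ‖h‖))) := by
          rw [hA2]; field_simp
      _ ≤ _ := by gcongr
  have l4 : 2 * (A + A2) * (1 + ‖h‖ / r) ≤ 2 * (L * (A + A2) * (1 + ‖h‖ / r)) * Q s (Fin.last d) (Fin.last d) := by
    have h0 : 0 ≤ ‖h‖ / r := by positivity
    calc 2 * (A + A2) * (1 + ‖h‖ / r) = 2 * (L * (A + A2) * (1 + ‖h‖ / r)) * L⁻¹ := by field_simp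
      _ ≤ _ := by gcongr
  have h0 : 0 ≤ ‖h‖ / r := by positivity
  have h5 := mul_nonneg hA0.le h0
  have h6 := mul_nonneg hA20.le h0
  nlinarith

set_option maxHeartbeats 1000000 in
lemma barrier (hD : ObliqueData d lam Λ M C₀ Q Q' v v') {w : SpaceTime (d+1) → ℝ}
    (hwc : ContinuousOn w (closure (Kc d 1))) (hw : ObliqueSup d lam Q v w)
    {x₀ y₀ : Eucl (d+1)} {t₀ s₀ ε W q : ℝ} (hε : 0 < ε) (hF : (y₀, s₀) ∈ Fc d 1)
    (hx0 : lastC x₀ = 0) (ht0 : t₀ ∈ Icc (-1:ℝ) 0)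
    (hψ : ∀ p ∈ closure (Kc d 1), lastC p.1 = 0 → W - (‖x₀ - p.1‖^2 + (t₀ - p.2)^2) / (2 * ε) ≤ w p)
    (hψ0 : W - (‖x₀ - y₀‖^2 + (t₀ - s₀)^2) / (2 * ε) = w (y₀, s₀)) {γ : ℝ} (hγ : 0 < γ) :
    ∃ σ > 0, ∀ x₁ t₁, ‖x₁ - x₀‖ < σ → |t₁ - t₀| < σ → 0 < lastC x₁ →
      (∀ p ∈ closure (Kc d 1), lastC p.1 = lastC x₁ →
        W - (‖x₀ - p.1‖^2 + (t₀ - p.2)^2) / (2 * ε)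
        + (⟪x₁ - x₀, p.1 - y₀⟫ + (t₁ - t₀) * (p.2 - s₀)) / ε + q * lastC x₁ ≤ w p) →
      ⟪v s₀, ε⁻¹ • (x₀ - y₀)⟫ + lastC (v s₀) * (q - γ) ≤ (t₀ - s₀) / ε + γ := by
  obtain ⟨C, hC0, hC⟩ := barrier_strict hD hε hγ
  obtain ⟨hy1, hy2, hs1, hs2⟩ := mem_Fc.1 hF
  simp only at hy1 hy2 hs1 hs2
  -- choice of ρ
  obtain ⟨ρ, hρ0, hρ1, hρy, hρs⟩ : ∃ ρ : ℝ, 0 < ρ ∧ ρ ≤ 1 ∧ 2 * ρ < 1 - ‖y₀‖ ∧ ρ < s₀ + 1 := by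
    refine ⟨min 1 (min ((1 - ‖y₀‖)/4) ((s₀+1)/2)), ?_, min_le_left _ _, ?_, ?_⟩
    · exact lt_min one_pos (lt_min (by linarith) (by linarith))
    · have := (min_le_right (1:ℝ) (min ((1 - ‖y₀‖)/4) ((s₀+1)/2))).trans (min_le_left _ _)
      linarith
    · have := (min_le_right (1:ℝ) (min ((1 - ‖y₀‖)/4) ((s₀+1)/2))).trans (min_le_right _ _)
      linarith
  have hρ2 : ρ^2 ≤ ρ := by nlinarith
  set K := closure (Kc d 1) with hK
  set f : SpaceTime (d+1) → ℝ := fun p => w p - (W - (‖x₀ - p.1‖^2 + (t₀ - p.2)^2) / (2 * ε)) with hf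
  have hfc : ContinuousOn f K := hwc.sub (by fun_prop)
  have hfu := clK_compact.uniformContinuousOn_of_continuous hfc
  rw [Metric.uniformContinuousOn_iff] at hfu
  set θ := γ * ρ^2 / 2 with hθ
  have hθ0 : 0 < θ := by positivity
  obtain ⟨δ, hδ0, hδ⟩ := hfu θ hθ0
  obtain ⟨σ, hσ0, hσ1, hσ2, hσ3, hσ4, hσ5⟩ : ∃ σ : ℝ, 0 < σ ∧ σ ≤ 1 ∧ σ ≤ δ ∧ σ ≤ ρ ∧
      (2 / ε + |q|) * σ ≤ θ ∧ C * (2 * σ) ≤ γ := by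
    refine ⟨min 1 (min δ (min ρ (min (θ / (2 / ε + |q|)) (γ / (2 * C))))), ?_, ?_, ?_, ?_, ?_, ?_⟩
    · have : 0 < 2 / ε + |q| := by positivity
      exact lt_min one_pos (lt_min hδ0 (lt_min hρ0 (lt_min (by positivity) (by positivity))))
    · exact min_le_left _ _
    · exact (min_le_right _ _).trans (min_le_left _ _)
    · exact (min_le_right _ _).trans ((min_le_right _ _).trans (min_le_left _ _))
    · have h1 : 0 < 2 / ε + |q| := by positivity
      have : min 1 (min δ (min ρ (min (θ / (2 / ε + |q|)) (γ / (2 * C))))) ≤ θ / (2 / ε + |q|) :=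
        (min_le_right _ _).trans ((min_le_right _ _).trans ((min_le_right _ _).trans (min_le_left _ _)))
      rw [le_div_iff₀ h1] at this
      linarith
    · have : min 1 (min δ (min ρ (min (θ / (2 / ε + |q|)) (γ / (2 * C))))) ≤ γ / (2 * C) :=
        (min_le_right _ _).trans ((min_le_right _ _).trans ((min_le_right _ _).trans (min_le_right _ _)))
      rw [le_div_iff₀ (by positivity)] at this
      linarith
  refine ⟨σ, hσ0, ?_⟩
  intro x₁ t₁ hx1 ht1 hr hbd
  set r := lastC x₁ with hr_def
  set h := x₁ - x₀ with hh
  set τ := t₁ - t₀ with hτ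
  have hrh : r ≤ ‖h‖ := by
    have := abs_lastC_le h
    rw [hh, lastC_sub, hx0, sub_zero] at this
    exact (le_abs_self _).trans this
  set c := C * (1 + ‖h‖ / r) with hc
  have hc0 : 0 ≤ c := by positivity
  have hcr : c * r ≤ γ := by
    have : c * r = C * (r + ‖h‖) := by rw [hc]; field_simp
    rw [this]
    exact le_trans (by gcongr; linarith) hσ5
  obtain ⟨Bt, g, H, hGT, hBt, hg, hH⟩ := barrierGT x₀ y₀ h t₀ s₀ ε r τ q c γ W hy2 hε
  set B : SpaceTime (d+1) → ℝ := fun p => W - (‖x₀ - p.1‖^2 + (t₀ - p.2)^2) / (2 * ε)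
        + lastC p.1 / r * ((⟪h, p.1 - y₀⟫ + τ * (p.2 - s₀)) / ε)
        + q * lastC p.1 - c * (lastC p.1 * (r - lastC p.1))
        - γ * (‖p.1 - y₀‖^2 + (s₀ - p.2)) with hB
  set N : Set (SpaceTime (d+1)) := {p | ‖p.1 - y₀‖ ≤ ρ} ∩ ({p | s₀ - ρ^2 ≤ p.2} ∩ ({p | p.2 ≤ s₀} ∩
    ({p | 0 ≤ lastC p.1} ∩ {p | lastC p.1 ≤ r}))) with hN
  have hNP : ∀ p ∈ N, p ∈ KcP d 1 := by
    rintro p ⟨n1, n2, n3, n4, n5⟩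
    simp only [mem_setOf_eq] at n1 n2 n3 n4 n5
    rw [mem_KcP]
    refine ⟨?_, n4, by linarith, by linarith⟩
    have := norm_add_le (p.1 - y₀) y₀
    rw [sub_add_cancel] at this
    linarith
  have hNK : N ⊆ K := fun p hp => KcP_sub_cl (hNP p hp)
  have hNc : IsCompact N := by
    refine clK_compact.of_isClosed_subset ?_ hNK
    have := lastC_cont (d := d)
    exact (isClosed_le (by fun_prop) (by fun_prop)).inter
      ((isClosed_le (by fun_prop) (by fun_prop)).inter
      ((isClosed_le (by fun_prop) (by fun_prop)).inter ((isClosed_le (by fun_prop) (by fun_prop)).inter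
      (isClosed_le (by fun_prop) (by fun_prop)))))
  have hq0N : (y₀, s₀) ∈ N := by
    refine ⟨by simp [hρ0.le], ?_, le_refl s₀, hy2.ge, ?_⟩
    · simp only [mem_setOf_eq]; nlinarith
    · simp only [mem_setOf_eq]; rw [hy2]; exact hr.le
  have hBcont : Continuous B := hGT.elim.1
  have hBq : B (y₀, s₀) = w (y₀, s₀) := by
    simp only [hB, hy2, ← hψ0]; simp
  -- main claim
  have main : ∀ p ∈ N, B p ≤ w p := by
    obtain ⟨m, hmN, hm⟩ := hNc.exists_isMinOn ⟨_, hq0N⟩ (f := fun p => w p - B p)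
      ((hwc.mono hNK).sub hBcont.continuousOn)
    by_contra hcon
    push Not at hcon
    obtain ⟨p', hp'N, hp'⟩ := hcon
    have hneg : w m < B m := by have : w m - B m ≤ w p' - B p' := hm hp'N
                                linarith
    obtain ⟨n1, n2, n3, n4, n5⟩ := id hmN
    simp only [mem_setOf_eq] at n1 n2 n3 n4 n5
    have hpen0 : 0 ≤ ‖m.1 - y₀‖^2 + (s₀ - m.2) := by
      have := sq_nonneg ‖m.1 - y₀‖; linarith
    have ne0 : 0 < lastC m.1 := by
      rcases n4.lt_or_eq with h | h
      · exact h
      · exfalso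
        have := hψ m (hNK hmN) h.symm
        simp only [hB, ← h] at hneg
        have := mul_nonneg hγ.le hpen0
        simp only [zero_div, zero_mul, mul_zero] at hneg
        linarith
    have ner : lastC m.1 < r := by
      rcases n5.lt_or_eq with h | h
      · exact h
      · exfalso
        have := hbd m (hNK hmN) h
        simp only [hB, h] at hneg
        have h3 := mul_nonneg hγ.le hpen0
        rw [div_self hr.ne', one_mul, sub_self, mul_zero, mul_zero] at hneg
        linarith
    have hside : ‖m.1 - y₀‖^2 + (s₀ - m.2) < ρ^2 := by
      by_contra hge
      push Not at hge
      -- f m ≥ -θ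
      have hfm : -θ ≤ f m := by
        set m' : SpaceTime (d+1) := (m.1 - lastC m.1 • eL d, m.2) with hm'
        have hl0 : lastC m'.1 = 0 := by
          simp only [hm', lastC_sub, lastC_smul, lastC_eL]; ring
        have hm'K : m' ∈ K := by
          refine KcP_sub_cl (mem_KcP.2 ⟨?_, hl0.ge, by simp only [hm']; linarith, by simp only [hm']; linarith⟩)
          have h1 := norm_add₃_le (a := m.1 - y₀) (b := y₀) (c := -(lastC m.1 • eL d))
          rw [norm_neg, norm_smul, norm_eL, Real.norm_of_nonneg n4] at h1
          have h2 : m'.1 = m.1 - y₀ + y₀ + -(lastC m.1 • eL d) := by simp only [hm']; abel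
          rw [h2]
          linarith
        have hdist : dist m m' < δ := by
          rw [Prod.dist_eq]
          simp only [hm', dist_self, dist_self_sub_right, norm_smul, norm_eL, Real.norm_of_nonneg n4]
          rw [max_eq_left (by linarith)]
          linarith
        have h3 := hδ m (hNK hmN) m' hm'K hdist
        rw [Real.dist_eq] at h3
        have h4 := (abs_lt.1 h3).1
        have h5 : 0 ≤ f m' := by
          have := hψ m' hm'K hl0
          simp only [hf]; linarith
        linarith
      have hℓ : |(⟪h, m.1 - y₀⟫ + τ * (m.2 - s₀)) / ε| ≤ 2 / ε * σ := by
        rw [abs_div, abs_of_pos hε]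
        have h1 := abs_real_inner_le_norm h (m.1 - y₀)
        have h2 : |τ * (m.2 - s₀)| ≤ σ * 1 := by
          rw [abs_mul]
          have : |m.2 - s₀| ≤ 1 := by rw [abs_le]; constructor <;> linarith
          gcongr
        have h3 : ‖h‖ * ‖m.1 - y₀‖ ≤ σ * 1 := by
          have : ‖m.1 - y₀‖ ≤ 1 := by linarith
          gcongr
        have h4 := abs_add_le ⟪h, m.1 - y₀⟫ (τ * (m.2 - s₀))
        calc _ ≤ (2 * σ) / ε := by gcongr; linarith
          _ = _ := by ring
      have e1 : lastC m.1 / r * ((⟪h, m.1 - y₀⟫ + τ * (m.2 - s₀)) / ε) ≤ 2 / ε * σ := by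
        have h1 : lastC m.1 / r ≤ 1 := by rw [div_le_one hr]; exact n5
        have h2 : 0 ≤ lastC m.1 / r := by positivity
        calc _ ≤ lastC m.1 / r * |(⟪h, m.1 - y₀⟫ + τ * (m.2 - s₀)) / ε| := by
              gcongr; exact le_abs_self _
          _ ≤ 1 * (2 / ε * σ) := by gcongr
          _ = _ := one_mul _
      have e2 : q * lastC m.1 ≤ |q| * σ := by
        calc q * lastC m.1 ≤ |q| * lastC m.1 := by gcongr; exact le_abs_self _
          _ ≤ _ := by gcongr; linarith
      have e3 : 0 ≤ c * (lastC m.1 * (r - lastC m.1)) :=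
        mul_nonneg hc0 (mul_nonneg n4 (by linarith))
      have e4 : γ * ρ^2 ≤ γ * (‖m.1 - y₀‖^2 + (s₀ - m.2)) := by gcongr
      simp only [hf] at hfm
      simp only [hB] at hneg
      have : (2 / ε + |q|) * σ = 2 / ε * σ + |q| * σ := by ring
      rw [hθ] at *
      linarith
    have hmP := mem_KcP.1 (hNP m hmN)
    have hmKc : m ∈ Kc d 1 := mem_Kc.2 ⟨hmP.1, ne0, hmP.2.2⟩
    have hsl : ‖m.1 - y₀‖ < ρ := by
      have : ‖m.1 - y₀‖^2 < ρ^2 := by linarith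
      exact lt_of_pow_lt_pow_left₀ 2 hρ0.le this
    have hsl2 : s₀ - ρ^2 < m.2 := by
      have := sq_nonneg ‖m.1 - y₀‖; linarith
    -- small radius
    obtain ⟨ρ', hρ'0, hρ'1, a1, a2, a3, a4⟩ : ∃ ρ' : ℝ, 0 < ρ' ∧ ρ' ≤ 1 ∧ ρ' ≤ ρ - ‖m.1 - y₀‖ ∧
        ρ' ≤ m.2 - (s₀ - ρ^2) ∧ ρ' ≤ lastC m.1 ∧ ρ' ≤ r - lastC m.1 := by
      refine ⟨min 1 (min (ρ - ‖m.1 - y₀‖) (min (m.2 - (s₀ - ρ^2)) (min (lastC m.1) (r - lastC m.1)))), ?_, ?_, ?_, ?_, ?_, ?_⟩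
      · exact lt_min one_pos (lt_min (by linarith) (lt_min (by linarith) (lt_min (by linarith) (by linarith))))
      · exact min_le_left _ _
      · exact (min_le_right _ _).trans (min_le_left _ _)
      · exact (min_le_right _ _).trans ((min_le_right _ _).trans (min_le_left _ _))
      · exact (min_le_right _ _).trans ((min_le_right _ _).trans ((min_le_right _ _).trans (min_le_left _ _)))
      · exact (min_le_right _ _).trans ((min_le_right _ _).trans ((min_le_right _ _).trans (min_le_right _ _)))
    have hcyl : ∀ p ∈ cylE m.1 m.2 ρ', p ∈ N := by
      rintro p ⟨b1, b2⟩
      rw [mem_ball, dist_eq_norm] at b1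
      have hlc : |lastC p.1 - lastC m.1| < ρ' := by
        have := abs_lastC_le (p.1 - m.1)
        rw [lastC_sub] at this; linarith
      have hlc' := abs_lt.1 hlc
      have : ρ'^2 ≤ ρ' := by nlinarith
      refine ⟨?_, ?_, ?_, ?_, ?_⟩ <;> simp only [mem_setOf_eq]
      · have := norm_add_le (p.1 - m.1) (m.1 - y₀)
        rw [sub_add_sub_cancel] at this; linarith
      · linarith [b2.1]
      · linarith [b2.2]
      · linarith
      · linarith
    have := (hw.2 _ _ _ _ m ρ' hρ'0 ((hGT.add (GT.const (w m - B m))).mono _)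
      ⟨⟨⟨mem_ball_self hρ'0, by simp; positivity⟩, hNK hmN⟩, by simp, fun p hp => by
        have : w m - B m ≤ w p - B p := hm (hcyl p hp.1)
        simp only; linarith⟩).1 hmKc
    have h2 := hC h r (lastC m.1) t₀ m.2 τ hr n4 n5 (ht1.le.trans hσ1) ht0 ⟨by linarith, by linarith⟩
    rw [← hc] at h2
    have e1 : Bt m = _ := hBt m.1 m.2
    simp only [add_zero, hH, e1] at this
    linarith
  -- touch at boundary
  obtain ⟨ρ', hρ'0, hρ'1, hρ'2⟩ : ∃ ρ' : ℝ, 0 < ρ' ∧ ρ' ≤ ρ ∧ ρ' ≤ r :=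
    ⟨min ρ r, lt_min hρ0 hr, min_le_left _ _, min_le_right _ _⟩
  have := (hw.2 _ _ _ _ (y₀, s₀) ρ' hρ'0 (hGT.mono _)
      ⟨⟨⟨mem_ball_self hρ'0, by simp; positivity⟩, hNK hq0N⟩, hBq, fun p hp => by
        refine main p ?_
        obtain ⟨⟨b1, b2⟩, b3⟩ := hp
        rw [mem_ball, dist_eq_norm] at b1
        simp only at b1 b2
        have hlc := abs_lastC_le (p.1 - y₀)
        rw [lastC_sub, hy2, sub_zero] at hlc
        have hlc' := le_abs_self (lastC p.1)
        have : ρ'^2 ≤ ρ^2 := by gcongr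
        refine ⟨?_, ?_, b2.2, (clK_sub b3).2.1, ?_⟩ <;> simp only [mem_setOf_eq]
        · linarith
        · linarith [b2.1]
        · linarith⟩).2 hF
  rw [hg, hBt, hy2, inner_add_right, inner_smul_right (v s₀) (eL d), inner_eL'] at this
  simp only [zero_div, zero_mul, add_zero] at this
  have hv : 0 ≤ lastC (v s₀) := by
    have h1 := hD.vlast s₀ ⟨by linarith, hs2⟩
    have h2 := hD.M_ge_one
    have : 0 < M⁻¹ := by positivity
    linarith
  have h9 : lastC (v s₀) * (q - γ) ≤ (q - c * r) * lastC (v s₀) := by nlinarith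
  linarith

end

lemma quad_id {n : ℕ} (x₁ x₀ y y₀ : Eucl n) :
    ‖x₁ - y₀‖^2 - ‖x₀ - y₀‖^2 - ‖x₁ - y‖^2 + ‖x₀ - y‖^2 = 2 * ⟪x₁ - x₀, y - y₀⟫ := by
  simp only [norm_sub_sq_real, inner_sub_left, inner_sub_right]
  ring

lemma phiGT {d : ℕ} (y₀ : Eucl (d+1)) (t₀ s₀ ε κ q D : ℝ) (hε : 0 < ε) :
    ∃ Bt g H, GT (n := d+1) (fun p => D + κ * (p.2 - t₀) + (‖p.1 - y₀‖^2 + (p.2 - s₀)^2) / (2 * ε)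
        + q * lastC p.1) Bt g H ∧
      (∀ y s, Bt (y, s) = κ + (s - s₀) / ε) ∧
      (∀ y s, g (y, s) = ε⁻¹ • (y - y₀) + q • eL d) := by
  have h1 := ((GT.normsq y₀).add (GT.time (n := d+1) (fun t => (t - s₀)^2) (fun t => 2 * (t - s₀))
    (fun t => by
      have := ((hasDerivAt_id t).sub_const s₀).pow 2
      exact this.congr_deriv (by simp)) (by fun_prop))).cmul (1 / (2 * ε))
  have h2 := (GT.ridge (fun z => q * z) (fun _ => q) (fun _ => 0) (eL d) (fun t => by
      simpa using (hasDerivAt_id t).const_mul q)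
    (fun t => hasDerivAt_const _ _) (by fun_prop))
  have h3 := (GT.time (n := d+1) (fun s => D + κ * (s - t₀)) (fun _ => κ) (fun t => by
      simpa using (((hasDerivAt_id t).sub_const t₀).const_mul κ).const_add D) (by fun_prop))
  refine ⟨_, _, _, ((h3.add h1).add h2).congr ?_, ?_, ?_⟩
  · intro x t
    simp only [inner_eL]
    ring
  · intro y s
    simp only
    field_simp
    ring
  · intro y s
    ext i
    simp
    field_simp

section
variable {d : ℕ} {lam Λ M C₀ : ℝ}
    {Q Q' : ℝ → Matrix (Fin (d + 1)) (Fin (d + 1)) ℝ} {v v' : ℝ → Eucl (d + 1)}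

lemma aux_r1 {y X M l : ℝ} (h1 : y ≤ X) (h2 : 1 ≤ M * l) (h3 : 0 ≤ X) : y ≤ M * X * l := by
  nlinarith

lemma aux_r2 {A B b : ℝ} (h : B^2 + A^2 ≤ b) : A * B ≤ b := by
  nlinarith [sq_nonneg (A - B), sq_nonneg A, sq_nonneg B]

lemma aux_r3 {θ ε : ℝ} (h1 : ε < 1) : θ^2 * ε ≤ θ^2 := by
  nlinarith [sq_nonneg θ]

lemma aux_r4 {a b : ℝ} (h1 : 0 < a) (h2 : a ≤ 1) (h3 : a ≤ b) : a^2 ≤ b := by nlinarith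

set_option maxHeartbeats 1000000 in
lemma boundary_case (hD : ObliqueData d lam Λ M C₀ Q Q' v v') {u w : SpaceTime (d+1) → ℝ}
    (hwc : ContinuousOn w (closure (Kc d 1))) (hu : ObliqueSub d lam Q v u)
    (hw : ObliqueSup d lam Q v w) {κ : ℝ} (hκ : 0 < κ) :
    ∃ η₀ > 0, ∀ ε, 0 < ε → ε < 1 → ∀ p ∈ Fc d 1, ∀ q ∈ Fc d 1,
      ‖p.1 - q.1‖^2 + (p.2 - q.2)^2 ≤ η₀ * ε → DMax d u w κ ε p q → False := by
  have hM := hD.M_ge_one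
  have hl := hD.lam_pos
  set S := 1 + M + M * κ + M^2 with hS
  have hS0 : 0 < S := by positivity
  obtain ⟨θ, hθ0, hθ1, hθ2⟩ : ∃ θ : ℝ, 0 < θ ∧ θ ≤ 1 ∧ lam⁻¹ * (θ * S) ≤ κ / 8 := by
    refine ⟨min 1 (lam * κ / (8 * S)), lt_min one_pos (by positivity), min_le_left _ _, ?_⟩
    calc lam⁻¹ * (min 1 (lam * κ / (8 * S)) * S) ≤ lam⁻¹ * ((lam * κ / (8 * S)) * S) := by
          gcongr; exact min_le_right _ _
      _ = κ / 8 := by field_simp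
  refine ⟨θ^2, by positivity, ?_⟩
  rintro ε hε hε1 ⟨x₀, t₀⟩ hp ⟨y₀, s₀⟩ hq hg hmax
  simp only at hg
  have hp' := mem_Fc.1 hp
  have hq' := mem_Fc.1 hq
  simp only at hp' hq'
  have hpK : (x₀, t₀) ∈ closure (Kc d 1) := KcP_sub_cl (Or.inr hp)
  have hqK : (y₀, s₀) ∈ closure (Kc d 1) := KcP_sub_cl (Or.inr hq)
  have ht : t₀ ∈ Icc (-1:ℝ) 0 := ⟨hp'.2.2.1.le, hp'.2.2.2⟩
  have hs : s₀ ∈ Icc (-1:ℝ) 0 := ⟨hq'.2.2.1.le, hq'.2.2.2⟩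
  have hvl := hD.vlast t₀ ht
  have hMi : 0 < M⁻¹ := by positivity
  have hv0 : 0 < lastC (v t₀) := by linarith
  set P := ε⁻¹ • (x₀ - y₀) with hP
  set a := (t₀ - s₀) / ε with ha
  set q := (a + κ / 2 - ⟪v t₀, P⟫) / lastC (v t₀) with hqd
  have hqe : ⟪v t₀, P⟫ + q * lastC (v t₀) = a + κ / 2 := by
    rw [hqd]; field_simp; ring
  set m := u (x₀, t₀) - w (y₀, s₀) - κ * t₀ - (‖x₀ - y₀‖^2 + (t₀ - s₀)^2) / (2 * ε) with hm
  set D := u (x₀, t₀) - (‖x₀ - y₀‖^2 + (t₀ - s₀)^2) / (2 * ε) with hDd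
  obtain ⟨Bt, g, H, hGT, hBt, hgg⟩ := phiGT y₀ t₀ s₀ ε κ q D hε
  by_cases halt : ∃ ρ > 0, ∀ p ∈ cylE x₀ t₀ ρ ∩ closure (Kc d 1),
      u p ≤ D + κ * (p.2 - t₀) + (‖p.1 - y₀‖^2 + (p.2 - s₀)^2) / (2 * ε) + q * lastC p.1
  · obtain ⟨ρ, hρ, hle⟩ := halt
    have := (hu.2 _ _ _ _ (x₀, t₀) ρ hρ (hGT.mono _)
      ⟨⟨⟨mem_ball_self hρ, by simp; positivity⟩, hpK⟩, by
        simp only [hDd, hp'.2.1]; ring, hle⟩).2 hp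
    rw [hBt, hgg, inner_add_right, inner_smul_right (v t₀) (eL d), inner_eL', ← hP, hqe] at this
    linarith
  · push Not at halt
    set γ := κ / (8 * (1 + M)) with hγd
    have hγ : 0 < γ := by positivity
    obtain ⟨σ, hσ0, hσ⟩ := barrier hD hwc hw (x₀ := x₀) (t₀ := t₀) (q := q)
      (W := u (x₀, t₀) - κ * t₀ - m) hε hq hp'.2.1 ht (fun p hp hp0 => by
        have := hmax (x₀, t₀) hpK p hp (by rw [hp0]; exact hp'.2.1)
        simp only at this
        linarith) (by rw [hm]; ring) hγ
    obtain ⟨⟨x₁, t₁⟩, hp1, hlt⟩ := halt (min 1 σ) (lt_min one_pos hσ0)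
    obtain ⟨⟨b1, b2⟩, b3⟩ := hp1
    rw [mem_ball, dist_eq_norm] at b1
    simp only at b1 b2 hlt
    have hmn : (min 1 σ)^2 ≤ σ := by
      have h1 := min_le_left 1 σ
      have h2 := min_le_right 1 σ
      have h3 : 0 < min 1 σ := lt_min one_pos hσ0
      exact aux_r4 h3 h1 h2
    have hr0 : 0 < lastC x₁ := by
      rcases (clK_sub b3).2.1.lt_or_eq with h | h
      · exact h
      · exfalso
        simp only at h
        have := hmax (x₁, t₁) b3 (y₀, s₀) hqK (by simp only; rw [← h]; exact hq'.2.1.symm)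
        simp only at this
        rw [← h] at hlt
        simp only [hDd] at hlt
        linarith
    have key := hσ x₁ t₁ (b1.trans_le (min_le_right _ _))
      (by rw [abs_lt]; constructor <;> linarith [b2.1, b2.2]) hr0 (by
        intro p hp hpl
        have h1 := hmax (x₁, t₁) b3 p hp hpl.symm
        simp only at h1
        rw [← hm] at h1
        have h2 := quad_id x₁ x₀ p.1 y₀
        have h3 : ⟪x₁ - x₀, p.1 - y₀⟫ / ε = (‖x₁ - y₀‖^2 - ‖x₀ - y₀‖^2 - ‖x₁ - p.1‖^2 + ‖x₀ - p.1‖^2) / (2 * ε) := by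
          rw [h2]; field_simp
        have h4 : (t₁ - t₀) * (p.2 - s₀) / ε = ((t₁ - s₀)^2 - (t₀ - s₀)^2 - (t₁ - p.2)^2 + (t₀ - p.2)^2) / (2 * ε) := by
          field_simp; ring
        rw [add_div ⟪x₁ - x₀, p.1 - y₀⟫, h3, h4]
        simp only [hDd] at hlt
        have e1 : u (x₀, t₀) - κ * t₀ - m - (‖x₀ - p.1‖^2 + (t₀ - p.2)^2) / (2 * ε) +
          ((‖x₁ - y₀‖^2 - ‖x₀ - y₀‖^2 - ‖x₁ - p.1‖^2 + ‖x₀ - p.1‖^2) / (2 * ε) +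
          ((t₁ - s₀)^2 - (t₀ - s₀)^2 - (t₁ - p.2)^2 + (t₀ - p.2)^2) / (2 * ε)) + q * lastC x₁ =
          (u (x₀, t₀) - (‖x₀ - y₀‖ ^ 2 + (t₀ - s₀) ^ 2) / (2 * ε) + κ * (t₁ - t₀) + (‖x₁ - y₀‖ ^ 2 + (t₁ - s₀) ^ 2) / (2 * ε) +
    q * lastC x₁) - κ * t₁ - m - (‖x₁ - p.1‖ ^ 2 + (t₁ - p.2) ^ 2) / (2 * ε) := by ring
        rw [e1]
        linarith)
    rw [← hP, ← ha] at key
    -- final estimate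
    have hΔ : ‖v t₀ - v s₀‖ ≤ lam⁻¹ * |t₀ - s₀| := hD.vLip ht hs
    have i1 : ⟪v t₀ - v s₀, P⟫ ≤ lam⁻¹ * |t₀ - s₀| * ‖P‖ :=
      (real_inner_le_norm _ _).trans (by gcongr)
    have i2 : |lastC (v t₀) - lastC (v s₀)| ≤ lam⁻¹ * |t₀ - s₀| := by
      have := abs_lastC_le (v t₀ - v s₀)
      rw [lastC_sub] at this; linarith
    have i3 : q * (lastC (v t₀) - lastC (v s₀)) ≤ |q| * (lam⁻¹ * |t₀ - s₀|) := by
      calc _ ≤ |q * (lastC (v t₀) - lastC (v s₀))| := le_abs_self _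
        _ = |q| * |lastC (v t₀) - lastC (v s₀)| := abs_mul _ _
        _ ≤ _ := by gcongr
    have i4 : lastC (v s₀) ≤ M := (le_abs_self _).trans ((abs_lastC_le _).trans (hD.vbound s₀ hs))
    have i5 : |q| ≤ M * (|a| + κ / 2 + M * ‖P‖) := by
      rw [hqd, abs_div, abs_of_pos hv0, div_le_iff₀ hv0]
      have n1 : |a + κ / 2 - ⟪v t₀, P⟫| ≤ |a| + κ / 2 + M * ‖P‖ := by
        have j1 := abs_real_inner_le_norm (v t₀) P
        have j2 : ‖v t₀‖ * ‖P‖ ≤ M * ‖P‖ := by have := hD.vbound t₀ ht; gcongr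
        have j3 := abs_sub (a + κ / 2) ⟪v t₀, P⟫
        have j4 := abs_add_le a (κ / 2)
        rw [abs_of_pos (show 0 < κ / 2 by positivity)] at j4
        linarith
      have n2 : 1 ≤ M * lastC (v t₀) := by
        calc 1 = M * M⁻¹ := by field_simp
          _ ≤ _ := by gcongr
      have n3 : 0 ≤ |a| + κ / 2 + M * ‖P‖ := by positivity
      exact aux_r1 n1 n2 n3
    have g1 : |t₀ - s₀| * ‖P‖ ≤ θ^2 := by
      rw [hP, norm_smul, norm_inv, Real.norm_of_nonneg hε.le]
      have : |t₀ - s₀| * (ε⁻¹ * ‖x₀ - y₀‖) = (|t₀ - s₀| * ‖x₀ - y₀‖) / ε := by field_simp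
      rw [this, div_le_iff₀ hε]
      have h2 : |t₀ - s₀|^2 = (t₀ - s₀)^2 := sq_abs _
      rw [← h2] at hg
      exact aux_r2 hg
    have g2 : |t₀ - s₀| * |a| ≤ θ^2 := by
      rw [ha, abs_div, abs_of_pos hε]
      have : |t₀ - s₀| * (|t₀ - s₀| / ε) = (t₀ - s₀)^2 / ε := by rw [← sq_abs (t₀ - s₀)]; ring
      rw [this, div_le_iff₀ hε]
      linarith [sq_nonneg ‖x₀ - y₀‖]
    have g3 : |t₀ - s₀| ≤ θ := by
      refine abs_le_of_sq_le_sq ?_ hθ0.le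
      linarith [sq_nonneg ‖x₀ - y₀‖, aux_r3 (θ := θ) hε1]
    have g4 : θ^2 ≤ θ := aux_r4 hθ0 hθ1 le_rfl
    have tot : |t₀ - s₀| * ‖P‖ + |q| * |t₀ - s₀| ≤ θ * S := by
      have h1 : |q| * |t₀ - s₀| ≤ M * (|a| + κ / 2 + M * ‖P‖) * |t₀ - s₀| := by gcongr
      have h2 : M * (|a| + κ / 2 + M * ‖P‖) * |t₀ - s₀| = M * (|t₀ - s₀| * |a|) + M * (κ / 2) * |t₀ - s₀|
        + M^2 * (|t₀ - s₀| * ‖P‖) := by ring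
      have h3 : M * (|t₀ - s₀| * |a|) ≤ M * θ := by gcongr; linarith
      have h4 : M * (κ / 2) * |t₀ - s₀| ≤ M * (κ / 2) * θ := by gcongr
      have h5 : M^2 * (|t₀ - s₀| * ‖P‖) ≤ M^2 * θ := by gcongr; linarith
      have h6 : θ * S = θ + M * θ + (M * (κ / 2) * θ + M * (κ / 2) * θ) + M^2 * θ := by rw [hS]; ring
      have h7 : 0 ≤ M * (κ / 2) * θ := by positivity
      linarith
    have i6 : lam⁻¹ * (|t₀ - s₀| * ‖P‖ + |q| * |t₀ - s₀|) ≤ κ / 8 :=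
      le_trans (by gcongr) hθ2
    have i7 : γ * (1 + M) = κ / 8 := by rw [hγd]; field_simp
    rw [inner_sub_left] at i1
    have i8 : γ * lastC (v s₀) ≤ γ * M := by gcongr
    have i9 : lam⁻¹ * (|t₀ - s₀| * ‖P‖ + |q| * |t₀ - s₀|) = lam⁻¹ * |t₀ - s₀| * ‖P‖ +
      |q| * (lam⁻¹ * |t₀ - s₀|) := by ring
    have j1 : γ * (1 + M) = γ + γ * M := by ring
    have j2 : lastC (v s₀) * (q - γ) = q * lastC (v s₀) - γ * lastC (v s₀) := by ring
    have j3 : q * (lastC (v t₀) - lastC (v s₀)) = q * lastC (v t₀) - q * lastC (v s₀) := by ring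
    linarith

end

noncomputable def freq {n : ℕ} (k : Fin n → ℤ) : Eucl n :=
  WithLp.toLp 2 (fun i => 2 * Real.pi * (k i : ℝ))

noncomputable def trigP {n : ℕ} (s : Finset (Fin n → ℤ)) (α β : (Fin n → ℤ) → ℝ) (x : Eucl n) : ℝ :=
  ∑ k ∈ s, (α k * Real.cos ⟪freq k, x⟫ + β k * Real.sin ⟪freq k, x⟫)

noncomputable def toT {n : ℕ} (x : Eucl n) : UnitAddTorus (Fin n) := fun i => ((x i : ℝ) : UnitAddCircle)

lemma toT_cont {n : ℕ} : Continuous (toT (n := n)) := by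
  unfold toT
  refine continuous_pi fun i => ?_
  exact (AddCircle.continuous_mk' 1).comp (by fun_prop)

lemma toT_inj {n : ℕ} (x0 : Eucl n) (R : ℝ) (hR : R ≤ 1/4) : Set.InjOn (toT (n := n)) (closedBall x0 R) := by
  intro x hx y hy h
  ext i
  have hi := congrFun h i
  simp only [toT] at hi
  have hxy : |x i - y i| < 1 := by
    have h1 := abs_coord_le (x - y) i
    have h2 : ‖x - y‖ ≤ 1/2 := by
      have := dist_triangle_right x y x0
      rw [mem_closedBall] at hx hy
      rw [← dist_eq_norm]; linarith
    have h3 : (x - y) i = x i - y i := rfl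
    rw [h3] at h1; linarith
  rw [QuotientAddGroup.eq, AddSubgroup.mem_zmultiples_iff] at hi
  obtain ⟨k, hk⟩ := hi
  simp at hk
  have : |(k:ℝ)| < 1 := by
    rw [hk, abs_lt]; rw [abs_lt] at hxy; constructor <;> linarith
  have hk0 : k = 0 := by
    have : |k| < 1 := by exact_mod_cast this
    exact Int.abs_lt_one_iff.1 this
  rw [hk0] at hk; simp at hk; linarith

lemma mFourier_toT {n : ℕ} (k : Fin n → ℤ) (x : Eucl n) :
    UnitAddTorus.mFourier k (toT x) = Complex.exp ((⟪freq k, x⟫ : ℝ) * Complex.I) := by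
  simp only [UnitAddTorus.mFourier, toT, ContinuousMap.coe_mk]
  simp only [fourier_coe_apply, ← Complex.exp_sum]
  congr 1
  simp [PiLp.inner_apply, freq, Finset.sum_mul]
  refine Finset.sum_congr rfl fun i _ => by ring

lemma trig_ext {n : ℕ} (x0 : Eucl n) (R C : ℝ) (hR : R ≤ 1/4) (hC : 0 ≤ C) (f : Eucl n → ℝ)
    (hf : ContinuousOn f (closedBall x0 R)) (hfC : ∀ x ∈ closedBall x0 R, |f x| ≤ C) :
    ∃ G : Eucl n → ℝ, Continuous G ∧ (∀ x, |G x| ≤ C) ∧ (∀ x ∈ closedBall x0 R, G x = f x) ∧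
      ∀ κ : ℝ, 0 < κ → ∃ (s : Finset (Fin n → ℤ)) (α β : (Fin n → ℤ) → ℝ),
        ∀ x, |trigP s α β x - G x| ≤ κ := by
  have hcomp : IsCompact (closedBall x0 R) := isCompact_closedBall x0 R
  have : CompactSpace (closedBall x0 R) := isCompact_iff_compactSpace.1 hcomp
  let e : closedBall x0 R → UnitAddTorus (Fin n) := fun x => toT x.1
  have he : Topology.IsClosedEmbedding e := by
    refine Topology.IsClosedEmbedding.of_continuous_injective_isClosedMap
      (toT_cont.comp continuous_subtype_val) ?_ ?_
    · intro x y h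
      exact Subtype.ext (toT_inj x0 R hR x.2 y.2 h)
    · exact (toT_cont.comp continuous_subtype_val).isClosedMap
  let f0 : BoundedContinuousFunction (closedBall x0 R) ℝ :=
    BoundedContinuousFunction.mkOfCompact ⟨fun x => f x.1, continuousOn_iff_continuous_domRestrict.1 hf⟩
  obtain ⟨g, hg1, hg2⟩ := BoundedContinuousFunction.exists_extension_forall_mem_Icc_of_isClosedEmbedding
    f0 (a := -C) (b := C) (fun x => abs_le.1 (hfC x.1 x.2)) (by linarith) he
  refine ⟨fun x => g (toT x), g.continuous.comp toT_cont, fun x => abs_le.2 (hg1 _), ?_, ?_⟩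
  · intro x hx
    have := congrFun hg2 ⟨x, hx⟩
    exact this
  · intro κ hκ
    let gc : C(UnitAddTorus (Fin n), ℂ) := ⟨fun y => ((g y : ℝ) : ℂ), by fun_prop⟩
    have hmem : gc ∈ (Submodule.span ℂ (Set.range (UnitAddTorus.mFourier (d := Fin n)))).topologicalClosure := by
      rw [UnitAddTorus.span_mFourier_closure_eq_top]; trivial
    rw [← SetLike.mem_coe, Submodule.topologicalClosure_coe, Metric.mem_closure_iff] at hmem
    obtain ⟨P, hP, hd⟩ := hmem κ hκ
    rw [SetLike.mem_coe, Finsupp.mem_span_range_iff_exists_finsupp] at hP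
    obtain ⟨c, rfl⟩ := hP
    refine ⟨c.support, fun k => (c k).re, fun k => -(c k).im, fun x => ?_⟩
    have h1 := (ContinuousMap.dist_apply_le_dist (f := gc) (g := c.sum fun i a => a • UnitAddTorus.mFourier i) (toT x)).trans hd.le
    rw [dist_comm, dist_eq_norm] at h1
    refine le_trans ?_ h1
    refine le_trans (le_of_eq ?_) (Complex.abs_re_le_norm _)
    congr 1
    simp only [Finsupp.sum, ContinuousMap.coe_sum, Finset.sum_apply, ContinuousMap.smul_apply,
      mFourier_toT, Complex.sub_re, Complex.re_sum, trigP]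
    congr 1
    refine Finset.sum_congr rfl fun k _ => ?_
    simp [Complex.exp_ofReal_mul_I_re, Complex.exp_ofReal_mul_I_im]; ring

noncomputable abbrev gam (n : ℕ) : Measure (Eucl n) := ProbabilityTheory.stdGaussian (Eucl n)

lemma gauss_exp {n : ℕ} (S : Eucl n →L[ℝ] Eucl n) (k x : Eucl n) :
    ∫ ξ, Complex.exp ((⟪k, x + S ξ⟫ : ℝ) * Complex.I) ∂(gam n) =
      Complex.exp ((⟪k, x⟫ : ℝ) * Complex.I) *
        (Real.exp (-‖ContinuousLinearMap.adjoint S k‖ ^ 2 / 2) : ℝ) := by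
  have h := ProbabilityTheory.charFun_stdGaussian (E := Eucl n) (ContinuousLinearMap.adjoint S k)
  rw [charFun_apply] at h
  have h2 : ∀ ξ : Eucl n, Complex.exp ((⟪k, x + S ξ⟫ : ℝ) * Complex.I) =
      Complex.exp ((⟪k, x⟫ : ℝ) * Complex.I) *
        Complex.exp ((⟪ξ, ContinuousLinearMap.adjoint S k⟫ : ℝ) * Complex.I) := by
    intro ξ
    rw [← Complex.exp_add, inner_add_right, ContinuousLinearMap.adjoint_inner_right,
      real_inner_comm k (S ξ)]
    push_cast; ring_nf
  simp_rw [h2]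
  rw [integral_const_mul]
  congr 1
  rw [Complex.ofReal_exp]
  simpa using h

lemma gauss_int {n : ℕ} (S : Eucl n →L[ℝ] Eucl n) (x : Eucl n) (f : Eucl n → ℝ) (hf : Continuous f)
    (C : ℝ) (hC : ∀ x, |f x| ≤ C) : Integrable (fun ξ => f (x + S ξ)) (gam n) := by
  refine Integrable.of_bound (C := C) ?_ ?_
  · exact (by fun_prop : Continuous fun ξ => f (x + S ξ)).aestronglyMeasurable
  · exact Filter.Eventually.of_forall fun ξ => hC _

lemma gauss_abs {n : ℕ} (S : Eucl n →L[ℝ] Eucl n) (x : Eucl n) (f : Eucl n → ℝ) 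
    (C : ℝ) (hC : ∀ x, |f x| ≤ C) : |∫ ξ, f (x + S ξ) ∂(gam n)| ≤ C := by
  have := norm_integral_le_of_norm_le_const (μ := gam n) (f := fun ξ => f (x + S ξ)) (C := C)
    (Filter.Eventually.of_forall fun ξ => hC _)
  simpa using this

lemma gauss_cos {n : ℕ} (S : Eucl n →L[ℝ] Eucl n) (k x : Eucl n) :
    ∫ ξ, Real.cos ⟪k, x + S ξ⟫ ∂(gam n) =
      Real.cos ⟪k, x⟫ * Real.exp (-‖ContinuousLinearMap.adjoint S k‖ ^ 2 / 2) := by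
  have hi : Integrable (fun ξ => Complex.exp ((⟪k, x + S ξ⟫ : ℝ) * Complex.I)) (gam n) := by
    refine Integrable.of_bound (C := 1) ?_ ?_
    · exact (by fun_prop : Continuous fun ξ => Complex.exp ((⟪k, x + S ξ⟫ : ℝ) * Complex.I)).aestronglyMeasurable
    · exact Filter.Eventually.of_forall fun ξ => by rw [Complex.norm_exp_ofReal_mul_I]
  have h := congrArg Complex.re (gauss_exp S k x)
  have h2 := reCLM_integral_aux hi
  rw [h2] at h
  simpa [Complex.exp_ofReal_mul_I_re, -Complex.ofReal_exp] using h
  where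
  reCLM_integral_aux {n : ℕ} {f : Eucl n → ℂ} (hi : Integrable f (gam n)) :
    (∫ ξ, f ξ ∂(gam n)).re = ∫ ξ, (f ξ).re ∂(gam n) := (Complex.reCLM.integral_comp_comm hi).symm

lemma gauss_sin {n : ℕ} (S : Eucl n →L[ℝ] Eucl n) (k x : Eucl n) :
    ∫ ξ, Real.sin ⟪k, x + S ξ⟫ ∂(gam n) =
      Real.sin ⟪k, x⟫ * Real.exp (-‖ContinuousLinearMap.adjoint S k‖ ^ 2 / 2) := by
  have hi : Integrable (fun ξ => Complex.exp ((⟪k, x + S ξ⟫ : ℝ) * Complex.I)) (gam n) := by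
    refine Integrable.of_bound (C := 1) ?_ ?_
    · exact (by fun_prop : Continuous fun ξ => Complex.exp ((⟪k, x + S ξ⟫ : ℝ) * Complex.I)).aestronglyMeasurable
    · exact Filter.Eventually.of_forall fun ξ => by rw [Complex.norm_exp_ofReal_mul_I]
  have h := congrArg Complex.im (gauss_exp S k x)
  have h2 : (∫ ξ, Complex.exp ((⟪k, x + S ξ⟫ : ℝ) * Complex.I) ∂(gam n)).im =
    ∫ ξ, (Complex.exp ((⟪k, x + S ξ⟫ : ℝ) * Complex.I)).im ∂(gam n) := (Complex.imCLM.integral_comp_comm hi).symm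
  rw [h2] at h
  simpa [Complex.exp_ofReal_mul_I_im, -Complex.ofReal_exp] using h

noncomputable def heatW {n : ℕ} (s : Finset (Fin n → ℤ)) (α β : (Fin n → ℤ) → ℝ)
    (θ : (Fin n → ℤ) → ℝ → ℝ) (p : SpaceTime n) : ℝ :=
  ∑ k ∈ s, (α k * Real.cos ⟪freq k, p.1⟫ + β k * Real.sin ⟪freq k, p.1⟫) * Real.exp (-θ k p.2)

lemma gauss_trig {n : ℕ} (S : Eucl n →L[ℝ] Eucl n) (s : Finset (Fin n → ℤ)) (α β : (Fin n → ℤ) → ℝ)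
    (θ : (Fin n → ℤ) → ℝ → ℝ) (x : Eucl n) (t : ℝ)
    (h : ∀ k, ‖ContinuousLinearMap.adjoint S (freq k)‖ ^ 2 / 2 = θ k t) :
    ∫ ξ, trigP s α β (x + S ξ) ∂(gam n) = heatW s α β θ (x, t) := by
  unfold trigP heatW
  have hc : ∀ k : Fin n → ℤ, Integrable (fun ξ => Real.cos ⟪freq k, x + S ξ⟫) (gam n) := fun k =>
    gauss_int S x (fun y => Real.cos ⟪freq k, y⟫) (by fun_prop) 1 (fun y => Real.abs_cos_le_one _)
  have hs : ∀ k : Fin n → ℤ, Integrable (fun ξ => Real.sin ⟪freq k, x + S ξ⟫) (gam n) := fun k =>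
    gauss_int S x (fun y => Real.sin ⟪freq k, y⟫) (by fun_prop) 1 (fun y => Real.abs_sin_le_one _)
  rw [integral_finsetSum]
  · refine Finset.sum_congr rfl fun k _ => ?_
    rw [integral_add ((hc k).const_mul _) ((hs k).const_mul _), integral_const_mul,
      integral_const_mul, gauss_cos, gauss_sin, ← h k, neg_div]
    ring
  · intro k _
    exact ((hc k).const_mul _).add ((hs k).const_mul _)

lemma heat_GT {n : ℕ} (s : Finset (Fin n → ℤ)) (α β : (Fin n → ℤ) → ℝ)
    (θ q : (Fin n → ℤ) → ℝ → ℝ) (hθ : ∀ k t, HasDerivAt (θ k) (q k t) t) (hq : ∀ k, Continuous (q k))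
    (lam : ℝ) (Q : ℝ → Matrix (Fin n) (Fin n) ℝ)
    (hQ : ∀ t ∈ Icc (-1 : ℝ) 0, ∀ k, lam * q k t = ∑ i, ∑ j, freq k i * (Q t i j * freq k j)) :
    ∃ Wt g H, GT (heatW s α β θ) Wt g H ∧
      ∀ p : SpaceTime n, p.2 ∈ Icc (-1 : ℝ) 0 → lam * Wt p = (Q p.2 * H p).trace := by
  have h1 : ∀ k ∈ s, GT (n := n) _ _ _ _ := fun k _ =>
    (GT.ridge (fun r => α k * Real.cos r + β k * Real.sin r)
      (fun r => -(α k * Real.sin r) + β k * Real.cos r)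
      (fun r => -(α k * Real.cos r + β k * Real.sin r)) (freq k)
      (fun r => by
        refine HasDerivAt.congr_deriv (((Real.hasDerivAt_cos r).const_mul (α k)).add
          ((Real.hasDerivAt_sin r).const_mul (β k))) (by ring))
      (fun r => by
        refine HasDerivAt.congr_deriv ((((Real.hasDerivAt_sin r).const_mul (α k)).neg).add
          ((Real.hasDerivAt_cos r).const_mul (β k))) (by ring)) (by fun_prop)).mul
      (GT.time (fun t => Real.exp (-θ k t)) (fun t => -(q k t) * Real.exp (-θ k t))
        (fun t => by
          refine HasDerivAt.congr_deriv ((hθ k t).neg.exp) (by simp only [Pi.neg_apply]; ring))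
        (by
          have : Continuous (θ k) := continuous_iff_continuousAt.2 fun t => (hθ k t).continuousAt
          have := hq k
          fun_prop))
  refine ⟨_, _, _, GT.sum s h1, ?_⟩
  intro p hp
  rw [Finset.mul_sum, Matrix.mul_sum, Matrix.trace_sum]
  refine Finset.sum_congr rfl fun k _ => ?_
  have h2 := hQ p.2 hp k
  have h3 : (Q p.2 * Matrix.vecMulVec (freq k) (freq k)).trace =
      ∑ i, ∑ j, freq k i * (Q p.2 i j * freq k j) := by
    rw [trace_vec]
    refine Finset.sum_congr rfl fun i _ => Finset.sum_congr rfl fun j _ => by ring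
  have h0 : Matrix.vecMulVec (0 : Fin n → ℝ) (freq k).ofLp = 0 := by ext; simp [Matrix.vecMulVec_apply]
  have h0' : ∀ y : Fin n → ℝ,  Matrix.vecMulVec y (0 : Fin n → ℝ) = 0 := by
    intro y; ext; simp [Matrix.vecMulVec_apply]
  have h0'' : ∀ y : Fin n → ℝ,  Matrix.vecMulVec (0 : Fin n → ℝ) y = 0 := by
    intro y; ext; simp [Matrix.vecMulVec_apply]
  simp only [WithLp.ofLp_zero, h0', h0'', smul_zero, add_zero, zero_add, Matrix.mul_smul,
    Matrix.trace_smul, h3, ← h2, smul_eq_mul]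
  ring

def clampT (t : ℝ) : ℝ := max (-1) (min t 0)

lemma clampT_mem (t : ℝ) : clampT t ∈ Icc (-1:ℝ) 0 :=
  ⟨le_max_left _ _, max_le (by norm_num) (min_le_right _ _)⟩

lemma clampT_eq {t : ℝ} (ht : t ∈ Icc (-1:ℝ) 0) : clampT t = t := by
  unfold clampT; rw [min_eq_left ht.2, max_eq_right ht.1]

lemma clampT_cont : Continuous clampT := by unfold clampT; fun_prop

def quad {n : ℕ} (A : Matrix (Fin n) (Fin n) ℝ) (k : Fin n → ℝ) : ℝ :=
  ∑ i, ∑ j, k i * (A i j * k j)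

noncomputable def intM {n : ℕ} (Q : ℝ → Matrix (Fin n) (Fin n) ℝ) (a b : ℝ) : Matrix (Fin n) (Fin n) ℝ :=
  fun i j => ∫ s in a..b, Q (clampT s) i j

section data
variable {d : ℕ} {lam Λ M C₀ : ℝ}
    {Q Q' : ℝ → Matrix (Fin (d + 1)) (Fin (d + 1)) ℝ} {v v' : ℝ → Eucl (d + 1)}

lemma ObliqueData.Qc (h : ObliqueData d lam Λ M C₀ Q Q' v v') (i j : Fin (d+1)) :
    Continuous fun s => Q (clampT s) i j := by
  have h1 : ContinuousOn (fun s => Q s i j) (Icc (-1:ℝ) 0) := fun t ht =>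
    (h.Qderiv t ht i j).continuousWithinAt
  exact h1.comp_continuous clampT_cont clampT_mem

lemma ObliqueData.quadc (h : ObliqueData d lam Λ M C₀ Q Q' v v') (k : Fin (d+1) → ℝ) :
    Continuous fun s => quad (Q (clampT s)) k := by
  unfold quad
  exact continuous_finsetSum _ fun i _ => continuous_finsetSum _ fun j _ =>
    ((h.Qc i j).mul_const _).const_mul _

lemma ObliqueData.quad_intM (h : ObliqueData d lam Λ M C₀ Q Q' v v') (a b : ℝ) (k : Fin (d+1) → ℝ) :
    quad (intM Q a b) k = ∫ s in a..b, quad (Q (clampT s)) k := by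
  unfold quad
  rw [intervalIntegral.integral_finsetSum]
  · refine Finset.sum_congr rfl fun i _ => ?_
    rw [intervalIntegral.integral_finsetSum]
    · refine Finset.sum_congr rfl fun j _ => ?_
      rw [intervalIntegral.integral_const_mul, intervalIntegral.integral_mul_const]
      rfl
    · intro j _
      exact (((h.Qc i j).mul_const (k j)).const_mul (k i)).intervalIntegrable _ _
  · intro i _
    exact (continuous_finsetSum _ fun j _ => ((h.Qc i j).mul_const (k j)).const_mul (k i)).intervalIntegrable _ _

lemma ObliqueData.intM_lo (h : ObliqueData d lam Λ M C₀ Q Q' v v') {a b : ℝ} (hab : a ≤ b)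
    (k : Fin (d+1) → ℝ) :
    (b - a) * ((Λ * M^2)⁻¹ * ∑ i, k i ^ 2) ≤ quad (intM Q a b) k := by
  rw [h.quad_intM]
  have := intervalIntegral.integral_mono_on (μ := volume) (f := fun _ => (Λ * M^2)⁻¹ * ∑ i, k i ^ 2) hab
    (intervalIntegrable_const) ((h.quadc k).intervalIntegrable a b)
    (fun s _ => h.Qlo (clampT_mem s) k)
  rw [intervalIntegral.integral_const, smul_eq_mul] at this
  exact this

lemma ObliqueData.intM_symm (h : ObliqueData d lam Λ M C₀ Q Q' v v') (a b : ℝ) :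
    (intM Q a b).IsSymm := by
  ext i j
  simp only [Matrix.transpose_apply, intM]
  refine intervalIntegral.integral_congr fun s _ => ?_
  exact (h.Qsymm _ (clampT_mem s)).apply i j

lemma psd_of_quad {n : ℕ} {A : Matrix (Fin n) (Fin n) ℝ} (h : A.IsSymm) (hq : ∀ k, 0 ≤ quad A k) :
    A.PosSemidef := by
  refine Matrix.PosSemidef.of_dotProduct_mulVec_nonneg ?_ ?_
  · rw [Matrix.IsHermitian, Matrix.conjTranspose_eq_transpose_of_trivial]; exact h
  · intro x
    have := hq x
    simpa [quad, dotProduct, Matrix.mulVec, Finset.mul_sum] using this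

lemma mclm_normsq {n : ℕ} (B : Matrix (Fin n) (Fin n) ℝ) (k : Eucl n) :
    ‖mclm B k‖ ^ 2 = quad (B.transpose * B) k := by
  rw [EuclideanSpace.real_norm_sq_eq]
  have : ∀ i, (mclm B k) i = ∑ j, B i j * k j := by
    intro i; simp [mclm, Matrix.toEuclideanLin, Matrix.mulVec, dotProduct]
  simp only [this, quad, Matrix.mul_apply, Matrix.transpose_apply, pow_two, Finset.sum_mul, Finset.mul_sum]
  rw [Finset.sum_comm]
  refine Finset.sum_congr rfl fun i _ => ?_
  rw [Finset.sum_comm]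
  refine Finset.sum_congr rfl fun j _ => ?_
  refine Finset.sum_congr rfl fun l _ => ?_
  ring

open scoped MatrixOrder in
lemma psd_sqrt {n : ℕ} {A : Matrix (Fin n) (Fin n) ℝ} (h : A.PosSemidef) :
    ∃ T : Matrix (Fin n) (Fin n) ℝ, T.PosSemidef ∧ T * T = A :=
  ⟨CFC.sqrt A, Matrix.nonneg_iff_posSemidef.1 (CFC.sqrt_nonneg A),
    CFC.sqrt_mul_sqrt_self A (Matrix.nonneg_iff_posSemidef.2 h)⟩

lemma psd_symm {n : ℕ} {A : Matrix (Fin n) (Fin n) ℝ} (h : A.PosSemidef) : A.transpose = A := by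
  have := h.isHermitian
  rwa [Matrix.IsHermitian, Matrix.conjTranspose_eq_transpose_of_trivial] at this

lemma exists_root {n : ℕ} {A : Matrix (Fin n) (Fin n) ℝ} (h : A.PosSemidef) :
    ∃ S : Eucl n →L[ℝ] Eucl n, ∀ k : Eucl n, ‖ContinuousLinearMap.adjoint S k‖ ^ 2 = quad A k := by
  obtain ⟨B, hB, hB2⟩ := psd_sqrt h
  refine ⟨ContinuousLinearMap.adjoint (mclm B), fun k => ?_⟩
  rw [ContinuousLinearMap.adjoint_adjoint, mclm_normsq, psd_symm hB, hB2]

lemma quad_smul {n : ℕ} (c : ℝ) (A : Matrix (Fin n) (Fin n) ℝ) (k : Fin n → ℝ) :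
    quad (c • A) k = c * quad A k := by
  simp [quad, Finset.mul_sum]
  refine Finset.sum_congr rfl fun i _ => Finset.sum_congr rfl fun j _ => by ring

lemma ObliqueData.root (h : ObliqueData d lam Λ M C₀ Q Q' v v') {a b : ℝ} (hab : a ≤ b) :
    ∃ S : Eucl (d+1) →L[ℝ] Eucl (d+1), ∀ k : Eucl (d+1),
      ‖ContinuousLinearMap.adjoint S k‖ ^ 2 = 2 / lam * quad (intM Q a b) k := by
  have hl := h.lam_pos
  have hp : ((2 / lam) • intM Q a b).PosSemidef := by
    refine psd_of_quad ((h.intM_symm a b).smul _) fun k => ?_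
    rw [quad_smul]
    have := h.intM_lo hab k
    have h0 : 0 ≤ (b - a) * ((Λ * M^2)⁻¹ * ∑ i, k i ^ 2) := by
      have := h.Lpos
      have : 0 ≤ b - a := by linarith
      positivity
    have : 0 ≤ quad (intM Q a b) k := h0.trans this
    positivity
  obtain ⟨S, hS⟩ := exists_root hp
  exact ⟨S, fun k => by rw [hS, quad_smul]⟩
end data

section data
variable {d : ℕ} {lam Λ M C₀ : ℝ}
    {Q Q' : ℝ → Matrix (Fin (d + 1)) (Fin (d + 1)) ℝ} {v v' : ℝ → Eucl (d + 1)}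

noncomputable def thet (lam : ℝ) (Q : ℝ → Matrix (Fin (d + 1)) (Fin (d + 1)) ℝ) (t1 : ℝ)
    (k : Fin (d+1) → ℤ) (t : ℝ) : ℝ := lam⁻¹ * ∫ s in t1..t, quad (Q (clampT s)) (freq k)

lemma bumpGT (hD : ObliqueData d lam Λ M C₀ Q Q' v v') (x0 : Eucl (d+1)) (t1 A K : ℝ) (hA : 0 ≤ A)
    (hK : lam * K = 2 * ((d:ℝ)+1) * (Λ*M^2) + 4 * ((d:ℝ)+1)^2 * (Λ*M^2)) :
    ∃ bt g H, GT (n := d+1) (fun p => A * ((‖p.1 - x0‖^2 + K * (p.2 - t1)) * (‖p.1 - x0‖^2 + K * (p.2 - t1))))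
      bt g H ∧ ∀ p : SpaceTime (d+1), p.2 ∈ Icc (-1:ℝ) 0 → t1 ≤ p.2 →
        (Q p.2 * H p).trace ≤ lam * bt p := by
  have z := (GT.normsq (n := d+1) x0).add (GT.time (fun t => K * (t - t1)) (fun _ => K)
    (fun t => by
      refine HasDerivAt.congr_deriv (((hasDerivAt_id t).sub_const t1).const_mul K) (by simp))
    continuous_const)
  have zz := (z.mul z).cmul A
  refine ⟨_, _, _, zz, ?_⟩
  intro p hp ht
  have h1 := hD.trQ hp
  have h2 := (abs_le.1 (hD.trvec hp (p.1 - x0) (p.1 - x0))).2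
  have hl := hD.lam_pos
  have hL := hD.Lpos
  have hK0 : 0 ≤ K := by
    have : 0 ≤ lam * K := by rw [hK]; positivity
    exact nonneg_of_mul_nonneg_right this hl
  simp only [add_zero, WithLp.ofLp_smul, Matrix.vecMulVec_smul, Matrix.smul_vecMulVec, Matrix.mul_smul, Matrix.mul_add,
    Matrix.trace_add, Matrix.trace_smul, smul_eq_mul, Matrix.mul_one, zero_add]
  set r := ‖p.1 - x0‖
  set τ := (Q p.2 * Matrix.vecMulVec (p.1 - x0).ofLp (p.1 - x0).ofLp).trace
  set z := r ^ 2 + K * (p.2 - t1)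
  have hz : r * r ≤ z := by
    have : 0 ≤ K * (p.2 - t1) := mul_nonneg hK0 (by linarith)
    simp only [z]; nlinarith
  have hz0 : 0 ≤ z := (mul_self_nonneg r).trans hz
  have e2 : lam * (A * (K * z + z * K)) = A * (2 * z * (lam * K)) := by ring
  rw [e2, hK]
  refine le_trans (le_of_eq ?_) (mul_le_mul_of_nonneg_left (a := A) (b := 4 * z * (Q p.2).trace + 8 * τ) ?_ hA)
  · ring
  · have h3 : z * (Q p.2).trace ≤ z * (((d:ℝ)+1) * (Λ * M^2)) := mul_le_mul_of_nonneg_left h1.2 hz0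
    have h4 : τ ≤ ((d:ℝ)+1)^2 * (Λ * M^2) * z := h2.trans (mul_le_mul_of_nonneg_left hz (by positivity))
    nlinarith

theorem AL (hD : ObliqueData d lam Λ M C₀ Q Q' v v') (u : SpaceTime (d+1) → ℝ) (x0 : Eucl (d+1))
    (t1 t0 R C K : ℝ) (ht : t1 < t0) (ht1 : -1 ≤ t1) (ht0 : t0 ≤ 0) (hR : 0 < R)
    (hK : lam * K = 2 * ((d:ℝ)+1) * (Λ*M^2) + 4 * ((d:ℝ)+1)^2 * (Λ*M^2))
    (huc : ContinuousOn u (closedBall x0 R ×ˢ Icc t1 t0))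
    (huC : ∀ p ∈ closedBall x0 R ×ˢ Icc t1 t0, |u p| ≤ C)
    (hv : ∀ φ φt g H, GT φ φt g H → ∀ p ∈ ball x0 R ×ˢ Ioc t1 t0,
      (∀ p' ∈ closedBall x0 R ×ˢ Icc t1 t0, p'.2 ≤ p.2 → u p' - φ p' ≤ u p - φ p) →
      lam * φt p ≤ (Q p.2 * H p).trace)
    (G : Eucl (d+1) → ℝ) (hGc : Continuous G) (hGC : ∀ x, |G x| ≤ C)
    (hGu : ∀ x ∈ closedBall x0 R, G x = u (x, t1))
    (hGa : ∀ κ : ℝ, 0 < κ → ∃ (s : Finset (Fin (d+1) → ℤ)) (α β : (Fin (d+1) → ℤ) → ℝ),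
        ∀ x, |trigP s α β x - G x| ≤ κ)
    (S : Eucl (d+1) →L[ℝ] Eucl (d+1))
    (hS : ∀ k : Eucl (d+1), ‖ContinuousLinearMap.adjoint S k‖ ^ 2 = 2 / lam * quad (intM Q t1 t0) k) :
    u (x0, t0) ≤ ∫ ξ, G (x0 + S ξ) ∂(gam (d+1)) + (2 * C + 1) / R^4 * (K * (t0 - t1))^2 := by
  have hl := hD.lam_pos
  have hC0 : 0 ≤ C := (abs_nonneg _).trans (hGC 0)
  have hL := hD.Lpos
  have hK0 : 0 ≤ K := by
    have : 0 ≤ lam * K := by rw [hK]; positivity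
    exact nonneg_of_mul_nonneg_right this hl
  set A := (2 * C + 1) / R^4 with hAdef
  have hA : 0 ≤ A := by positivity
  have hAR : A * R^4 = 2 * C + 1 := by rw [hAdef]; field_simp
  obtain ⟨bt, bg, bH, hb, hbt⟩ := bumpGT hD x0 t1 A K hA hK
  refine le_of_forall_pos_le_add fun κ0 hκ0 => ?_
  -- choose κ
  obtain ⟨κ, hκ, hκκ⟩ : ∃ κ : ℝ, 0 < κ ∧ 3 * κ ≤ κ0 := ⟨κ0 / 3, by positivity, by linarith⟩
  obtain ⟨s, α, β, hP⟩ := hGa κ hκ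
  have hθ : ∀ k t, HasDerivAt (thet lam Q t1 k) (lam⁻¹ * quad (Q (clampT t)) (freq k)) t := fun k t =>
    (intervalIntegral.integral_hasDerivAt_right ((hD.quadc _).intervalIntegrable _ _)
      ((hD.quadc _).stronglyMeasurableAtFilter _ _) (hD.quadc _).continuousAt).const_mul _
  obtain ⟨Wt, Wg, WH, hW, hWe⟩ := heat_GT s α β (thet lam Q t1)
    (fun k t => lam⁻¹ * quad (Q (clampT t)) (freq k)) hθ (fun k => (hD.quadc _).const_mul _) lam Q
    (by
      intro t ht k
      rw [clampT_eq ht, ← mul_assoc, mul_inv_cancel₀ hl.ne', one_mul]; rfl)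
  set W := heatW s α β (thet lam Q t1) with hWdef
  have hth : ∀ (S' : Eucl (d+1) →L[ℝ] Eucl (d+1)) (t : ℝ),
      (∀ k : Eucl (d+1), ‖ContinuousLinearMap.adjoint S' k‖ ^ 2 = 2 / lam * quad (intM Q t1 t) k) →
      ∀ k, ‖ContinuousLinearMap.adjoint S' (freq k)‖ ^ 2 / 2 = thet lam Q t1 k t := by
    intro S' t h k
    rw [h, hD.quad_intM, thet]; field_simp
  have hPC : ∀ x, |trigP s α β x| ≤ C + κ := by
    intro x
    have := abs_sub_abs_le_abs_sub (trigP s α β x) (G x)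
    linarith [hP x, hGC x]
  have hWC : ∀ x, ∀ t, t1 ≤ t → |W (x, t)| ≤ C + κ := by
    intro x t ht
    obtain ⟨S', hS'⟩ := hD.root ht
    rw [hWdef, ← gauss_trig S' s α β _ x t (hth S' t hS')]
    exact gauss_abs S' x _ _ hPC
  have hW1 : ∀ x, W (x, t1) = trigP s α β x := by
    intro x
    simp [hWdef, heatW, trigP, thet]
  obtain ⟨ν, hν, hνκ⟩ : ∃ ν : ℝ, 0 < ν ∧ ν * (t0 - t1) ≤ κ := by
    refine ⟨κ / (t0 - t1), div_pos hκ (by linarith), ?_⟩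
    rw [div_mul_cancel₀ _ (by linarith)]
  have hT := (hW.add hb).add (GT.time (n := d+1) (fun t => ν * (t - t1)) (fun _ => ν)
    (fun t => by
      refine HasDerivAt.congr_deriv (((hasDerivAt_id t).sub_const t1).const_mul ν) (by simp))
    continuous_const)
  have hcomp : IsCompact (closedBall x0 R ×ˢ Icc t1 t0) :=
    (isCompact_closedBall x0 R).prod isCompact_Icc
  have hne : (x0, t0) ∈ closedBall x0 R ×ˢ Icc t1 t0 :=
    ⟨mem_closedBall_self hR.le, ht.le, le_refl _⟩
  obtain ⟨p, hp, hmax⟩ := hcomp.exists_isMaxOn ⟨_, hne⟩ (huc.sub hT.elim.1.continuousOn)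
  have hmax' := fun p' hp' => isMaxOn_iff.1 hmax p' hp'
  set b : SpaceTime (d+1) → ℝ := fun p => A * ((‖p.1 - x0‖^2 + K * (p.2 - t1)) * (‖p.1 - x0‖^2 + K * (p.2 - t1))) with hbdef
  have hbp : 0 ≤ b p := mul_nonneg hA (mul_self_nonneg _)
  have hνp : 0 ≤ ν * (p.2 - t1) := mul_nonneg hν.le (by linarith [hp.2.1])
  have hpk : u p - (W p + b p + ν * (p.2 - t1)) ≤ κ := by
    by_cases c1 : p.2 = t1
    · have h1 : p = (p.1, t1) := by rw [← c1]
      have h2 : W p = trigP s α β p.1 := by rw [h1, hW1]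
      have h3 : u p = G p.1 := by rw [hGu _ hp.1, ← h1]
      have := (abs_le.1 (hP p.1)).1
      rw [h2, h3]; linarith
    · by_cases c2 : p.1 ∈ ball x0 R
      · exfalso
        have h1 := hv _ _ _ _ hT p ⟨c2, lt_of_le_of_ne hp.2.1 (Ne.symm c1), hp.2.2⟩
          (fun p' hp' _ => hmax' p' hp')
        have hpI : p.2 ∈ Icc (-1:ℝ) 0 := ⟨ht1.trans hp.2.1, hp.2.2.trans ht0⟩
        have h2 := hWe p hpI
        have h3 := hbt p hpI hp.2.1
        simp only [add_zero, Matrix.mul_add, Matrix.trace_add] at h1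
        nlinarith
      · have h1 : ‖p.1 - x0‖ = R := by
          have h2 := hp.1
          rw [mem_closedBall, dist_eq_norm] at h2
          rw [mem_ball, dist_eq_norm, not_lt] at c2
          exact le_antisymm h2 c2
        have h2 := (abs_le.1 (huC p hp)).2
        have h3 := (abs_le.1 (hWC p.1 p.2 hp.2.1)).1
        have h4 : 2 * C + 1 ≤ b p := by
          rw [← hAR]
          refine mul_le_mul_of_nonneg_left ?_ hA
          rw [h1]
          have : 0 ≤ K * (p.2 - t1) := mul_nonneg hK0 (by linarith [hp.2.1])
          nlinarith [sq_nonneg R]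
        have h5 : W (p.1, p.2) = W p := rfl
        linarith
  have hfin : u (x0, t0) - (W (x0, t0) + b (x0, t0) + ν * (t0 - t1)) ≤ κ := (hmax' _ hne).trans hpk
  have hb0 : b (x0, t0) = A * (K * (t0 - t1))^2 := by 
    simp only [hbdef, sub_self, norm_zero]; ring
  have hW0 : W (x0, t0) ≤ ∫ ξ, G (x0 + S ξ) ∂(gam (d+1)) + κ := by
    rw [hWdef, ← gauss_trig S s α β _ x0 t0 (hth S t0 hS)]
    have hPc : Continuous (trigP s α β) := by unfold trigP; fun_prop
    have i1 := gauss_int S x0 _ hPc _ hPC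
    have i2 := gauss_int S x0 _ hGc _ hGC
    have : ∫ ξ, (G (x0 + S ξ) + κ) ∂(gam (d+1)) = ∫ ξ, G (x0 + S ξ) ∂(gam (d+1)) + κ := by
      rw [integral_add i2 (integrable_const _)]; simp
    rw [← this]
    refine integral_mono i1 (i2.add (integrable_const _)) fun ξ => ?_
    have := (abs_le.1 (hP (x0 + S ξ))).2
    simp only; linarith
  linarith
end data

lemma mclm_mul {n : ℕ} (A B : Matrix (Fin n) (Fin n) ℝ) : mclm (A * B) = mclm A * mclm B := by
  ext x i; simp [mclm, Matrix.toEuclideanLin, Matrix.mulVec_mulVec]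

lemma mclm_sub {n : ℕ} (A B : Matrix (Fin n) (Fin n) ℝ) : mclm (A - B) = mclm A - mclm B := by
  ext x i; simp [mclm]

lemma mclm_app {n : ℕ} (A : Matrix (Fin n) (Fin n) ℝ) (x : Eucl n) (i : Fin n) :
    (mclm A x) i = ∑ j, A i j * x j := by
  simp [mclm, Matrix.toEuclideanLin, Matrix.mulVec, dotProduct]

lemma mclm_adj {n : ℕ} (A : Matrix (Fin n) (Fin n) ℝ) :
    ContinuousLinearMap.adjoint (mclm A) = mclm A.transpose := by
  symm
  rw [ContinuousLinearMap.eq_adjoint_iff]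
  intro x y
  simp only [PiLp.inner_apply, mclm_app, Matrix.transpose_apply]
  simp only [RCLike.inner_apply, conj_trivial, Finset.mul_sum, Finset.sum_mul]
  rw [Finset.sum_comm]
  refine Finset.sum_congr rfl fun i _ => Finset.sum_congr rfl fun j _ => by ring

lemma mclm_norm_le {n : ℕ} (A : Matrix (Fin n) (Fin n) ℝ) (B : ℝ) (hB : 0 ≤ B)
    (h : ∀ i j, |A i j| ≤ B) : ‖mclm A‖ ≤ n * B := by
  refine ContinuousLinearMap.opNorm_le_bound _ (by positivity) fun x => ?_
  have h1 : ∀ i, |(mclm A x) i| ≤ B * ∑ j, |x j| := by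
    intro i
    rw [mclm_app, Finset.mul_sum]
    refine (Finset.abs_sum_le_sum_abs _ _).trans (Finset.sum_le_sum fun j _ => ?_)
    rw [abs_mul]; exact mul_le_mul_of_nonneg_right (h i j) (abs_nonneg _)
  have h2 : (∑ j, |x j|)^2 ≤ n * ‖x‖^2 := by
    have := sq_sum_le_card_mul_sum_sq (s := Finset.univ) (f := fun j => |x j|)
    simpa [EuclideanSpace.real_norm_sq_eq] using this
  refine abs_le_of_sq_le_sq' ?_ (by positivity) |>.2
  rw [EuclideanSpace.real_norm_sq_eq]
  calc ∑ i, (mclm A x) i ^ 2 ≤ ∑ i : Fin n, (B * ∑ j, |x j|)^2 := by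
        refine Finset.sum_le_sum fun i _ => ?_
        exact sq_le_sq' (neg_le_of_abs_le (h1 i)) (le_of_abs_le (h1 i))
    _ = n * (B^2 * (∑ j, |x j|)^2) := by simp [mul_pow]
    _ ≤ n * (B^2 * (n * ‖x‖^2)) := by gcongr
    _ = _ := by ring

lemma mclm_transpose_norm {n : ℕ} (A : Matrix (Fin n) (Fin n) ℝ) : ‖mclm A.transpose‖ = ‖mclm A‖ := by
  rw [← mclm_adj]; exact LinearIsometryEquiv.norm_map ContinuousLinearMap.adjoint _

lemma quad_inner {n : ℕ} (A : Matrix (Fin n) (Fin n) ℝ) (x : Eucl n) : quad A x = ⟪x, mclm A x⟫ := by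
  simp only [PiLp.inner_apply, mclm_app, quad, RCLike.inner_apply, conj_trivial, Finset.sum_mul]
  refine Finset.sum_congr rfl fun i _ => Finset.sum_congr rfl fun j _ => by ring

lemma quad_le {n : ℕ} (A : Matrix (Fin n) (Fin n) ℝ) (B : ℝ) (hB : 0 ≤ B)
    (h : ∀ i j, |A i j| ≤ B) (x : Eucl n) : quad A x ≤ n * B * ‖x‖^2 := by
  rw [quad_inner]
  have h1 := real_inner_le_norm x (mclm A x)
  have h2 := (mclm A).le_of_opNorm_le (mclm_norm_le A B hB h) x
  nlinarith [norm_nonneg x]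

lemma root_norm {n : ℕ} {S : Eucl n →L[ℝ] Eucl n} {A : Matrix (Fin n) (Fin n) ℝ} {B : ℝ} (hB : 0 ≤ B)
    (h : ∀ i j, |A i j| ≤ B) 
    (hS : ∀ k : Eucl n, ‖ContinuousLinearMap.adjoint S k‖ ^ 2 = quad A k) : ‖S‖ ≤ n * B + 1 := by
  rw [← LinearIsometryEquiv.norm_map (ContinuousLinearMap.adjoint) S]
  refine ContinuousLinearMap.opNorm_le_bound _ (by positivity) fun x => ?_
  refine abs_le_of_sq_le_sq' ?_ (by positivity) |>.2
  rw [hS]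
  refine (quad_le A B hB h x).trans ?_
  rw [mul_pow]
  refine mul_le_mul_of_nonneg_right ?_ (by positivity)
  have : 0 ≤ n * B := by positivity
  nlinarith

lemma sq_root_near {n : ℕ} {T : Matrix (Fin n) (Fin n) ℝ} (hT : T.PosSemidef) (k : Eucl n) :
    ‖mclm (T - 1) k‖ ≤ ‖mclm (T * T - 1) k‖ := by
  have e : T * T - 1 = (T + 1) * (T - 1) := by noncomm_ring
  rw [e, mclm_mul]
  simp only [mul_apply_eq_comp]
  set z := mclm (T - 1) k
  rw [mclm_add, mclm_one]
  simp only [add_apply, ContinuousLinearMap.id_apply]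
  refine abs_le_of_sq_le_sq' ?_ (by positivity) |>.2
  rw [norm_add_sq_real]
  have : 0 ≤ ⟪mclm T z, z⟫ := by
    rw [real_inner_comm, ← quad_inner]; exact psd_quad hT z
  nlinarith [sq_nonneg ‖mclm T z‖]

set_option maxHeartbeats 1600000 in
lemma mat_couple (n : ℕ) (l : Fin n) (c B : ℝ) (hc : 0 < c) (hB : 0 < B) :
    ∃ K : ℝ, 0 < K ∧ ∀ C1 C2 : Matrix (Fin n) (Fin n) ℝ, C1.IsSymm → C2.IsSymm →
      C1 l l = 1 → C2 l l = 1 →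
      (∀ k : Fin n → ℝ, c * ∑ i, k i ^ 2 ≤ quad C1 k) → (∀ k : Fin n → ℝ, c * ∑ i, k i ^ 2 ≤ quad C2 k) →
      (∀ i j, |C1 i j| ≤ B) → (∀ i j, |C2 i j| ≤ B) →
      ∀ δ : ℝ, (∀ i j, |C1 i j - C2 i j| ≤ δ) →
      ∃ S1 S2 : Eucl n →L[ℝ] Eucl n,
        (∀ k : Eucl n, ‖ContinuousLinearMap.adjoint S1 k‖ ^ 2 = quad C1 k) ∧
        (∀ k : Eucl n, ‖ContinuousLinearMap.adjoint S2 k‖ ^ 2 = quad C2 k) ∧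
        (∀ ξ, (S1 ξ) l = (S2 ξ) l) ∧ ‖S1‖ ≤ K ∧ ‖S2‖ ≤ K ∧ ‖S1 - S2‖ ≤ K * δ := by
  set b : ℝ := n * B + 1 with hb
  have hb1 : 1 ≤ b := by have : 0 ≤ n * B := by positivity
                         linarith
  have hn0 : 0 ≤ (n:ℝ) := by positivity
  refine ⟨b + n * b + b * (c⁻¹ * (n + n * b * (1 + 2 * b) + b * n)), by positivity, ?_⟩
  intro C1 C2 s1 s2 l1 l2 q1 q2 e1 e2 δ hδ
  have hδ0 : 0 ≤ δ := (abs_nonneg _).trans (hδ l l)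
  have psd : ∀ C : Matrix (Fin n) (Fin n) ℝ, C.IsSymm → (∀ k : Fin n → ℝ, c * ∑ i, k i ^ 2 ≤ quad C k) →
      C.PosSemidef := fun C hs hq => psd_of_quad hs fun k => le_trans (by positivity) (hq k)
  have p1 := psd C1 s1 q1
  have p2 := psd C2 s2 q2
  obtain ⟨A, hA, hAA⟩ := psd_sqrt p1
  have hAs : A.transpose = A := psd_symm hA
  have hAk : ∀ k : Eucl n, c * ‖k‖^2 ≤ ‖mclm A k‖^2 := by
    intro k
    rw [mclm_normsq, hAs, hAA, EuclideanSpace.real_norm_sq_eq]; exact q1 k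
  have hAu : IsUnit A := by
    rw [← Matrix.mulVec_injective_iff_isUnit]
    refine (injective_iff_map_eq_zero (Matrix.mulVecLin A)).2 fun x hx => ?_
    have h1 := hAk (WithLp.toLp 2 x)
    have h2 : mclm A (WithLp.toLp 2 x) = 0 := by
      ext i
      have := congrFun hx i
      simpa [mclm, Matrix.toEuclideanLin] using this
    rw [h2, norm_zero] at h1
    have h3 : ‖WithLp.toLp 2 x‖ ^ 2 ≤ 0 := by
      by_contra h
      push Not at h
      have := mul_pos hc h
      norm_num at h1; linarith
    have h4 : ‖WithLp.toLp 2 x‖ = 0 := by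
      exact pow_eq_zero_iff (two_ne_zero) |>.1 (le_antisymm h3 (sq_nonneg _))
    rw [norm_eq_zero] at h4
    simpa using h4
  have hAd : IsUnit A.det := (Matrix.isUnit_iff_isUnit_det A).1 hAu
  set I := A⁻¹ with hI
  have hAI : A * I = 1 := Matrix.mul_nonsing_inv A hAd
  have hIA : I * A = 1 := Matrix.nonsing_inv_mul A hAd
  have hIs : I.transpose = I := by rw [hI, Matrix.transpose_nonsing_inv, hAs]
  -- norm of inverse
  have hIn : ∀ k : Eucl n, c * ‖mclm I k‖^2 ≤ ‖k‖^2 := by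
    intro k
    have := hAk (mclm I k)
    have h2 : mclm A (mclm I k) = k := by
      rw [← mul_apply_eq_comp, ← mclm_mul, hAI, mclm_one]; rfl
    rwa [h2] at this
  set e : Fin n → ℝ := Pi.single l 1 with he
  set V : Fin n → ℝ := fun i => C1 i l - C2 i l with hV
  set J : Matrix (Fin n) (Fin n) ℝ := Matrix.vecMulVec V e with hJ
  have hJapp : ∀ i j, J i j = V i * e j := fun i j => rfl
  have heV : dotProduct e V = 0 := by simp [he, hV, l1, l2]
  have hJJ : J * J = 0 := by
    rw [hJ, Matrix.vecMulVec_mul_vecMulVec, heV]; ext i j; simp [Matrix.vecMulVec_apply]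
  set N := 1 + J with hN
  set Ni := 1 - J with hNi
  have hNiN : Ni * N = 1 := by
    have : Ni * N = 1 - J * J := by rw [hN, hNi]; noncomm_ring
    rw [this, hJJ, sub_zero]
  have hNNiT : N.transpose * Ni.transpose = 1 := by
    rw [← Matrix.transpose_mul, hNiN, Matrix.transpose_one]
  set Y := I * (N * C2 * N.transpose) * I with hY
  have hYp : Y.PosSemidef := by
    have h1 := (p2.mul_mul_conjTranspose_same N).mul_mul_conjTranspose_same I
    rw [Matrix.conjTranspose_eq_transpose_of_trivial, Matrix.conjTranspose_eq_transpose_of_trivial, hIs] at h1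
    exact h1
  obtain ⟨T, hT, hTT⟩ := psd_sqrt hYp
  have hTs : T.transpose = T := psd_symm hT
  set S := Ni * A * T with hS
  have hNS : N * S = A * T := by
    have : N * Ni = 1 := by
      have : N * Ni = 1 - J * J := by rw [hN, hNi]; noncomm_ring
      rw [this, hJJ, sub_zero]
    rw [hS, ← mul_assoc, ← mul_assoc, this, one_mul]
  have hSS : S * S.transpose = C2 := by
    rw [hS, Matrix.transpose_mul, Matrix.transpose_mul, hTs, hAs]
    calc Ni * A * T * (T * (A * Ni.transpose)) = Ni * A * (T * T) * A * Ni.transpose := by noncomm_ring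
      _ = Ni * (A * I) * (N * C2 * N.transpose) * (I * A) * Ni.transpose := by rw [hTT, hY]; noncomm_ring
      _ = (Ni * N) * C2 * (N.transpose * Ni.transpose) := by rw [hAI, hIA]; noncomm_ring
      _ = C2 := by rw [hNiN, hNNiT]; simp
  have r1 : ∀ k : Eucl n, ‖ContinuousLinearMap.adjoint (mclm A) k‖ ^ 2 = quad C1 k := by
    intro k; rw [mclm_adj, hAs, mclm_normsq, hAs, hAA]
  have r2 : ∀ k : Eucl n, ‖ContinuousLinearMap.adjoint (mclm S) k‖ ^ 2 = quad C2 k := by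
    intro k; rw [mclm_adj, mclm_normsq, Matrix.transpose_transpose, hSS]
  have n1 : ‖mclm A‖ ≤ b := root_norm hB.le e1 r1
  have n2 : ‖mclm S‖ ≤ b := root_norm hB.le e2 r2
  have nC2 : ‖mclm C2‖ ≤ b := (mclm_norm_le C2 B hB.le e2).trans (by rw [hb]; linarith)
  have hJb : ∀ δ', 0 ≤ δ' → (∀ i, |V i| ≤ δ') → ‖mclm J‖ ≤ n * δ' := by
    intro δ' h0 h
    refine mclm_norm_le J δ' h0 fun i j => ?_
    rw [hJapp, abs_mul]
    have : |e j| ≤ 1 := by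
      rw [he]; by_cases hj : j = l
      · subst hj; simp
      · simp [Pi.single_apply, hj]
    calc |V i| * |e j| ≤ |V i| * 1 := by gcongr
      _ ≤ δ' := by rw [mul_one]; exact h i
  have nJ : ‖mclm J‖ ≤ n * δ := hJb δ hδ0 fun i => hδ i l
  have nJ' : ‖mclm J‖ ≤ 2 * b := by
    refine (hJb (2*B) (by positivity) fun i => ?_).trans (by rw [hb]; linarith)
    have := abs_sub (C1 i l) (C2 i l)
    have := e1 i l
    have := e2 i l
    simp only [hV]; linarith
  have none : ‖mclm (1 : Matrix (Fin n) (Fin n) ℝ)‖ ≤ 1 := by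
    rw [mclm_one]; exact ContinuousLinearMap.norm_id_le
  have nN : ‖mclm N.transpose‖ ≤ 1 + 2 * b := by
    rw [mclm_transpose_norm, hN, mclm_add]
    exact (norm_add_le _ _).trans (add_le_add none nJ')
  have hX : T * T - 1 = I * (N * C2 * N.transpose - C1) * I := by
    have : I * C1 * I = 1 := by
      rw [← hAA]
      calc I * (A * A) * I = (I * A) * (A * I) := by noncomm_ring
        _ = 1 := by rw [hIA, hAI]; simp
    rw [hTT, hY, mul_sub, sub_mul, this]
  have hdec : N * C2 * N.transpose - C1 = (C2 - C1) + J * C2 * N.transpose + C2 * J.transpose := by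
    rw [hN, Matrix.transpose_add, Matrix.transpose_one]; noncomm_ring
  have nX : ‖mclm (N * C2 * N.transpose - C1)‖ ≤ (n + n * b * (1 + 2 * b) + b * n) * δ := by
    rw [hdec, mclm_add, mclm_add, mclm_mul, mclm_mul, mclm_mul]
    have h1 : ‖mclm (C2 - C1)‖ ≤ n * δ := mclm_norm_le _ δ hδ0 fun i j => by
      rw [Matrix.sub_apply, abs_sub_comm]; exact hδ i j
    have h2 : ‖mclm J * mclm C2 * mclm N.transpose‖ ≤ (n * δ) * b * (1 + 2 * b) := by
      refine (norm_mul_le _ _).trans ?_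
      refine mul_le_mul ((norm_mul_le _ _).trans ?_) nN (norm_nonneg _) (by positivity)
      exact mul_le_mul nJ nC2 (norm_nonneg _) (by positivity)
    have h3 : ‖mclm C2 * mclm J.transpose‖ ≤ b * (n * δ) := by
      refine (norm_mul_le _ _).trans ?_
      rw [mclm_transpose_norm]
      exact mul_le_mul nC2 nJ (norm_nonneg _) (by positivity)
    calc _ ≤ n * δ + (n * δ) * b * (1 + 2 * b) + b * (n * δ) :=
          (norm_add_le _ _).trans (add_le_add ((norm_add_le _ _).trans (add_le_add h1 h2)) h3)
      _ = _ := by ring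
  have nT : ‖mclm (T - 1)‖ ≤ c⁻¹ * ((n + n * b * (1 + 2 * b) + b * n) * δ) := by
    refine ContinuousLinearMap.opNorm_le_bound _ (by positivity) fun k => ?_
    refine (sq_root_near hT k).trans ?_
    rw [hX, mclm_mul, mclm_mul]
    simp only [mul_apply_eq_comp]
    set w := mclm I k
    have hw := hIn k
    set z := mclm (N * C2 * N.transpose - C1) w
    have hz : ‖z‖ ≤ (n + n * b * (1 + 2 * b) + b * n) * δ * ‖w‖ := ContinuousLinearMap.le_of_opNorm_le _ nX w
    have hIz := hIn z
    set m := (n + n * b * (1 + 2 * b) + b * n) * δ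
    have hm : 0 ≤ m := by positivity
    refine abs_le_of_sq_le_sq' ?_ (by positivity) |>.2
    have h5 : ‖z‖^2 ≤ m^2 * ‖w‖^2 := by
      rw [← mul_pow]; exact pow_le_pow_left₀ (norm_nonneg _) hz 2
    have h6 : c * (c * ‖mclm I z‖^2) ≤ m^2 * ‖k‖^2 := by
      calc c * (c * ‖mclm I z‖^2) ≤ c * (m^2 * ‖w‖^2) := mul_le_mul_of_nonneg_left (hIz.trans h5) hc.le
        _ = m^2 * (c * ‖w‖^2) := by ring
        _ ≤ m^2 * ‖k‖^2 := by gcongr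
    rw [show (c⁻¹ * m * ‖k‖)^2 = c⁻¹ * (c⁻¹ * (m^2 * ‖k‖^2)) by ring]
    rw [inv_mul_eq_div, le_div_iff₀ hc, inv_mul_eq_div, le_div_iff₀ hc]
    linarith
  have hcoef : 0 ≤ c⁻¹ * (n + n * b * (1 + 2 * b) + b * n) := by positivity
  refine ⟨mclm A, mclm S, r1, r2, ?_, ?_, ?_, ?_⟩
  · -- last coordinate
    have hrow : ∀ j, A l j = S l j := by
      set y : Fin n → ℝ := A.mulVec e with hy
      have hNe : N.transpose.mulVec e = e := by
        rw [hN, Matrix.transpose_add, Matrix.transpose_one, Matrix.add_mulVec, Matrix.one_mulVec, hJ,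
          Matrix.transpose_vecMulVec, Matrix.vecMulVec_mulVec, dotProduct_comm, heV]; simp
      have hNC : N.mulVec (C2.mulVec e) = C1.mulVec e := by
        rw [hN, Matrix.add_mulVec, Matrix.one_mulVec, hJ, Matrix.vecMulVec_mulVec]
        have h1 : dotProduct e (C2.mulVec e) = 1 := by simp [he, l2]
        rw [h1]
        ext i; simp [he, hV]
      have hTy2 : (T * T).mulVec y = y := by
        rw [hTT, hY, hy, Matrix.mulVec_mulVec]
        have : I * (N * C2 * N.transpose) * I * A = I * (N * (C2 * (N.transpose * (I * A)))) := by noncomm_ring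
        rw [this, hIA, mul_one, ← Matrix.mulVec_mulVec, ← Matrix.mulVec_mulVec, ← Matrix.mulVec_mulVec,
          hNe, hNC, ← hAA, ← Matrix.mulVec_mulVec, Matrix.mulVec_mulVec, hIA, Matrix.one_mulVec]
      have hTy : T.mulVec y = y := by
        have h1 := sq_root_near hT (WithLp.toLp 2 y)
        have h2 : mclm (T * T - 1) (WithLp.toLp 2 y) = 0 := by
          ext i
          have := congrFun hTy2 i
          simp only [mclm, Matrix.toEuclideanLin]
          simp [Matrix.sub_mulVec, this]
        rw [h2, norm_zero] at h1
        have h3 := norm_eq_zero.1 (le_antisymm h1 (norm_nonneg _))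
        ext i
        have h4 := congrArg (fun z : Eucl n => z i) h3
        simp only [mclm, Matrix.toEuclideanLin] at h4
        simp [Matrix.sub_mulVec] at h4
        linarith
      intro j
      have g1 : S.transpose.mulVec e = y := by
        rw [hS, Matrix.transpose_mul, Matrix.transpose_mul, hTs, hAs, ← Matrix.mulVec_mulVec, ← Matrix.mulVec_mulVec]
        have : Ni.transpose.mulVec e = e := by
          rw [hNi, Matrix.transpose_sub, Matrix.transpose_one, Matrix.sub_mulVec, Matrix.one_mulVec, hJ,
            Matrix.transpose_vecMulVec, Matrix.vecMulVec_mulVec, dotProduct_comm, heV]; simp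
        rw [this]; exact hTy
      have g2 := congrFun g1 j
      have g3 : y j = A j l := by simp [hy, he]
      have g4 : S.transpose.mulVec e j = S l j := by simp [he]
      rw [g3, g4] at g2
      rw [g2, ← Matrix.transpose_apply A, hAs]
    intro ξ
    rw [mclm_app, mclm_app]
    exact Finset.sum_congr rfl fun j _ => by rw [hrow]
  · refine n1.trans ?_
    have i1 := mul_nonneg hn0 (by linarith : (0:ℝ) ≤ b)
    have i2 := mul_nonneg (by linarith : (0:ℝ) ≤ b) hcoef
    linarith
  · refine n2.trans ?_
    have i1 := mul_nonneg hn0 (by linarith : (0:ℝ) ≤ b)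
    have i2 := mul_nonneg (by linarith : (0:ℝ) ≤ b) hcoef
    linarith
  · have hd : A - S = J * S - A * (T - 1) := by
      have : J * S = N * S - S := by rw [hN]; noncomm_ring
      rw [this, hNS]; noncomm_ring
    rw [← mclm_sub, hd, mclm_sub, mclm_mul J S, mclm_mul A (T - 1)]
    refine (norm_sub_le _ _).trans ?_
    have h1 : ‖mclm J * mclm S‖ ≤ (n * δ) * b :=
      (norm_mul_le _ _).trans (mul_le_mul nJ n2 (norm_nonneg _) (by positivity))
    have h2 : ‖mclm A * mclm (T - 1)‖ ≤ b * (c⁻¹ * ((n + n * b * (1 + 2 * b) + b * n) * δ)) :=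
      (norm_mul_le _ _).trans (mul_le_mul n1 nT (norm_nonneg _) (by positivity))
    have h3 := mul_nonneg (by linarith : (0:ℝ) ≤ b) hδ0
    refine (add_le_add h1 h2).trans ?_
    refine le_trans ?_ (le_trans (le_add_of_nonneg_left h3) (le_of_eq ?_)) (b := (n * δ) * b + b * (c⁻¹ * ((n + n * b * (1 + 2 * b) + b * n) * δ)))
    · exact le_refl _
    · ring

lemma visc_of_sub {d : ℕ} {lam : ℝ} {Q : ℝ → Matrix (Fin (d + 1)) (Fin (d + 1)) ℝ}
    {v : ℝ → Eucl (d + 1)} {u : SpaceTime (d+1) → ℝ} (hu : ObliqueSub d lam Q v u)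
    {x0 : Eucl (d+1)} {t1 t0 R : ℝ} (hZ : closedBall x0 R ×ˢ Icc t1 t0 ⊆ Kc d 1)
    (φ φt : SpaceTime (d+1) → ℝ) (g : SpaceTime (d+1) → Eucl (d+1))
    (H : SpaceTime (d+1) → Matrix (Fin (d + 1)) (Fin (d + 1)) ℝ) (hφ : GT φ φt g H)
    (p : SpaceTime (d+1)) (hp : p ∈ ball x0 R ×ˢ Ioc t1 t0)
    (hm : ∀ p' ∈ closedBall x0 R ×ˢ Icc t1 t0, p'.2 ≤ p.2 → u p' - φ p' ≤ u p - φ p) :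
    lam * φt p ≤ (Q p.2 * H p).trace := by
  obtain ⟨r, hr, hrb⟩ := Metric.isOpen_iff.1 (isOpen_ball (x := x0) (ε := R)) p.1 hp.1
  set ρ := min 1 (min r (p.2 - t1)) with hρ
  have hρ0 : 0 < ρ := lt_min one_pos (lt_min hr (by linarith [hp.2.1]))
  have h1 : ρ ≤ 1 := min_le_left _ _
  have h2 : ρ ≤ r := (min_le_right _ _).trans (min_le_left _ _)
  have h3 : ρ ≤ p.2 - t1 := (min_le_right _ _).trans (min_le_right _ _)
  have hpK : p ∈ Kc d 1 := hZ ⟨ball_subset_closedBall hp.1, hp.2.1.le, hp.2.2⟩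
  have hT := hφ.add (GT.const (n := d+1) (u p - φ p))
  have := (hu.2 _ _ _ _ p ρ hρ0 (hT.mono _) ⟨⟨⟨mem_ball_self hρ0, by simp only [mem_Ioc]; constructor <;> nlinarith⟩,
    subset_closure hpK⟩, by ring, ?_⟩).1 hpK
  · simpa using this
  · rintro p' ⟨⟨ha, hb⟩, -⟩
    have h5 : p' ∈ closedBall x0 R ×ˢ Icc t1 t0 := by
      refine ⟨ball_subset_closedBall (hrb (ball_subset_ball h2 ha)), ?_, hb.2.trans hp.2.2⟩
      have := hb.1
      nlinarith
    have := hm p' h5 hb.2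
    simp only; linarith

lemma gam_pow (n : ℕ) (k : ℕ) : Integrable (fun ξ : Eucl n => ‖ξ‖ ^ k) (gam n) := by
  have h := ProbabilityTheory.IsGaussian.memLp_id (gam n) k (by simp)
  have := h.integrable_norm_pow'
  simpa using this

lemma gauss_couple {n : ℕ} (G1 G2 : Eucl n → ℝ) (C a D ε R : ℝ) (hε : 0 < ε) (hR : 0 < R) (hD0 : 0 ≤ D)
    (h1 : Continuous G1) (h2 : Continuous G2) (b1 : ∀ x, |G1 x| ≤ C) (b2 : ∀ x, |G2 x| ≤ C)
    (S1 S2 : Eucl n →L[ℝ] Eucl n) (x0 y0 : Eucl n)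
    (hb : ∀ ξ, ‖S1 ξ‖ ≤ R → ‖S2 ξ‖ ≤ R →
      G1 (x0 + S1 ξ) + G2 (y0 + S2 ξ) ≤ a + ‖(x0 + S1 ξ) - (y0 + S2 ξ)‖^2 / (2 * ε))
    (hD : 2 * C ≤ a + D) :
    ∫ ξ, G1 (x0 + S1 ξ) ∂(gam n) + ∫ ξ, G2 (y0 + S2 ξ) ∂(gam n) ≤
      a + (‖x0 - y0‖^2 + ‖S1 - S2‖^2 * ∫ ξ, ‖ξ‖^2 ∂(gam n)) / (2 * ε)
        + D / R^4 * ((‖S1‖^4 + ‖S2‖^4) * ∫ ξ, ‖ξ‖^4 ∂(gam n)) := by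
  have i1 := gauss_int S1 x0 G1 h1 C b1
  have i2 := gauss_int S2 y0 G2 h2 C b2
  have i3 := gam_pow n 2
  have i4 := gam_pow n 4
  have il : Integrable (fun ξ : Eucl n => ⟪x0 - y0, (S1 - S2) ξ⟫) (gam n) := by
    have h := (ProbabilityTheory.IsGaussian.memLp_id (gam n) 1 (by simp)).integrable le_rfl
    exact ((innerSL ℝ (x0 - y0)).comp (S1 - S2)).integrable_comp h
  have el : ∫ ξ : Eucl n, ⟪x0 - y0, (S1 - S2) ξ⟫ ∂(gam n) = 0 :=
    ProbabilityTheory.integral_strongDual_stdGaussian ((innerSL ℝ (x0 - y0)).comp (S1 - S2))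
  rw [← integral_add i1 i2]
  have key : ∀ ξ, G1 (x0 + S1 ξ) + G2 (y0 + S2 ξ) ≤
      ((a + ‖x0 - y0‖^2 / (2*ε)) + (1/ε) * ⟪x0 - y0, (S1 - S2) ξ⟫ + (‖S1 - S2‖^2 / (2*ε)) * ‖ξ‖^2)
        + (D / R^4 * (‖S1‖^4 + ‖S2‖^4)) * ‖ξ‖^4 := by
    intro ξ
    have e1 : a + ‖(x0 + S1 ξ) - (y0 + S2 ξ)‖^2 / (2*ε) ≤ 
        (a + ‖x0 - y0‖^2 / (2*ε)) + (1/ε) * ⟪x0 - y0, (S1 - S2) ξ⟫ + (‖S1 - S2‖^2 / (2*ε)) * ‖ξ‖^2 := by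
      have e2 : (x0 + S1 ξ) - (y0 + S2 ξ) = (x0 - y0) + (S1 - S2) ξ := by
        simp; abel
      rw [e2, norm_add_sq_real]
      have e3 : ‖(S1 - S2) ξ‖^2 ≤ ‖S1 - S2‖^2 * ‖ξ‖^2 := by
        rw [← mul_pow]; exact pow_le_pow_left₀ (norm_nonneg _) ((S1 - S2).le_opNorm ξ) 2
      have e4 := div_le_div_of_nonneg_right e3 (by positivity : 0 ≤ 2 * ε)
      have e5 : (‖x0 - y0‖^2 + 2 * ⟪x0 - y0, (S1 - S2) ξ⟫ + ‖(S1 - S2) ξ‖^2) / (2*ε) =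
        ‖x0 - y0‖^2 / (2*ε) + 1/ε * ⟪x0 - y0, (S1 - S2) ξ⟫ + ‖(S1 - S2) ξ‖^2 / (2*ε) := by
        field_simp
      have e7 : ‖S1 - S2‖^2/(2*ε)*‖ξ‖^2 = ‖S1 - S2‖^2*‖ξ‖^2/(2*ε) := by ring
      rw [e5]; linarith
    have e6 : 0 ≤ (D / R^4 * (‖S1‖^4 + ‖S2‖^4)) * ‖ξ‖^4 := by positivity
    by_cases c : ‖S1 ξ‖ ≤ R ∧ ‖S2 ξ‖ ≤ R
    · have := hb ξ c.1 c.2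
      linarith
    · have g1 := (abs_le.1 (b1 (x0 + S1 ξ))).2
      have g2 := (abs_le.1 (b2 (y0 + S2 ξ))).2
      have g3 : 0 ≤ ‖(x0 + S1 ξ) - (y0 + S2 ξ)‖^2 / (2*ε) := by positivity
      have g4 : R^4 ≤ (‖S1‖^4 + ‖S2‖^4) * ‖ξ‖^4 := by
        rw [add_mul, ← mul_pow, ← mul_pow]
        have p1 : 0 ≤ (‖S1‖ * ‖ξ‖)^4 := by positivity
        have p2 : 0 ≤ (‖S2‖ * ‖ξ‖)^4 := by positivity
        by_cases c1 : ‖S1 ξ‖ ≤ R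
        · have c2 : R ≤ ‖S2 ξ‖ := by
            by_contra hh; push Not at hh; exact c ⟨c1, hh.le⟩
          have := pow_le_pow_left₀ hR.le (c2.trans (S2.le_opNorm ξ)) 4
          linarith
        · push Not at c1
          have := pow_le_pow_left₀ hR.le (c1.le.trans (S1.le_opNorm ξ)) 4
          linarith
      have g5 : D ≤ (D / R^4 * (‖S1‖^4 + ‖S2‖^4)) * ‖ξ‖^4 := by
        calc D = D / R^4 * R^4 := by field_simp
          _ ≤ D / R^4 * ((‖S1‖^4 + ‖S2‖^4) * ‖ξ‖^4) := by gcongr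
          _ = _ := by ring
      linarith
  have j1 : Integrable (fun ξ : Eucl n => (a + ‖x0 - y0‖^2 / (2*ε)) + (1/ε) * ⟪x0 - y0, (S1 - S2) ξ⟫) (gam n) :=
    (integrable_const _).add (il.const_mul _)
  have j2 : Integrable (fun ξ : Eucl n => (a + ‖x0 - y0‖^2 / (2*ε)) + (1/ε) * ⟪x0 - y0, (S1 - S2) ξ⟫
      + (‖S1 - S2‖^2 / (2*ε)) * ‖ξ‖^2) (gam n) := j1.add (i3.const_mul (‖S1 - S2‖^2 / (2*ε)))
  have j3 : Integrable (fun ξ : Eucl n => ((a + ‖x0 - y0‖^2 / (2*ε)) + (1/ε) * ⟪x0 - y0, (S1 - S2) ξ⟫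
      + (‖S1 - S2‖^2 / (2*ε)) * ‖ξ‖^2) + (D / R^4 * (‖S1‖^4 + ‖S2‖^4)) * ‖ξ‖^4) (gam n) :=
    j2.add (i4.const_mul (D / R^4 * (‖S1‖^4 + ‖S2‖^4)))
  refine (integral_mono (i1.add i2) j3 key).trans (le_of_eq ?_)
  rw [integral_add j2 (i4.const_mul _), integral_add j1 (i3.const_mul _),
    integral_add (integrable_const _) (il.const_mul _), integral_const_mul, integral_const_mul, integral_const_mul, el]
  simp
  ring

section data2
variable {d : ℕ} {lam Λ M C₀ : ℝ}
    {Q Q' : ℝ → Matrix (Fin (d + 1)) (Fin (d + 1)) ℝ} {v v' : ℝ → Eucl (d + 1)}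

lemma clampT_lip (s t : ℝ) : |clampT s - clampT t| ≤ |s - t| := by
  unfold clampT
  refine (abs_max_sub_max_le_max _ _ _ _).trans ?_
  simp only [sub_self, abs_zero]
  refine max_le (abs_nonneg _) ((abs_min_sub_min_le_max _ _ _ _).trans ?_)
  simp

lemma ObliqueData.mean_near (h : ObliqueData d lam Λ M C₀ Q Q' v v') {b r : ℝ} (hr : 0 ≤ r)
    (i j : Fin (d+1)) :
    |intM Q (b - r) b i j - r * Q (clampT b) i j| ≤ r * (C₀ / lam * r) := by
  have hl := h.lam_pos
  have hC := h.C0_pos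
  have e : intM Q (b - r) b i j - r * Q (clampT b) i j =
      ∫ s in (b - r)..b, (Q (clampT s) i j - Q (clampT b) i j) := by
    rw [intervalIntegral.integral_sub ((h.Qc i j).intervalIntegrable _ _) intervalIntegrable_const]
    simp [intM]
  rw [e]
  have := intervalIntegral.norm_integral_le_of_norm_le_const (a := b - r) (b := b)
    (f := fun s => Q (clampT s) i j - Q (clampT b) i j) (C := C₀ / lam * r) ?_
  · rw [Real.norm_eq_abs] at this
    have e2 : |b - (b - r)| = r := by rw [sub_sub_cancel, abs_of_nonneg hr]
    rw [e2] at this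
    linarith
  · intro s hs
    rw [uIoc_of_le (by linarith)] at hs
    rw [Real.norm_eq_abs]
    refine (h.QLip (clampT_mem s) (clampT_mem b) i j).trans ?_
    have := clampT_lip s b
    have h3 : |s - b| ≤ r := by rw [abs_le]; constructor <;> linarith [hs.1, hs.2]
    have := this.trans h3
    gcongr

lemma ObliqueData.mean_hi (h : ObliqueData d lam Λ M C₀ Q Q' v v') {b r : ℝ} (hr : 0 ≤ r)
    (i j : Fin (d+1)) : |intM Q (b - r) b i j| ≤ r * (Λ * M^2) := by
  have := intervalIntegral.norm_integral_le_of_norm_le_const (a := b - r) (b := b)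
    (f := fun s => Q (clampT s) i j) (C := Λ * M^2)
    (fun s _ => by rw [Real.norm_eq_abs]; exact h.Qentry (clampT_mem s) i j)
  rw [Real.norm_eq_abs] at this
  have e2 : |b - (b - r)| = r := by rw [sub_sub_cancel, abs_of_nonneg hr]
  rw [e2] at this
  rw [mul_comm]; exact this

lemma ObliqueData.mean_lo (h : ObliqueData d lam Λ M C₀ Q Q' v v') {b r : ℝ} (hr : 0 ≤ r)
    (i : Fin (d+1)) : r * (Λ * M^2)⁻¹ ≤ intM Q (b - r) b i i := by
  have := intervalIntegral.integral_mono_on (μ := volume) (f := fun _ => (Λ * M^2)⁻¹)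
    (by linarith : b - r ≤ b)
    (intervalIntegrable_const) ((h.Qc i i).intervalIntegrable (b-r) b)
    (fun s _ => (h.Qdiag (clampT_mem s) i).1)
  rw [intervalIntegral.integral_const, smul_eq_mul, sub_sub_cancel] at this
  exact this

lemma ObliqueData.choose_h2 (h : ObliqueData d lam Λ M C₀ Q Q' v v') (t0 s0 : ℝ) {r : ℝ} (hr : 0 < r) :
    ∃ r2, 0 < r2 ∧ r2 ≤ (Λ * M^2)^2 * r ∧
      intM Q (s0 - r2) s0 (Fin.last d) (Fin.last d) = intM Q (t0 - r) t0 (Fin.last d) (Fin.last d) := by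
  set l := Fin.last d
  have hL := h.Lpos
  set L := Λ * M^2 with hLd
  set f := intM Q (t0 - r) t0 l l with hf
  have hf1 : r * L⁻¹ ≤ f := h.mean_lo hr.le l
  have hf2 : f ≤ r * L := (le_abs_self _).trans (h.mean_hi hr.le l l)
  have hf0 : 0 < f := lt_of_lt_of_le (by positivity) hf1
  have hc : Continuous fun ρ => intM Q (s0 - ρ) s0 l l := by
    have e : (fun ρ => intM Q (s0 - ρ) s0 l l) = fun ρ => - ∫ s in s0..(s0 - ρ), Q (clampT s) l l := by
      funext ρ; simp only [intM]; rw [intervalIntegral.integral_symm]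
    rw [e]
    have := intervalIntegral.continuous_primitive (μ := volume)
      (fun a b => (h.Qc l l).intervalIntegrable a b) s0
    exact (this.comp (continuous_const.sub continuous_id)).neg
  have hpos : 0 ≤ L^2 * r := by positivity
  have h0 : intM Q (s0 - 0) s0 l l = 0 := by simp [intM]
  have h1 : f ≤ intM Q (s0 - L^2 * r) s0 l l := by
    have := h.mean_lo (b := s0) hpos l
    have e : L^2 * r * L⁻¹ = r * L := by field_simp
    rw [← hLd, e] at this
    linarith
  obtain ⟨ρ, ⟨hρ0, hρ1⟩, hρ⟩ := intermediate_value_Icc hpos hc.continuousOn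
    (show f ∈ Icc _ _ from ⟨h0.le.trans hf0.le, h1⟩)
  refine ⟨ρ, lt_of_le_of_ne hρ0 ?_, hρ1, hρ⟩
  rintro rfl
  exact hf0.ne (h0.symm.trans hρ)

set_option maxHeartbeats 1600000 in
lemma ObliqueData.choose_h (h : ObliqueData d lam Λ M C₀ Q Q' v v') :
    ∃ K ≥ 1, ∀ t0 ∈ Icc (-1:ℝ) 0, ∀ s0 ∈ Icc (-1:ℝ) 0, ∀ r > 0, ∃ r2 > 0, r2 ≤ K * r ∧
      |r2 - r| ≤ K * r * (|t0 - s0| + K * r) ∧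
      ∃ S1 S2 : Eucl (d+1) →L[ℝ] Eucl (d+1),
        (∀ k : Eucl (d+1), ‖ContinuousLinearMap.adjoint S1 k‖ ^ 2 = 2 / lam * quad (intM Q (t0 - r) t0) k) ∧
        (∀ k : Eucl (d+1), ‖ContinuousLinearMap.adjoint S2 k‖ ^ 2 = 2 / lam * quad (intM Q (s0 - r2) s0) k) ∧
        (∀ ξ, (S1 ξ) (Fin.last d) = (S2 ξ) (Fin.last d)) ∧
        ‖S1‖^2 ≤ K * r ∧ ‖S2‖^2 ≤ K * r ∧ ‖S1 - S2‖^2 ≤ K * r * (|t0 - s0| + K * r)^2 := by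
  have hL := h.Lpos
  have hl := h.lam_pos
  have hC := h.C0_pos
  set L := Λ * M^2 with hLd
  set q := C₀ / lam with hq
  have hq0 : 0 < q := by positivity
  have hL0 : 0 < L := by linarith
  obtain ⟨K', hK', hmc⟩ := mat_couple (d+1) (Fin.last d) (L^2)⁻¹ (L^2) (by positivity) (by positivity)
  set K0 := 1 + L^2 with hK0
  set a := 2 * L / lam * K'^2 with ha
  have ha0 : 0 < a := by positivity
  set K := K0 + L^3 * q + a + a * (2 * L^5 * q)^2 with hK
  have k1 : K0 ≤ K := by have : 0 ≤ L^3 * q + a + a * (2 * L^5 * q)^2 := by positivity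
                         linarith
  have k2 : L^3 * q ≤ K := by have : 0 ≤ K0 + a + a * (2 * L^5 * q)^2 := by positivity
                              linarith
  have k3 : a ≤ K := by have : 0 ≤ K0 + L^3 * q + a * (2 * L^5 * q)^2 := by positivity
                        linarith
  have k4 : a * (2 * L^5 * q)^2 ≤ K := by have : 0 ≤ K0 + L^3 * q + a := by positivity
                                          linarith
  have k5 : L^2 ≤ K := by linarith
  have k6 : 1 ≤ K := by nlinarith
  refine ⟨K, k6, fun t0 ht s0 hs r hr => ?_⟩
  obtain ⟨r2, hr2, hr2L, hfe⟩ := h.choose_h2 t0 s0 hr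
  rw [← hLd] at hr2L
  set l := Fin.last d
  set I1 := intM Q (t0 - r) t0 with hI1
  set I2 := intM Q (s0 - r2) s0 with hI2
  set f := I1 l l with hf
  set τ := |t0 - s0| with hτ
  have hτ0 : 0 ≤ τ := abs_nonneg _
  have f1 : r * L⁻¹ ≤ f := h.mean_lo hr.le l
  have f2 : f ≤ r * L := (le_abs_self _).trans (h.mean_hi hr.le l l)
  have f3 : f ≤ r2 * L := hfe ▸ (le_abs_self _).trans (h.mean_hi hr2.le l l)
  have f4 : r2 * L⁻¹ ≤ f := hfe ▸ h.mean_lo hr2.le l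
  have f0 : 0 < f := lt_of_lt_of_le (by positivity) f1
  have n1 := fun i j => h.mean_near (b := t0) hr.le i j
  have n2 := fun i j => h.mean_near (b := s0) hr2.le i j
  rw [clampT_eq ht, ← hq, ← hI1] at n1
  rw [clampT_eq hs, ← hq, ← hI2] at n2
  have n3 := fun i j => h.QLip ht hs i j
  rw [← hq, ← hτ] at n3
  set E := r * (τ + K0 * r) with hE
  have hE0 : 0 ≤ E := by positivity
  have b1 : r * (q * r) + r2 * (q * r2) + r2 * (q * τ) ≤ L^2 * q * E := by
    have c1 : r2 * (q * r2) ≤ (L^2 * r) * (q * (L^2 * r)) := by gcongr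
    have c2 : r2 * (q * τ) ≤ (L^2 * r) * (q * τ) := by gcongr
    have c3 : r * (q * r) ≤ (L^2 * r) * (q * r) := by
      have : r ≤ L^2 * r := by nlinarith
      gcongr
    calc _ ≤ (L^2 * r) * (q * r) + (L^2 * r) * (q * (L^2 * r)) + (L^2 * r) * (q * τ) := by linarith
      _ = _ := by rw [hE, hK0]; ring
  have b2 : |r2 - r| ≤ L^3 * q * E := by
    have c1 := abs_le.1 (n1 l l)
    have c2 := abs_le.1 (n2 l l)
    have c3 := abs_le.1 (n3 l l)
    have c4 := (h.Qdiag ht l).1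
    rw [hfe] at c2
    have c5 : |r2 - r| * L⁻¹ ≤ L^2 * q * E := by
      have c6 : |r2 - r| * L⁻¹ ≤ |r2 - r| * Q t0 l l := by gcongr
      have c7 : |r2 - r| * Q t0 l l = |(r2 - r) * Q t0 l l| := by
        rw [abs_mul, abs_of_pos (lt_of_lt_of_le (by positivity) c4)]
      rw [c7] at c6
      refine c6.trans (le_trans ?_ b1)
      have c8 : (r2 - r) * Q t0 l l = (f - r * Q t0 l l) - (f - r2 * Q s0 l l) + r2 * (Q t0 l l - Q s0 l l) := by ring
      have c9 : |r2 * (Q t0 l l - Q s0 l l)| ≤ r2 * (q * τ) := by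
        rw [abs_mul, abs_of_pos hr2]; gcongr; exact n3 l l
      have c9 := abs_le.1 c9
      rw [c8, abs_le]; constructor <;> linarith
    calc |r2 - r| = L * (|r2 - r| * L⁻¹) := by field_simp
      _ ≤ L * (L^2 * q * E) := by gcongr
      _ = _ := by ring
  have b3 : ∀ i j, |I1 i j - I2 i j| ≤ 2 * L^4 * q * E := by
    intro i j
    have c1 := abs_le.1 (n1 i j)
    have c2 := abs_le.1 (n2 i j)
    have c3 : |r2 * (Q t0 i j - Q s0 i j)| ≤ r2 * (q * τ) := by
      rw [abs_mul, abs_of_pos hr2]; gcongr; exact n3 i j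
    have c3 := abs_le.1 c3
    have c4 : |(r2 - r) * Q t0 i j| ≤ L^3 * q * E * L := by
      rw [abs_mul]
      have := h.Qentry ht i j
      gcongr
    have c4 := abs_le.1 c4
    have c5 : L^2 * q * E ≤ L^4 * q * E := by
      have : L^2 ≤ L^4 := pow_le_pow_right₀ hL (by norm_num)
      gcongr
    have c6 : I1 i j - I2 i j = (I1 i j - r * Q t0 i j) - (I2 i j - r2 * Q s0 i j)
      - (r2 - r) * Q t0 i j + r2 * (Q t0 i j - Q s0 i j) := by ring
    rw [c6, abs_le]; constructor <;> linarith
  have hΔ : τ + K0 * r ≤ τ + K * r := by gcongr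
  have hB : ∀ (I : Matrix (Fin (d+1)) (Fin (d+1)) ℝ) (ρ : ℝ), 0 < ρ → ρ * L⁻¹ ≤ f →
      (∀ i j, |I i j| ≤ ρ * L) → ∀ i j, |(f⁻¹ • I) i j| ≤ L^2 := by
    intro I ρ hρ hρf hI i j
    rw [Matrix.smul_apply, smul_eq_mul, abs_mul, abs_of_pos (inv_pos.2 f0), inv_mul_le_iff₀ f0]
    calc _ ≤ ρ * L := hI i j
      _ = (ρ * L⁻¹) * L^2 := by field_simp
      _ ≤ _ := by gcongr
  have hq2 : ∀ (b ρ : ℝ), 0 < ρ → f ≤ ρ * L → ∀ k, (L^2)⁻¹ * ∑ i, k i ^ 2 ≤ quad (f⁻¹ • intM Q (b - ρ) b) k := by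
    intro b ρ hρ hρf k
    rw [quad_smul, le_inv_mul_iff₀ f0]
    have := h.intM_lo (by linarith : b - ρ ≤ b) k
    rw [sub_sub_cancel, ← hLd] at this
    refine le_trans ?_ this
    have hs : 0 ≤ ∑ i, k i ^ 2 := Finset.sum_nonneg fun i _ => sq_nonneg _
    calc f * ((L^2)⁻¹ * ∑ i, k i ^ 2) ≤ (ρ * L) * ((L^2)⁻¹ * ∑ i, k i ^ 2) := by gcongr
      _ = _ := by field_simp
  have hδ : ∀ i j, |(f⁻¹ • I1) i j - (f⁻¹ • I2) i j| ≤ 2 * L^5 * q * (τ + K0 * r) := by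
    intro i j
    rw [Matrix.smul_apply, Matrix.smul_apply, ← smul_sub, smul_eq_mul, abs_mul, abs_of_pos (inv_pos.2 f0),
      inv_mul_le_iff₀ f0]
    calc _ ≤ 2 * L^4 * q * E := b3 i j
      _ = (r * L⁻¹) * (2 * L^5 * q * (τ + K0 * r)) := by rw [hE]; field_simp
      _ ≤ _ := by gcongr
  obtain ⟨S1, S2, hS1, hS2, hSl, hN1, hN2, hN⟩ := hmc (f⁻¹ • I1) (f⁻¹ • I2)
    ((h.intM_symm _ _).smul _) ((h.intM_symm _ _).smul _)
    (by rw [Matrix.smul_apply, smul_eq_mul]; exact inv_mul_cancel₀ f0.ne')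
    (by rw [Matrix.smul_apply, smul_eq_mul, hfe]; exact inv_mul_cancel₀ f0.ne')
    (hq2 t0 r hr f2) (hq2 s0 r2 hr2 f3)
    (hB I1 r hr f1 (fun i j => h.mean_hi hr.le i j)) (hB I2 r2 hr2 f4 (fun i j => h.mean_hi hr2.le i j))
    _ hδ
  set c := Real.sqrt (2 / lam * f) with hc
  have hc2 : c^2 = 2 / lam * f := Real.sq_sqrt (by positivity)
  have hc0 : 0 ≤ c := Real.sqrt_nonneg _
  have hcb : c^2 ≤ 2 / lam * (r * L) := by rw [hc2]; gcongr
  have hadj : ∀ (S : Eucl (d+1) →L[ℝ] Eucl (d+1)) (I : Matrix (Fin (d+1)) (Fin (d+1)) ℝ),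
      (∀ k : Eucl (d+1), ‖ContinuousLinearMap.adjoint S k‖ ^ 2 = quad (f⁻¹ • I) k) →
      ∀ k : Eucl (d+1), ‖ContinuousLinearMap.adjoint (c • S) k‖ ^ 2 = 2 / lam * quad I k := by
    intro S I hS k
    have : ContinuousLinearMap.adjoint (c • S) = c • ContinuousLinearMap.adjoint S := by simp
    rw [this, smul_apply, norm_smul, mul_pow, hS, Real.norm_eq_abs, sq_abs, hc2, quad_smul]
    field_simp
  have hno : ∀ (S : Eucl (d+1) →L[ℝ] Eucl (d+1)) (m : ℝ), ‖S‖ ≤ m → ‖c • S‖^2 ≤ 2 * L / lam * m^2 * r := by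
    intro S m hm
    rw [norm_smul, mul_pow, Real.norm_eq_abs, sq_abs]
    have : ‖S‖^2 ≤ m^2 := pow_le_pow_left₀ (norm_nonneg _) hm 2
    calc c^2 * ‖S‖^2 ≤ (2 / lam * (r * L)) * m^2 := by gcongr
      _ = _ := by ring
  refine ⟨r2, hr2, hr2L.trans (by gcongr), ?_, c • S1, c • S2, hadj S1 I1 hS1, hadj S2 I2 hS2, ?_, ?_, ?_, ?_⟩
  · calc |r2 - r| ≤ L^3 * q * E := b2
      _ = L^3 * q * r * (τ + K0 * r) := by rw [hE]; ring
      _ ≤ _ := by gcongr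
  · intro ξ
    have := hSl ξ
    simp [this]
  · exact (hno S1 K' hN1).trans (by gcongr)
  · exact (hno S2 K' hN2).trans (by gcongr)
  · have es : c • S1 - c • S2 = c • (S1 - S2) := by ext ξ; simp [mul_sub]
    rw [es]
    refine (hno _ _ hN).trans ?_
    calc _ = a * (2 * L^5 * q)^2 * r * (τ + K0 * r)^2 := by rw [ha]; ring
      _ ≤ _ := by gcongr

end data2

lemma Kc_nbhd {d : ℕ} {p : SpaceTime (d+1)} (hp : p ∈ Kc d 1) : ∃ R > 0, ∃ h0 > 0,
    ∀ R' ≤ R, ∀ r ≤ h0, closedBall p.1 R' ×ˢ Icc (p.2 - r) p.2 ⊆ Kc d 1 := by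
  rw [mem_Kc] at hp
  obtain ⟨h1, h2, h3, h4⟩ := hp
  refine ⟨min ((1 - ‖p.1‖)/2) (lastC p.1 / 2), lt_min (by linarith) (by linarith), (p.2 + 1)/2, by linarith, ?_⟩
  rintro R' hR r hr x ⟨hx, hx1, hx2⟩
  have a1 := hR.trans (min_le_left _ _)
  have a2 := hR.trans (min_le_right _ _)
  rw [mem_closedBall, dist_eq_norm] at hx
  rw [mem_Kc]
  have b1 : ‖x.1‖ ≤ ‖p.1‖ + ‖x.1 - p.1‖ := by
    have := norm_add_le p.1 (x.1 - p.1); rwa [add_sub_cancel] at this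
  have b2 := abs_lastC_le (x.1 - p.1)
  rw [lastC_sub] at b2
  have b3 := (abs_le.1 b2).1
  refine ⟨by linarith, by linarith, by linarith, by linarith⟩

section data3
variable {d : ℕ} {lam Λ M C₀ : ℝ}
    {Q Q' : ℝ → Matrix (Fin (d + 1)) (Fin (d + 1)) ℝ} {v v' : ℝ → Eucl (d + 1)}
    {u w : SpaceTime (d+1) → ℝ}

lemma one_side (hD : ObliqueData d lam Λ M C₀ Q Q' v v') (hu : ObliqueSub d lam Q v u)
    (huc : ContinuousOn u (closure (Kc d 1))) {C KA : ℝ} (hC : 0 ≤ C)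
    (hKA : lam * KA = 2 * ((d:ℝ)+1) * (Λ*M^2) + 4 * ((d:ℝ)+1)^2 * (Λ*M^2))
    (hCu : ∀ p ∈ closure (Kc d 1), |u p| ≤ C)
    {x0 : Eucl (d+1)} {t0 r R : ℝ} (hr : 0 < r) (hR : 0 < R) (hR4 : R ≤ 1/4)
    (hZ : closedBall x0 R ×ˢ Icc (t0 - r) t0 ⊆ Kc d 1)
    (S : Eucl (d+1) →L[ℝ] Eucl (d+1))
    (hS : ∀ k : Eucl (d+1), ‖ContinuousLinearMap.adjoint S k‖ ^ 2 = 2 / lam * quad (intM Q (t0 - r) t0) k) :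
    ∃ G : Eucl (d+1) → ℝ, Continuous G ∧ (∀ x, |G x| ≤ C) ∧ (∀ x ∈ closedBall x0 R, G x = u (x, t0 - r)) ∧
      u (x0, t0) ≤ ∫ ξ, G (x0 + S ξ) ∂(gam (d+1)) + (2*C+1)/R^4*(KA * r)^2 := by
  have hsub : closedBall x0 R ×ˢ Icc (t0 - r) t0 ⊆ closure (Kc d 1) := hZ.trans subset_closure
  have hm : ∀ x ∈ closedBall x0 R, (x, t0 - r) ∈ closedBall x0 R ×ˢ Icc (t0 - r) t0 :=
    fun x hx => ⟨hx, le_rfl, by simp only; linarith⟩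
  have c0 := mem_Kc.1 (hZ (hm x0 (mem_closedBall_self hR.le)))
  have c1 := mem_Kc.1 (hZ (show (x0, t0) ∈ _ from ⟨mem_closedBall_self hR.le, by simp only [mem_Icc]; constructor <;> linarith⟩))
  simp only at c0 c1
  obtain ⟨G, g1, g2, g3, g4⟩ := trig_ext x0 R C hR4 hC (fun x => u (x, t0 - r))
    ((huc.mono hsub).comp (by fun_prop) hm) (fun x hx => hCu _ (hsub (hm x hx)))
  refine ⟨G, g1, g2, g3, ?_⟩
  have := AL hD u x0 (t0 - r) t0 R C KA (by linarith) (by linarith) (by linarith) hR hKA (huc.mono hsub)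
    (fun p hp => hCu p (hsub hp)) (visc_of_sub hu hZ) G g1 g2 g3 g4 S hS
  rwa [sub_sub_cancel] at this

set_option maxHeartbeats 1000000 in
lemma interior_ineq (hD : ObliqueData d lam Λ M C₀ Q Q' v v') (huc : ContinuousOn u (closure (Kc d 1)))
    (hwc : ContinuousOn w (closure (Kc d 1))) (hu : ObliqueSub d lam Q v u) (hw : ObliqueSup d lam Q v w)
    {κ ε : ℝ} (hκ : 0 < κ) (hε : 0 < ε) {p q : SpaceTime (d+1)} (hp : p ∈ Kc d 1) (hq : q ∈ Kc d 1)
    (hpq : lastC p.1 = lastC q.1) (hmax : DMax d u w κ ε p q) {K : ℝ} (hK : 1 ≤ K)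
    (hch : ∀ r > 0, ∃ r2 > 0, r2 ≤ K * r ∧
      |r2 - r| ≤ K * r * (|p.2 - q.2| + K * r) ∧
      ∃ S1 S2 : Eucl (d+1) →L[ℝ] Eucl (d+1),
        (∀ k : Eucl (d+1), ‖ContinuousLinearMap.adjoint S1 k‖ ^ 2 = 2 / lam * quad (intM Q (p.2 - r) p.2) k) ∧
        (∀ k : Eucl (d+1), ‖ContinuousLinearMap.adjoint S2 k‖ ^ 2 = 2 / lam * quad (intM Q (q.2 - r2) q.2) k) ∧
        (∀ ξ, (S1 ξ) (Fin.last d) = (S2 ξ) (Fin.last d)) ∧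
        ‖S1‖^2 ≤ K * r ∧ ‖S2‖^2 ≤ K * r ∧ ‖S1 - S2‖^2 ≤ K * r * (|p.2 - q.2| + K * r)^2) :
    ∃ h0 > 0, ∃ C3, ∀ r > 0, r ≤ h0 → κ ≤ (K * (|p.2 - q.2| + K * r)^2 * (∫ ξ, ‖ξ‖^2 ∂(gam (d+1)))
      + 2 * |p.2 - q.2| * (K * (|p.2 - q.2| + K * r)) + K^2 * r * (|p.2 - q.2| + K * r)^2) / (2 * ε) + C3 * r := by
  obtain ⟨Cu, hCu⟩ := clK_compact.exists_bound_of_continuousOn huc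
  obtain ⟨Cw, hCw⟩ := clK_compact.exists_bound_of_continuousOn hwc
  set C := max Cu Cw with hCd
  have hCu' : ∀ x ∈ closure (Kc d 1), |u x| ≤ C := fun x hx => (hCu x hx).trans (le_max_left _ _)
  have hCw' : ∀ x ∈ closure (Kc d 1), |-w x| ≤ C := fun x hx => by
    rw [abs_neg]; exact (hCw x hx).trans (le_max_right _ _)
  have hC : 0 ≤ C := (abs_nonneg _).trans (hCu' p (subset_closure hp))
  obtain ⟨R1, hR1, a1, ha1, z1⟩ := Kc_nbhd hp
  obtain ⟨R2, hR2, a2, ha2, z2⟩ := Kc_nbhd hq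
  set R := min (1/4) (min R1 R2) with hRd
  have hR : 0 < R := lt_min (by norm_num) (lt_min hR1 hR2)
  have hR4 : R ≤ 1/4 := min_le_left _ _
  have hRR1 : R ≤ R1 := (min_le_right _ _).trans (min_le_left _ _)
  have hRR2 : R ≤ R2 := (min_le_right _ _).trans (min_le_right _ _)
  have hl := hD.lam_pos
  set KA := (2 * ((d:ℝ)+1) * (Λ*M^2) + 4 * ((d:ℝ)+1)^2 * (Λ*M^2)) / lam with hKA
  have hKA' : lam * KA = 2 * ((d:ℝ)+1) * (Λ*M^2) + 4 * ((d:ℝ)+1)^2 * (Λ*M^2) := by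
    rw [hKA]; field_simp
  have hL := hD.Lpos
  have hKA0 : 0 ≤ KA := by positivity
  set m := u p - w q - κ * p.2 - (‖p.1 - q.1‖^2 + (p.2 - q.2)^2) / (2 * ε) with hm
  set D := 2 * C + |m| + κ with hDd
  have hD0 : 0 ≤ D := by positivity
  set m2 := ∫ ξ, ‖ξ‖^2 ∂(gam (d+1)) with hm2
  set m4 := ∫ ξ, ‖ξ‖^4 ∂(gam (d+1)) with hm4
  have hm20 : 0 ≤ m2 := integral_nonneg fun ξ => by positivity
  have hm40 : 0 ≤ m4 := integral_nonneg fun ξ => by positivity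
  set τ := |p.2 - q.2| with hτ
  have hτ0 : 0 ≤ τ := abs_nonneg _
  refine ⟨min a1 (a2 / K), lt_min ha1 (by positivity),
    (2*C+1)/R^4*KA^2 + (2*C+1)/R^4*(KA*K)^2 + D/R^4*((2*K^2)*m4), fun r hr hr0 => ?_⟩
  obtain ⟨r2, hr2, hr2K, hrr, S1, S2, hS1, hS2, hSl, n1, n2, n3⟩ := hch r hr
  have r1a : r ≤ a1 := hr0.trans (min_le_left _ _)
  have r2a : r2 ≤ a2 := by
    have := hr0.trans (min_le_right _ _)
    rw [le_div_iff₀ (by linarith)] at this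
    linarith
  have Z1 := z1 R hRR1 r r1a
  have Z2 := z2 R hRR2 r2 r2a
  obtain ⟨G1, g1, g2, g3, g4⟩ := one_side hD hu huc hC hKA' hCu' hr hR hR4 Z1 S1 hS1
  obtain ⟨G2, k1, k2, k3, k4⟩ := one_side hD (sup_neg hw) hwc.neg hC hKA' hCw' hr2 hR hR4 Z2 S2 hS2
  set a := m + κ * (p.2 - r) + (p.2 - r - (q.2 - r2))^2 / (2 * ε) with had
  have hp2 := mem_Kc.1 (Z1 (show (p.1, p.2 - r) ∈ _ from ⟨mem_closedBall_self hR.le, by simp only [mem_Icc]; constructor <;> linarith⟩))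
  simp only at hp2
  have gc := gauss_couple G1 G2 C a D ε R hε hR hD0 g1 k1 g2 k2 S1 S2 p.1 q.1 ?_ ?_
  rotate_left
  · intro ξ x1 x2
    have m1 : p.1 + S1 ξ ∈ closedBall p.1 R := by simpa using x1
    have m2 : q.1 + S2 ξ ∈ closedBall q.1 R := by simpa using x2
    rw [g3 _ m1, k3 _ m2]
    have e1 : (p.1 + S1 ξ, p.2 - r) ∈ closure (Kc d 1) :=
      subset_closure (Z1 ⟨m1, by simp only [mem_Icc]; constructor <;> linarith⟩)
    have e2 : (q.1 + S2 ξ, q.2 - r2) ∈ closure (Kc d 1) :=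
      subset_closure (Z2 ⟨m2, by simp only [mem_Icc]; constructor <;> linarith⟩)
    have := hmax _ e1 _ e2 (by
      simp only
      rw [lastC_add, lastC_add, hpq]
      simp only [lastC, hSl ξ])
    rw [← hm] at this
    simp only at this
    rw [add_div] at this
    rw [had]
    linarith
  · have s1 : -|m| ≤ m := neg_abs_le m
    have s2 : 0 ≤ (p.2 - r - (q.2 - r2))^2 / (2 * ε) := by positivity
    have s3 : κ * (-1) ≤ κ * (p.2 - r) := by gcongr; exact hp2.2.2.1.le
    rw [hDd, had]; linarith
  have q4 : ‖S1‖^4 + ‖S2‖^4 ≤ 2 * K^2 * r^2 := by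
    have e1 : ‖S1‖^4 ≤ (K*r)^2 := by
      rw [show ‖S1‖^4 = (‖S1‖^2)^2 by ring]; exact pow_le_pow_left₀ (by positivity) n1 2
    have e2 : ‖S2‖^4 ≤ (K*r)^2 := by
      rw [show ‖S2‖^4 = (‖S2‖^2)^2 by ring]; exact pow_le_pow_left₀ (by positivity) n2 2
    have e3 : 2 * K^2 * r^2 = (K*r)^2 + (K*r)^2 := by ring
    rw [e3]; exact add_le_add e1 e2
  have q5 : D / R^4 * ((‖S1‖^4 + ‖S2‖^4) * m4) ≤ D / R^4 * ((2 * K^2 * r^2) * m4) := by gcongr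
  have q6 : (2*C+1)/R^4*(KA * r2)^2 ≤ (2*C+1)/R^4*(KA * (K * r))^2 := by gcongr
  have q7 : (p.2 - r - (q.2 - r2))^2 ≤ (p.2 - q.2)^2 + 2 * τ * (K * r * (τ + K * r)) + (K * r * (τ + K * r))^2 := by
    have e1 : (p.2 - q.2) * (r2 - r) ≤ τ * (K * r * (τ + K * r)) := by
      refine (le_abs_self _).trans ?_
      rw [abs_mul]; gcongr
    have e2 : (r2 - r)^2 ≤ (K * r * (τ + K * r))^2 := by
      rw [← sq_abs (r2 - r)]; exact pow_le_pow_left₀ (abs_nonneg _) hrr 2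
    have e3 : (p.2 - r - (q.2 - r2))^2 = (p.2 - q.2)^2 + 2 * ((p.2 - q.2) * (r2 - r)) + (r2 - r)^2 := by ring
    rw [e3]; linarith
  have q8 : ‖S1 - S2‖^2 * m2 ≤ (K * r * (τ + K * r)^2) * m2 := by gcongr
  have q9 : ((p.2 - r - (q.2 - r2))^2 + ‖S1 - S2‖^2 * m2) / (2 * ε) ≤
      (((p.2 - q.2)^2 + 2 * τ * (K * r * (τ + K * r)) + (K * r * (τ + K * r))^2) + (K * r * (τ + K * r)^2) * m2) / (2 * ε) := by
    gcongr
  have e0 : u p = u (p.1, p.2) := rfl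
  have e1 : w q = w (q.1, q.2) := rfl
  have fin : κ * r ≤ r * ((K * (τ + K * r)^2 * m2
      + 2 * τ * (K * (τ + K * r)) + K^2 * r * (τ + K * r)^2) / (2 * ε) + 
      ((2*C+1)/R^4*KA^2 + (2*C+1)/R^4*(KA*K)^2 + D/R^4*((2*K^2)*m4)) * r) := by
    have k4' : -w q ≤ ∫ ξ, G2 (q.1 + S2 ξ) ∂(gam (d+1)) + (2*C+1)/R^4*(KA * r2)^2 := k4
    have g4' : u p ≤ ∫ ξ, G1 (p.1 + S1 ξ) ∂(gam (d+1)) + (2*C+1)/R^4*(KA * r)^2 := g4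
    have em : u p - w q = m + κ * p.2 + ‖p.1 - q.1‖^2/(2*ε) + (p.2 - q.2)^2 / (2 * ε) := by
      rw [hm]; ring
    have t1 : (‖p.1 - q.1‖^2 + ‖S1 - S2‖^2 * m2) / (2 * ε) = ‖p.1 - q.1‖^2/(2*ε) + ‖S1 - S2‖^2 * m2 / (2 * ε) := add_div _ _ _
    rw [add_div] at q9
    have t2 : r * ((K * (τ + K * r)^2 * m2
      + 2 * τ * (K * (τ + K * r)) + K^2 * r * (τ + K * r)^2) / (2 * ε) + 
      ((2*C+1)/R^4*KA^2 + (2*C+1)/R^4*(KA*K)^2 + D/R^4*((2*K^2)*m4)) * r) = 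
      (((p.2 - q.2)^2 + 2 * τ * (K * r * (τ + K * r)) + (K * r * (τ + K * r))^2) + (K * r * (τ + K * r)^2) * m2) / (2 * ε) 
       - (p.2 - q.2)^2 / (2 * ε) + (2*C+1)/R^4*(KA * r)^2 + (2*C+1)/R^4*(KA * (K * r))^2 + D / R^4 * ((2 * K^2 * r^2) * m4) := by
      ring
    rw [t2]
    rw [t1] at gc
    rw [had] at gc
    linarith
  rw [mul_comm κ r] at fin
  exact le_of_mul_le_mul_left fin hr

lemma interior_case (hD : ObliqueData d lam Λ M C₀ Q Q' v v') (huc : ContinuousOn u (closure (Kc d 1)))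
    (hwc : ContinuousOn w (closure (Kc d 1))) (hu : ObliqueSub d lam Q v u) (hw : ObliqueSup d lam Q v w)
    {κ : ℝ} (hκ : 0 < κ) : ∃ η₀ > 0, ∀ ε, 0 < ε → ε < 1 → ∀ p ∈ Kc d 1, ∀ q ∈ Kc d 1,
      lastC p.1 = lastC q.1 → ‖p.1 - q.1‖^2 + (p.2 - q.2)^2 ≤ η₀ * ε → DMax d u w κ ε p q → False := by
  obtain ⟨K, hK, hch⟩ := hD.choose_h
  set m2 := ∫ ξ, ‖ξ‖^2 ∂(gam (d+1)) with hm2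
  have hm20 : 0 ≤ m2 := integral_nonneg fun ξ => by positivity
  have hP : 0 < K * m2 + 2 * K := by positivity
  refine ⟨κ / (K * m2 + 2 * K), by positivity, fun ε hε _ p hp q hq hpq hη hmax => ?_⟩
  have hp2 := mem_Kc.1 hp
  have hq2 := mem_Kc.1 hq
  obtain ⟨h0, hh0, C3, hin⟩ := interior_ineq hD huc hwc hu hw hκ hε hp hq hpq hmax hK
    (hch p.2 ⟨hp2.2.2.1.le, hp2.2.2.2⟩ q.2 ⟨hq2.2.2.1.le, hq2.2.2.2⟩)
  rw [← hm2] at hin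
  set τ := |p.2 - q.2| with hτ
  have ht : Filter.Tendsto (fun r : ℝ => (K * (τ + K * r)^2 * m2
      + 2 * τ * (K * (τ + K * r)) + K^2 * r * (τ + K * r)^2) / (2 * ε) + C3 * r) (nhdsWithin 0 (Ioi 0))
      (nhds ((K * (τ + K * 0)^2 * m2
      + 2 * τ * (K * (τ + K * 0)) + K^2 * 0 * (τ + K * 0)^2) / (2 * ε) + C3 * 0)) := by
    apply Filter.Tendsto.mono_left _ nhdsWithin_le_nhds
    exact Continuous.tendsto (f := fun r : ℝ => (K * (τ + K * r)^2 * m2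
      + 2 * τ * (K * (τ + K * r)) + K^2 * r * (τ + K * r)^2) / (2 * ε) + C3 * r) (by fun_prop) 0
  have hle := ge_of_tendsto ht (b := κ) (by
    filter_upwards [Ioc_mem_nhdsGT hh0] with r hr
    exact hin r hr.1 hr.2)
  have e1 : (K * (τ + K * 0)^2 * m2
      + 2 * τ * (K * (τ + K * 0)) + K^2 * 0 * (τ + K * 0)^2) / (2 * ε) + C3 * 0 = (K * m2 + 2 * K) * τ^2 / (2 * ε) := by
    ring
  rw [e1, le_div_iff₀ (by positivity)] at hle
  have e2 : τ^2 ≤ κ / (K * m2 + 2 * K) * ε := by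
    rw [hτ, sq_abs]
    have : 0 ≤ ‖p.1 - q.1‖^2 := by positivity
    linarith
  have e3 : (K * m2 + 2 * K) * τ^2 ≤ (K * m2 + 2 * K) * (κ / (K * m2 + 2 * K) * ε) := by gcongr
  have e4 : (K * m2 + 2 * K) * (κ / (K * m2 + 2 * K) * ε) = κ * ε := by field_simp
  have : 0 < κ * ε := by positivity
  linarith

end data3

/-- **Comparison principle for the linearized oblique problem.** If `η_sub` is a viscosity
subsolution and `η_sup` a viscosity supersolution of the linearized oblique problem on
`K₁⁺`, both continuous on `K̄₁`, and `η_sub ≤ η_sup` on `∂_bK₁`, then `η_sub ≤ η_sup` in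
`K₁`. -/
theorem oblique_comparison (d : ℕ) (hd : 1 ≤ d) (lam Λ M C₀ : ℝ)
    (Q Q' : ℝ → Matrix (Fin (d + 1)) (Fin (d + 1)) ℝ) (v v' : ℝ → Eucl (d + 1))
    (hdata : ObliqueData d lam Λ M C₀ Q Q' v v')
    (ηsub ηsup : SpaceTime (d + 1) → ℝ)
    (hcsub : ContinuousOn ηsub (closure (Kc d 1)))
    (hcsup : ContinuousOn ηsup (closure (Kc d 1)))
    (hsub : ObliqueSub d lam Q v ηsub)
    (hsup : ObliqueSup d lam Q v ηsup)
    (hbdry : ∀ p ∈ bdryK d, ηsub p ≤ ηsup p) :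
    ∀ p ∈ Kc d 1, ηsub p ≤ ηsup p := by
  intro ph hph
  by_contra hlt
  push Not at hlt
  obtain ⟨κ, hκ, hs⟩ := setup hcsub hcsup hbdry hph hlt
  obtain ⟨η₁, h1, hb⟩ := boundary_case hdata hcsup hsub hsup hκ
  obtain ⟨η₂, h2, hi⟩ := interior_case hdata hcsub hcsup hsub hsup hκ
  obtain ⟨ε, hε, hε1, p, hp, q, hq, hpq, hd2, hmax⟩ := hs (min η₁ η₂) (lt_min h1 h2)
  have e1 : min η₁ η₂ * ε ≤ η₁ * ε := by gcongr; exact min_le_left _ _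
  have e2 : min η₁ η₂ * ε ≤ η₂ * ε := by gcongr; exact min_le_right _ _
  rcases hp with hp | hp <;> rcases hq with hq | hq
  · exact hi ε hε hε1 p hp q hq hpq (hd2.trans e2) hmax
  · exact absurd (hpq.trans hq.2.1) hp.2.1.ne'
  · exact absurd (hpq.symm.trans hp.2.1) hq.2.1.ne'
  · exact hb ε hε hε1 p hp q hq (hd2.trans e1) hmax
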